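/- Let m ≥ 2, let 1 < q⃗_k < ∞ for k = 1,…,m, and let 1/q⃗ = 1/q⃗_1 + ⋯ + 1/q⃗_m (componentwise). If b⃗ = (b_1,…,b_m) with each b_k ∈ BMO(ℝ^n), then for each i ∈ {1,…,m} the operator M^{b⃗}_{m,i}, and hence also M^{b⃗}_m = Σ_{i=1}^m M^{b⃗}_{m,i}, is bounded from L^{q⃗_1}(ℝ^n)×⋯×L^{q⃗_m}(ℝ^n) to L^{q⃗}(ℝ^n): there is C > 0 such that ‖M^{b⃗}_{m,i}(f⃗)‖_{L^{q⃗}} ≤ C ‖b⃗‖_{BMO^m} Π_{k=1}^m ‖f_k‖_{L^{q⃗_k}} for all f_k ∈ L^{q⃗_k}(ℝ^n), where ‖b⃗‖_{BMO^m} = max_{1≤k≤m} ‖b_k‖_{BMO}. -/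

import Mathlib

open MeasureTheory ENNReal Set

noncomputable section

/-- Euclidean distance on `Fin n → ℝ`. -/
def eudist (n : ℕ) (x y : Fin n → ℝ) : ℝ :=
  Real.sqrt (∑ i, (x i - y i) ^ 2)

/-- Open Euclidean ball in `Fin n → ℝ`. -/
def eball (n : ℕ) (x : Fin n → ℝ) (r : ℝ) : Set (Fin n → ℝ) :=
  {y | eudist n x y < r}

/-- Iterated mixed Lebesgue "norm" of an `ℝ≥0∞`-valued function: the innermost
integration is in the first coordinate with exponent `q 0`, the outermost in the
last coordinate with exponent `q (n-1)`. -/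
def mixedLnorm : (n : ℕ) → (Fin n → ℝ) → ((Fin n → ℝ) → ℝ≥0∞) → ℝ≥0∞
  | 0, _, g => g (fun i => i.elim0)
  | (n + 1), q, g =>
      (∫⁻ t : ℝ, (mixedLnorm n (fun i => q i.castSucc)
          (fun y => g (Fin.snoc y t))) ^ q (Fin.last n)) ^ (1 / q (Fin.last n))

/-- Mixed Lebesgue norm `‖f‖_{L^{q⃗}}` of a real-valued function on `ℝ^n`. -/
def mixedNorm (n : ℕ) (q : Fin n → ℝ) (f : (Fin n → ℝ) → ℝ) : ℝ≥0∞ :=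
  mixedLnorm n q (fun x => ENNReal.ofReal |f x|)

/-- Generalized mixed Morrey norm of an `ℝ≥0∞`-valued function. -/
def morreyLnorm (n : ℕ) (q : Fin n → ℝ) (φ : (Fin n → ℝ) → ℝ → ℝ)
    (g : (Fin n → ℝ) → ℝ≥0∞) : ℝ≥0∞ :=
  ⨆ (x : Fin n → ℝ) (r : ℝ) (_ : 0 < r),
    (ENNReal.ofReal (φ x r))⁻¹
      * (mixedNorm n q ((eball n x r).indicator fun _ => (1 : ℝ)))⁻¹
      * mixedLnorm n q ((eball n x r).indicator g)

/-- Generalized mixed Morrey norm `‖f‖_{M^φ_{q⃗}}` of a real-valued function. -/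
def morreyNorm (n : ℕ) (q : Fin n → ℝ) (φ : (Fin n → ℝ) → ℝ → ℝ)
    (f : (Fin n → ℝ) → ℝ) : ℝ≥0∞ :=
  morreyLnorm n q φ (fun x => ENNReal.ofReal |f x|)

/-- The BMO norm (as an extended real number). -/
def bmoNorm (n : ℕ) (b : (Fin n → ℝ) → ℝ) : ℝ≥0∞ :=
  ⨆ (x : Fin n → ℝ) (r : ℝ) (_ : 0 < r),
    ENNReal.ofReal ((volume (eball n x r)).toReal⁻¹
      * ∫ y in eball n x r, |b y - ⨍ z in eball n x r, b z|)

/-- Sublinearity in each entry of a multi-(sub)linear operator. -/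
def EntrywiseSublinear (n m : ℕ)
    (T : (Fin m → ((Fin n → ℝ) → ℝ)) → ((Fin n → ℝ) → ℝ)) : Prop :=
  (∀ (f : Fin m → ((Fin n → ℝ) → ℝ)) (i : Fin m) (g h : (Fin n → ℝ) → ℝ)
      (x : Fin n → ℝ),
      |T (Function.update f i (g + h)) x|
        ≤ |T (Function.update f i g) x| + |T (Function.update f i h) x|) ∧
  (∀ (f : Fin m → ((Fin n → ℝ) → ℝ)) (i : Fin m) (c : ℝ) (g : (Fin n → ℝ) → ℝ)
      (x : Fin n → ℝ),
      |T (Function.update f i (c • g)) x| = |c| * |T (Function.update f i g) x|)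

/-- The multi-sublinear size condition (1.1) with constant `C`. -/
def SizeCond (n m : ℕ)
    (T : (Fin m → ((Fin n → ℝ) → ℝ)) → ((Fin n → ℝ) → ℝ)) (C : ℝ) : Prop :=
  ∀ f : Fin m → ((Fin n → ℝ) → ℝ),
    (∀ i, Integrable (f i)) → (∀ i, HasCompactSupport (f i)) →
    ∀ x, x ∉ ⋂ j, Function.support (f j) →
      |T f x| ≤ C * ∫ y : Fin m → (Fin n → ℝ),
        (∏ i, |f i (y i)|) / Real.sqrt (∑ i, eudist n x (y i) ^ 2) ^ (m * n)

/-- The multi-sublinear commutator size condition (1.2), with symbol `b` and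
distinguished index `i`, with constant `C`. -/
def CommSizeCond (n m : ℕ) (b : (Fin n → ℝ) → ℝ) (i : Fin m)
    (T : (Fin m → ((Fin n → ℝ) → ℝ)) → ((Fin n → ℝ) → ℝ)) (C : ℝ) : Prop :=
  ∀ f : Fin m → ((Fin n → ℝ) → ℝ),
    (∀ k, Integrable (f k)) → (∀ k, HasCompactSupport (f k)) →
    ∀ x, x ∉ ⋂ j, Function.support (f j) →
      |T f x| ≤ C * ∫ y : Fin m → (Fin n → ℝ),
        |b x - b (y i)| * (∏ k, |f k (y k)|)
          / Real.sqrt (∑ k, eudist n x (y k) ^ 2) ^ (m * n)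

/-- The Hardy–Littlewood maximal operator. -/
def hlMax (n : ℕ) (f : (Fin n → ℝ) → ℝ) (x : Fin n → ℝ) : ℝ≥0∞ :=
  ⨆ (r : ℝ) (_ : 0 < r),
    (volume (eball n x r))⁻¹ * ∫⁻ y in eball n x r, ENNReal.ofReal |f y|

/-- The maximal commutator of the Hardy–Littlewood maximal operator. -/
def maxComm (n : ℕ) (b f : (Fin n → ℝ) → ℝ) (x : Fin n → ℝ) : ℝ≥0∞ :=
  ⨆ (r : ℝ) (_ : 0 < r),
    (volume (eball n x r))⁻¹
      * ∫⁻ y in eball n x r, ENNReal.ofReal (|b x - b y| * |f y|)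

/-- The multi-sublinear maximal operator `M_m`. -/
def multiMax (n m : ℕ) (f : Fin m → ((Fin n → ℝ) → ℝ)) (x : Fin n → ℝ) : ℝ≥0∞ :=
  ⨆ (r : ℝ) (_ : 0 < r),
    ∏ i, (volume (eball n x r))⁻¹ * ∫⁻ y in eball n x r, ENNReal.ofReal |f i y|

/-- The multi-sublinear maximal commutator `M^{b⃗}_{m,i}`. -/
def multiMaxComm (n m : ℕ) (b : Fin m → ((Fin n → ℝ) → ℝ)) (i : Fin m)
    (f : Fin m → ((Fin n → ℝ) → ℝ)) (x : Fin n → ℝ) : ℝ≥0∞ :=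
  (⨆ (r : ℝ) (_ : 0 < r),
      (volume (eball n x r))⁻¹
        * ∫⁻ y in eball n x r, ENNReal.ofReal (|b i x - b i y| * |f i y|)) *
  (⨆ (r : ℝ) (_ : 0 < r),
      ∏ k ∈ Finset.univ.erase i,
        (volume (eball n x r))⁻¹ * ∫⁻ y in eball n x r, ENNReal.ofReal |f k y|)

/-- `w` is an `A₁` weight with constant `c`. -/
def IsA1Weight (n : ℕ) (w : (Fin n → ℝ) → ℝ) (c : ℝ) : Prop :=
  (∀ x, 0 < w x) ∧ LocallyIntegrable w ∧
    ∀ (x : Fin n → ℝ) (r : ℝ), 0 < r →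
      ∀ᵐ y ∂(volume.restrict (eball n x r)),
        (volume (eball n x r)).toReal⁻¹ * ∫ z in eball n x r, w z ≤ c * w y

/-- `T` is an `m`-linear Calderón–Zygmund operator. -/
def IsCZOperator (n m : ℕ)
    (T : (Fin m → ((Fin n → ℝ) → ℝ)) → ((Fin n → ℝ) → ℝ)) : Prop :=
  -- additivity in each entry
  (∀ (f : Fin m → ((Fin n → ℝ) → ℝ)) (i : Fin m) (g h : (Fin n → ℝ) → ℝ),
      T (Function.update f i (g + h))
        = T (Function.update f i g) + T (Function.update f i h)) ∧
  -- homogeneity in each entry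
  (∀ (f : Fin m → ((Fin n → ℝ) → ℝ)) (i : Fin m) (c : ℝ) (g : (Fin n → ℝ) → ℝ),
      T (Function.update f i (c • g)) = c • T (Function.update f i g)) ∧
  -- boundedness from a product of Lebesgue spaces
  (∃ (s : Fin m → ℝ) (s₀ A : ℝ), (∀ i, 1 ≤ s i) ∧ 0 < s₀ ∧
      (1 / s₀ = ∑ i, 1 / s i) ∧ 0 < A ∧
      ∀ f : Fin m → ((Fin n → ℝ) → ℝ), (∀ i, Measurable (f i)) →
        (∀ i, mixedNorm n (fun _ => s i) (f i) ≠ ⊤) →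
        mixedNorm n (fun _ => s₀) (T f)
          ≤ ENNReal.ofReal A * ∏ i, mixedNorm n (fun _ => s i) (f i)) ∧
  -- Calderón–Zygmund kernel and representation
  (∃ (K : (Fin n → ℝ) → (Fin m → (Fin n → ℝ)) → ℝ) (ε C : ℝ), 0 < ε ∧ 0 < C ∧
      -- size estimate
      (∀ x y, ¬(∀ k, y k = x) →
        |K x y| ≤ C / (∑ k, eudist n x (y k)) ^ (m * n)) ∧
      -- regularity in the first variable
      (∀ x x' y, ¬(∀ k, y k = x) →
        2 * eudist n x x' ≤ (⨆ k, eudist n x (y k)) →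
        |K x y - K x' y|
          ≤ C * eudist n x x' ^ ε / (∑ k, eudist n x (y k)) ^ ((m * n : ℝ) + ε)) ∧
      -- regularity in each of the remaining variables
      (∀ x y (k : Fin m) (y' : Fin n → ℝ), ¬(∀ j, y j = x) →
        2 * eudist n (y k) y' ≤ (⨆ j, eudist n x (y j)) →
        |K x y - K x (Function.update y k y')|
          ≤ C * eudist n (y k) y' ^ ε / (∑ j, eudist n x (y j)) ^ ((m * n : ℝ) + ε)) ∧
      -- integral representation off the supports
      (∀ f : Fin m → ((Fin n → ℝ) → ℝ),
        (∀ j, Measurable (f j)) → (∀ j, ∃ M : ℝ, ∀ x, |f j x| ≤ M) →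
        (∀ j, HasCompactSupport (f j)) →
        ∀ x, x ∉ ⋂ j, Function.support (f j) →
          T f x = ∫ y : Fin m → (Fin n → ℝ), K x y * ∏ j, f j (y j)))

/-- The commutator `K^{b⃗}_{m,i}` of an `m`-linear operator. -/
def czComm (n m : ℕ) (T : (Fin m → ((Fin n → ℝ) → ℝ)) → ((Fin n → ℝ) → ℝ))
    (b : Fin m → ((Fin n → ℝ) → ℝ)) (i : Fin m)
    (f : Fin m → ((Fin n → ℝ) → ℝ)) : (Fin n → ℝ) → ℝ :=
  fun x => b i x * T f x - T (Function.update f i fun y => b i y * f i y) x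

set_option linter.unusedVariables false
set_option linter.unusedSectionVars false
set_option linter.unusedSimpArgs false
set_option linter.unnecessarySimpa false

/-- A filtration by partitions of a measure space. -/
structure Filt (α : Type) [MeasurableSpace α] (μ : Measure α) where
  P : ℕ → α → Set α
  D : ℝ≥0∞
  hD : D ≠ ⊤
  self_mem : ∀ k x, x ∈ P k x
  eq_of_mem : ∀ k x y, y ∈ P k x → P k y = P k x
  anti : ∀ k x, P (k + 1) x ⊆ P k x
  meas : ∀ k, MeasurableSet {z : α × α | z.2 ∈ P k z.1}
  pos : ∀ k x, μ (P k x) ≠ 0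
  fin : ∀ k x, μ (P k x) ≠ ⊤
  reg : ∀ k x, μ (P k x) ≤ D * μ (P (k + 1) x)

namespace Filt

variable {α : Type} [MeasurableSpace α] {μ : Measure α} (F : Filt α μ)

/-- Conditional expectation. -/
def E (k : ℕ) (f : α → ℝ≥0∞) (x : α) : ℝ≥0∞ :=
  (μ (F.P k x))⁻¹ * ∫⁻ y in F.P k x, f y ∂μ

/-- Adapted functions: constant on atoms. -/
def Ad {β : Type} (k : ℕ) (h : α → β) : Prop := ∀ x y, y ∈ F.P k x → h y = h x

lemma mP (k : ℕ) (x : α) : MeasurableSet (F.P k x) := by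
  have := F.meas k
  exact (measurable_prodMk_left (x := x)) this

lemma mem_symm {k : ℕ} {x y : α} (h : y ∈ F.P k x) : x ∈ F.P k y := by
  rw [F.eq_of_mem k x y h]; exact F.self_mem k x

lemma mem_iff {k : ℕ} {x y : α} : y ∈ F.P k x ↔ x ∈ F.P k y := ⟨F.mem_symm, F.mem_symm⟩

lemma anti' {j k : ℕ} (h : j ≤ k) (x : α) : F.P k x ⊆ F.P j x := by
  induction h with
  | refl => exact subset_rfl
  | step _ ih => exact (F.anti _ x).trans ih

variable {F} in
lemma Ad.mono {β : Type} {j k : ℕ} {h : α → β} (hh : F.Ad j h) (hjk : j ≤ k) : F.Ad k h :=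
  fun x y hy => hh x y (F.anti' hjk x hy)

lemma E_ad (k : ℕ) (f : α → ℝ≥0∞) : F.Ad k (F.E k f) := by
  intro x y hy
  simp only [E, F.eq_of_mem k x y hy]

lemma E_ad' {j k : ℕ} (hjk : j ≤ k) (f : α → ℝ≥0∞) : F.Ad k (F.E j f) :=
  (F.E_ad j f).mono hjk

lemma E_mono {k : ℕ} {f g : α → ℝ≥0∞} (h : ∀ x, f x ≤ g x) (x : α) : F.E k f x ≤ F.E k g x := by
  unfold E; gcongr; exact h _

lemma E_mono_on {k : ℕ} {f g : α → ℝ≥0∞} (x : α) (h : ∀ y ∈ F.P k x, f y ≤ g y) :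
    F.E k f x ≤ F.E k g x := by
  unfold E
  exact mul_le_mul' le_rfl (setLIntegral_mono' (F.mP k x) h)

lemma E_congr_on {k : ℕ} {f g : α → ℝ≥0∞} (x : α) (h : ∀ y ∈ F.P k x, f y = g y) :
    F.E k f x = F.E k g x :=
  le_antisymm (F.E_mono_on x fun y hy => (h y hy).le) (F.E_mono_on x fun y hy => (h y hy).ge)

lemma E_ae_mono {k : ℕ} {f g : α → ℝ≥0∞} (h : ∀ᵐ x ∂μ, f x ≤ g x) (x : α) :
    F.E k f x ≤ F.E k g x := by
  unfold E
  gcongr 1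
  exact lintegral_mono_ae (ae_restrict_of_ae h)

lemma E_const (k : ℕ) (c : ℝ≥0∞) (x : α) : F.E k (fun _ => c) x = c := by
  simp only [E, lintegral_const, Measure.restrict_apply MeasurableSet.univ, univ_inter]
  rw [mul_comm c, ← mul_assoc, ENNReal.inv_mul_cancel (F.pos k x) (F.fin k x), one_mul]

lemma E_add {k : ℕ} {f : α → ℝ≥0∞} (hf : Measurable f) (g : α → ℝ≥0∞) (x : α) :
    F.E k (fun y => f y + g y) x = F.E k f x + F.E k g x := by
  simp only [E]
  rw [lintegral_add_left hf, mul_add]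

lemma E_sum {ι : Type} (s : Finset ι) {k : ℕ} {f : ι → α → ℝ≥0∞} (hf : ∀ i ∈ s, Measurable (f i))
    (x : α) : F.E k (fun y => ∑ i ∈ s, f i y) x = ∑ i ∈ s, F.E k (f i) x := by
  simp only [E]
  rw [lintegral_finsetSum _ hf, Finset.mul_sum]

lemma E_ad_mul {k : ℕ} {h f : α → ℝ≥0∞} (hh : F.Ad k h) (hf : Measurable f) (x : α) :
    F.E k (fun y => h y * f y) x = h x * F.E k f x := by
  rw [F.E_congr_on (g := fun y => h x * f y) x fun y hy => by rw [hh x y hy]]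
  simp only [E]
  rw [lintegral_const_mul _ hf, mul_left_comm]

lemma E_const_mul {k : ℕ} (c : ℝ≥0∞) {f : α → ℝ≥0∞} (hf : Measurable f) (x : α) :
    F.E k (fun y => c * f y) x = c * F.E k f x :=
  F.E_ad_mul (h := fun _ => c) (fun _ _ _ => rfl) hf x

lemma E_of_ad {k : ℕ} {h : α → ℝ≥0∞} (hh : F.Ad k h) (x : α) : F.E k h x = h x := by
  have := F.E_ad_mul hh (f := fun _ => 1) measurable_const x
  simpa [F.E_const] using this

lemma E_indicator (k : ℕ) (f : α → ℝ≥0∞) (x : α) :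
    ∫⁻ y in F.P k x, f y ∂μ = ∫⁻ y, {z : α × α | z.2 ∈ F.P k z.1}.indicator 1 (x, y) * f y ∂μ := by
  rw [← lintegral_indicator (F.mP k x)]
  congr 1 with y
  by_cases h : y ∈ F.P k x <;> simp [Set.indicator, h]

variable [SigmaFinite μ]

lemma measurable_setE {β : Type} [MeasurableSpace β] (k : ℕ) {f : α → β → ℝ≥0∞}
    (hf : Measurable (Function.uncurry f)) :
    Measurable (fun z : α × β => ∫⁻ t in F.P k z.1, f t z.2 ∂μ) := by
  simp only [F.E_indicator]
  apply Measurable.lintegral_prod_right'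
    (f := fun w : (α × β) × α => {z : α × α | z.2 ∈ F.P k z.1}.indicator 1 (w.1.1, w.2) * f w.2 w.1.2)
  apply Measurable.mul
  · exact (measurable_one.indicator (F.meas k)).comp
      ((measurable_fst.comp measurable_fst).prodMk measurable_snd)
  · exact hf.comp (measurable_snd.prodMk (measurable_snd.comp measurable_fst))

lemma measurable_muP (k : ℕ) : Measurable (fun x : α => μ (F.P k x)) := by
  have := F.measurable_setE (β := Unit) k (f := fun _ _ => 1) measurable_const
  have h2 := this.comp (measurable_id.prodMk (measurable_const (a := ())))
  simpa [Function.comp_def] using h2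

lemma measurable_E2 {β : Type} [MeasurableSpace β] (k : ℕ) {f : α → β → ℝ≥0∞}
    (hf : Measurable (Function.uncurry f)) :
    Measurable (fun z : α × β => F.E k (fun t => f t z.2) z.1) :=
  ((F.measurable_muP k).comp measurable_fst).inv.mul (F.measurable_setE k hf)

lemma measurable_setE1 (k : ℕ) {f : α → ℝ≥0∞} (hf : Measurable f) :
    Measurable (fun x : α => ∫⁻ t in F.P k x, f t ∂μ) := by
  simp only [F.E_indicator]
  apply Measurable.lintegral_prod_right'
    (f := fun w : α × α => {z : α × α | z.2 ∈ F.P k z.1}.indicator 1 (w.1, w.2) * f w.2)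
  exact (measurable_one.indicator (F.meas k)).mul (hf.comp measurable_snd)

lemma measurable_E (k : ℕ) {f : α → ℝ≥0∞} (hf : Measurable f) : Measurable (F.E k f) :=
  (F.measurable_muP k).inv.mul (F.measurable_setE1 k hf)

lemma lintegral_E (k : ℕ) {f : α → ℝ≥0∞} (hf : Measurable f) :
    ∫⁻ x, F.E k f x ∂μ = ∫⁻ x, f x ∂μ := by
  simp only [E, F.E_indicator]
  have hm : Measurable (fun z : α × α => {z : α × α | z.2 ∈ F.P k z.1}.indicator (1 : α × α → ℝ≥0∞) z) :=
    measurable_one.indicator (F.meas k)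
  calc ∫⁻ x, (μ (F.P k x))⁻¹ * ∫⁻ y, {z : α × α | z.2 ∈ F.P k z.1}.indicator 1 (x, y) * f y ∂μ ∂μ
      = ∫⁻ x, ∫⁻ y, (μ (F.P k x))⁻¹ * ({z : α × α | z.2 ∈ F.P k z.1}.indicator 1 (x, y) * f y) ∂μ ∂μ := by
        congr 1 with x
        rw [lintegral_const_mul]
        exact (hm.comp measurable_prodMk_left).mul hf
    _ = ∫⁻ y, ∫⁻ x, (μ (F.P k x))⁻¹ * ({z : α × α | z.2 ∈ F.P k z.1}.indicator 1 (x, y) * f y) ∂μ ∂μ := by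
        apply lintegral_lintegral_swap
        exact (((F.measurable_muP k).comp measurable_fst).inv.mul
          (hm.mul (hf.comp measurable_snd))).aemeasurable
    _ = ∫⁻ y, f y ∂μ := by
        congr 1 with y
        have : ∀ x, (μ (F.P k x))⁻¹ * ({z : α × α | z.2 ∈ F.P k z.1}.indicator 1 (x, y) * f y)
            = (F.P k y).indicator (fun _ => (μ (F.P k y))⁻¹ * f y) x := by
          intro x
          by_cases h : y ∈ F.P k x
          · have h' := F.mem_symm h
            rw [Set.indicator_of_mem h', Set.indicator_of_mem (by exact h), F.eq_of_mem k x y h]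
            simp
          · have h' : x ∉ F.P k y := fun h'' => h (F.mem_symm h'')
            simp [Set.indicator, h, h']
        simp only [this]
        rw [lintegral_indicator (F.mP k y)]
        simp only [lintegral_const, Measure.restrict_apply MeasurableSet.univ, univ_inter]
        rw [mul_right_comm, ENNReal.inv_mul_cancel (F.pos k y) (F.fin k y), one_mul]

lemma lintegral_ad_mul_E {k : ℕ} {h f : α → ℝ≥0∞} (hh : F.Ad k h) (hm : Measurable h)
    (hf : Measurable f) : ∫⁻ x, h x * F.E k f x ∂μ = ∫⁻ x, h x * f x ∂μ := by
  rw [← F.lintegral_E k (f := fun x => h x * f x) (hm.mul hf)]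
  congr 1 with x
  exact (F.E_ad_mul hh hf x).symm

lemma indicator_ad {j k : ℕ} (hjk : j ≤ k) (x : α) :
    F.Ad k ((F.P j x).indicator (1 : α → ℝ≥0∞)) := by
  intro y z hz
  have hz' := F.anti' hjk y hz
  have h1 : z ∈ F.P j x ↔ y ∈ F.P j x := by
    rw [F.mem_iff, F.mem_iff (y := y), F.eq_of_mem j y z hz']
  by_cases h : y ∈ F.P j x
  · simp [Set.indicator, h, h1.2 h]
  · have h2 : z ∉ F.P j x := fun h' => h (h1.1 h')
    simp [Set.indicator, h, h2]

lemma setlintegral_E {j k : ℕ} (hjk : j ≤ k) {f : α → ℝ≥0∞} (hf : Measurable f) (x : α) :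
    ∫⁻ y in F.P j x, F.E k f y ∂μ = ∫⁻ y in F.P j x, f y ∂μ := by
  have := F.lintegral_ad_mul_E (F.indicator_ad hjk x) (measurable_one.indicator (F.mP j x)) hf
  rw [← lintegral_indicator (F.mP j x), ← lintegral_indicator (F.mP j x)]
  convert this using 2 <;>
  · ext y; by_cases h : y ∈ F.P j x <;> simp [h]

lemma tower {j k : ℕ} (hjk : j ≤ k) {f : α → ℝ≥0∞} (hf : Measurable f) (x : α) :
    F.E j (F.E k f) x = F.E j f x := by
  unfold E
  rw [← F.setlintegral_E hjk hf x]
  rfl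

lemma E_reg (k : ℕ) (f : α → ℝ≥0∞) (x : α) : F.E (k + 1) f x ≤ F.D * F.E k f x := by
  unfold E
  rw [← mul_assoc]
  apply mul_le_mul'
  · have h := F.reg k x
    rw [ENNReal.inv_le_iff_le_mul (by intro h; simp [ENNReal.mul_eq_top, F.hD, F.pos k x] at h)
      (fun h => by simp [F.fin] at h)]
    rw [← mul_assoc]
    calc (1 : ℝ≥0∞) = μ (F.P k x) * (μ (F.P k x))⁻¹ := (ENNReal.mul_inv_cancel (F.pos k x) (F.fin k x)).symm
      _ ≤ (F.D * μ (F.P (k + 1) x)) * (μ (F.P k x))⁻¹ := by gcongr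
      _ = _ := by ring
  · exact lintegral_mono_set (F.anti k x)

lemma jensen {p : ℝ} (hp : 1 ≤ p) (k : ℕ) {f : α → ℝ≥0∞} (hf : Measurable f) (x : α) :
    F.E k f x ^ p ≤ F.E k (fun y => f y ^ p) x := by
  rcases hp.eq_or_lt with rfl | hp
  · simp
  have hpq : p.HolderConjugate (p.conjExponent) := Real.HolderConjugate.conjExponent hp
  have h := ENNReal.lintegral_mul_le_Lp_mul_Lq (μ.restrict (F.P k x)) hpq hf.aemeasurable
    (g := fun _ => 1) aemeasurable_const
  simp only [Pi.mul_apply, mul_one, ENNReal.one_rpow, lintegral_const, one_mul,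
    Measure.restrict_apply MeasurableSet.univ, univ_inter] at h
  have hp0 : 0 < p := by linarith
  unfold E
  rw [ENNReal.mul_rpow_of_nonneg _ _ hp0.le]
  calc _ ≤ (μ (F.P k x))⁻¹ ^ p * ((∫⁻ y in F.P k x, f y ^ p ∂μ) ^ (1 / p)
          * μ (F.P k x) ^ (1 / p.conjExponent)) ^ p := by gcongr
    _ = (μ (F.P k x))⁻¹ * ∫⁻ y in F.P k x, f y ^ p ∂μ := by
      rw [ENNReal.mul_rpow_of_nonneg _ _ hp0.le, ← ENNReal.rpow_mul, ← ENNReal.rpow_mul,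
        one_div_mul_cancel hp0.ne', ENNReal.rpow_one, mul_comm (lintegral _ _), ← mul_assoc]
      congr 1
      rw [ENNReal.inv_rpow, ← ENNReal.rpow_neg, ← ENNReal.rpow_add _ _ (F.pos k x) (F.fin k x),
        ← ENNReal.rpow_neg_one]
      congr 1
      have := hpq.inv_add_inv_eq_one
      have e : 1 / p.conjExponent = 1 - p⁻¹ := by rw [one_div]; linarith
      rw [e]; field_simp; ring

lemma E_liminf {k : ℕ} {f : ℕ → α → ℝ≥0∞} (hf : ∀ i, Measurable (f i)) (x : α) :
    F.E k (fun y => Filter.liminf (fun i => f i y) Filter.atTop) x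
      ≤ Filter.liminf (fun i => F.E k (f i) x) Filter.atTop := by
  unfold E
  calc _ ≤ (μ (F.P k x))⁻¹ * Filter.liminf (fun i => ∫⁻ y in F.P k x, f i y ∂μ) Filter.atTop := by
        gcongr; exact lintegral_liminf_le hf
    _ = _ := (ENNReal.liminf_const_mul_of_ne_top (ENNReal.inv_ne_top.2 (F.pos k x))).symm

lemma lintegral_E_rpow {p : ℝ} (hp : 1 ≤ p) (k : ℕ) {f : α → ℝ≥0∞} (hf : Measurable f) :
    ∫⁻ x, F.E k f x ^ p ∂μ ≤ ∫⁻ x, f x ^ p ∂μ := by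
  rw [← F.lintegral_E k (hf.pow_const p)]
  exact lintegral_mono fun x => F.jensen hp k hf x

end Filt

/-- increments of a sequence -/
def inc (a : ℕ → ℝ≥0∞) : ℕ → ℝ≥0∞
  | 0 => a 0
  | k + 1 => a (k + 1) - a k

lemma sum_inc {a : ℕ → ℝ≥0∞} (ha : Monotone a) (K : ℕ) :
    ∑ k ∈ Finset.range (K + 1), inc a k = a K := by
  induction K with
  | zero => simp [inc]
  | succ K ih => rw [Finset.sum_range_succ, ih, inc, add_tsub_cancel_of_le (ha (Nat.le_succ K))]

namespace Filt

variable {α : Type} [MeasurableSpace α] {μ : Measure α} (F : Filt α μ)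

/-- Truncated maximal function. -/
def mx (K : ℕ) (f : α → ℝ≥0∞) (x : α) : ℝ≥0∞ := ⨆ (k : ℕ) (_ : k ≤ K), F.E k f x

lemma E_le_mx {k K : ℕ} (h : k ≤ K) (f : α → ℝ≥0∞) (x : α) : F.E k f x ≤ F.mx K f x :=
  le_iSup₂ (f := fun k (_ : k ≤ K) => F.E k f x) k h

lemma mx_le {K : ℕ} {f : α → ℝ≥0∞} {x : α} {c : ℝ≥0∞} (h : ∀ k ≤ K, F.E k f x ≤ c) :
    F.mx K f x ≤ c := iSup₂_le h

lemma mx_monotone (f : α → ℝ≥0∞) (x : α) : Monotone (fun K => F.mx K f x) := by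
  intro a b hab
  exact F.mx_le fun k hk => F.E_le_mx (hk.trans hab) f x

lemma mx_mono {K : ℕ} {f g : α → ℝ≥0∞} (h : ∀ x, f x ≤ g x) (x : α) : F.mx K f x ≤ F.mx K g x :=
  F.mx_le fun k hk => (F.E_mono h x).trans (F.E_le_mx hk g x)

lemma mx_ad (K : ℕ) (f : α → ℝ≥0∞) : F.Ad K (F.mx K f) := by
  intro x y hy
  unfold mx
  refine iSup_congr fun k => iSup_congr fun hk => F.E_ad' hk f x y hy

lemma mx_succ (K : ℕ) (f : α → ℝ≥0∞) (x : α) :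
    F.mx (K + 1) f x = max (F.mx K f x) (F.E (K + 1) f x) := by
  apply le_antisymm
  · apply F.mx_le
    intro k hk
    rcases Nat.le_succ_iff.1 hk with h | rfl
    · exact le_max_of_le_left (F.E_le_mx h f x)
    · exact le_max_right _ _
  · exact max_le (F.mx_monotone f x (Nat.le_succ K)) (F.E_le_mx le_rfl f x)

lemma mx_zero (f : α → ℝ≥0∞) (x : α) : F.mx 0 f x = F.E 0 f x :=
  le_antisymm (F.mx_le fun k hk => by rw [Nat.le_zero.1 hk]) (F.E_le_mx le_rfl f x)

variable [SigmaFinite μ]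

lemma measurable_mx (K : ℕ) {f : α → ℝ≥0∞} (hf : Measurable f) : Measurable (F.mx K f) := by
  unfold mx
  exact Measurable.iSup fun k => Measurable.iSup fun _ => F.measurable_E k hf

lemma measurable_mx2 {β : Type} [MeasurableSpace β] (K : ℕ) {f : α → β → ℝ≥0∞}
    (hf : Measurable (Function.uncurry f)) :
    Measurable (fun z : α × β => F.mx K (fun t => f t z.2) z.1) := by
  unfold mx
  exact Measurable.iSup fun k => Measurable.iSup fun _ => F.measurable_E2 k hf

lemma mx_le_sum (K : ℕ) (f : α → ℝ≥0∞) (x : α) :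
    F.mx K f x ≤ ∑ k ∈ Finset.range (K + 1), F.E k f x :=
  F.mx_le fun k hk => Finset.single_le_sum (f := fun k => F.E k f x) (fun _ _ => zero_le)
    (Finset.mem_range.2 (Nat.lt_succ_of_le hk))

end Filt

lemma measurable_inc {α : Type} [MeasurableSpace α] {a : ℕ → α → ℝ≥0∞} (ha : ∀ k, Measurable (a k))
    (k : ℕ) : Measurable (fun x => inc (fun k => a k x) k) := by
  cases k with
  | zero => exact ha 0
  | succ k => exact (ha _).sub (ha _)

lemma Filt.inc_ad {α : Type} [MeasurableSpace α] {μ : Measure α} (F : Filt α μ) {a : ℕ → α → ℝ≥0∞}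
    (ha : ∀ k, F.Ad k (a k)) (k : ℕ) : F.Ad k (fun x => inc (fun k => a k x) k) := by
  intro x y hy
  cases k with
  | zero => exact ha 0 x y hy
  | succ k =>
    simp only [inc]
    rw [ha (k + 1) x y hy, (ha k).mono (Nat.le_succ k) x y hy]

lemma selfimp {p : ℝ} (hp : 1 < p) {I c Z : ℝ≥0∞} (hI : I ≠ ⊤)
    (h : I ≤ c * (I ^ (1 - 1 / p) * Z ^ (1 / p))) : I ≤ c ^ p * Z := by
  have hp0 : 0 < p := by linarith
  rcases eq_or_ne I 0 with rfl | h0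
  · simp
  have h1 : I ^ (1 - 1 / p) ≠ 0 := by simp [ENNReal.rpow_eq_zero_iff, h0, hI]
  have h2 : I ^ (1 - 1 / p) ≠ ⊤ := by simp [ENNReal.rpow_eq_top_iff, h0, hI]
  have h3 : I ^ (1 / p) ≤ c * Z ^ (1 / p) := by
    rw [← ENNReal.mul_le_mul_iff_right h1 h2]
    calc I ^ (1 - 1 / p) * I ^ (1 / p) = I := by
          rw [← ENNReal.rpow_add _ _ h0 hI]; simp
      _ ≤ _ := h
      _ = _ := by ring
  calc I = (I ^ (1 / p)) ^ p := by rw [← ENNReal.rpow_mul, one_div_mul_cancel hp0.ne', ENNReal.rpow_one]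
    _ ≤ (c * Z ^ (1 / p)) ^ p := by gcongr
    _ = _ := by
      rw [ENNReal.mul_rpow_of_nonneg _ _ hp0.le, ← ENNReal.rpow_mul, one_div_mul_cancel hp0.ne', ENNReal.rpow_one]

lemma rpow_split {p : ℝ} (hp : 1 < p) (x : ℝ≥0∞) : x * x ^ (p - 1) = x ^ p := by
  conv_lhs => rw [← ENNReal.rpow_one x, ← ENNReal.rpow_mul, one_mul]
  rw [← ENNReal.rpow_add_of_nonneg _ _ (by norm_num) (by linarith)]
  congr 1; ring

/-- Young's inequality. -/
lemma youngE {p : ℝ} (hp : 1 < p) (x y : ℝ≥0∞) :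
    (1 + ENNReal.ofReal (p - 1)) * (x * y ^ (p - 1)) ≤ x ^ p + ENNReal.ofReal (p - 1) * y ^ p := by
  have hpq : p.HolderConjugate (p.conjExponent) := Real.HolderConjugate.conjExponent hp
  have h := ENNReal.young_inequality x (y ^ (p - 1)) hpq
  have hp0 : 0 < p := by linarith
  have hp1 : 0 < p - 1 := by linarith
  have e : (1 + ENNReal.ofReal (p - 1)) = ENNReal.ofReal p := by
    rw [← ENNReal.ofReal_one, ← ENNReal.ofReal_add zero_le_one hp1.le]; congr 1; ring
  have hq : p.conjExponent = p / (p - 1) := rfl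
  have hq0 : 0 < p / (p - 1) := by positivity
  have hP0 : ENNReal.ofReal p ≠ 0 := by simp [hp0]
  rw [e]
  calc _ ≤ ENNReal.ofReal p * (x ^ p / ENNReal.ofReal p + (y ^ (p - 1)) ^ p.conjExponent / ENNReal.ofReal p.conjExponent) := by gcongr
    _ = _ := by
      rw [mul_add, ENNReal.mul_div_cancel hP0 ofReal_ne_top]
      congr 1
      rw [← ENNReal.rpow_mul, hq, mul_div_cancel₀ _ hp1.ne', ENNReal.ofReal_div_of_pos hp1,
        div_eq_mul_inv, ENNReal.inv_div (by simp) (by simp [hp, hp0]), div_eq_mul_inv]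
      rw [mul_left_comm, mul_left_comm (ENNReal.ofReal p), ENNReal.mul_inv_cancel hP0 ofReal_ne_top, mul_one, mul_comm]

lemma holder1 {α : Type} [MeasurableSpace α] {μ : Measure α} {p : ℝ} (hp : 1 < p)
    {h f : α → ℝ≥0∞} (hh : Measurable h) (hf : Measurable f) :
    ∫⁻ x, h x ^ (p - 1) * f x ∂μ ≤ (∫⁻ x, h x ^ p ∂μ) ^ (1 - 1 / p) * (∫⁻ x, f x ^ p ∂μ) ^ (1 / p) := by
  have hpq : p.HolderConjugate (p.conjExponent) := Real.HolderConjugate.conjExponent hp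
  have h1 := ENNReal.lintegral_mul_le_Lp_mul_Lq μ hpq.symm (hh.pow_const (p - 1)).aemeasurable hf.aemeasurable
  have hp1 : 0 < p - 1 := by linarith
  have hq : p.conjExponent = p / (p - 1) := rfl
  have e1 : (p - 1) * p.conjExponent = p := by rw [hq, mul_div_cancel₀ _ hp1.ne']
  have e2 : 1 / p.conjExponent = 1 - 1 / p := by
    have := hpq.inv_add_inv_eq_one
    rw [one_div, one_div]; linarith
  simp only [← ENNReal.rpow_mul, e1, e2] at h1
  exact h1

lemma sum_inc_rpow {a : ℕ → ℝ≥0∞} (ha : Monotone a) {r : ℝ} (hr : 0 ≤ r) (K : ℕ) :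
    ∑ k ∈ Finset.range (K + 1), inc (fun k => a k ^ r) k = a K ^ r :=
  sum_inc (a := fun k => a k ^ r) (fun i j h => ENNReal.rpow_le_rpow (ha h) hr) K

lemma doob_det {p : ℝ} (hp : 1 < p) (x u : ℕ → ℝ≥0∞) (hx : ∀ k, x k ≠ ⊤)
    (h0 : u 0 = x 0) (hs : ∀ k, u (k + 1) = max (u k) (x (k + 1))) (K : ℕ) :
    ENNReal.ofReal (p - 1) * u K ^ p ≤
      (1 + ENNReal.ofReal (p - 1)) * ∑ k ∈ Finset.range (K + 1), inc (fun k => u k ^ (p - 1)) k * x k := by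
  set c := ENNReal.ofReal (p - 1)
  induction K with
  | zero =>
    simp only [zero_add, Finset.range_one, Finset.sum_singleton, inc, h0]
    rw [mul_comm (x 0 ^ (p - 1)), rpow_split hp]
    gcongr; exact le_add_self
  | succ K ih =>
    rw [Finset.sum_range_succ, mul_add, inc]
    rcases le_total (x (K + 1)) (u K) with h | h
    · rw [hs, max_eq_left h]
      exact ih.trans le_self_add
    · rw [hs, max_eq_right h]
      set X := x (K + 1)
      set U := u K
      have hXp : X ^ p ≠ ⊤ := ENNReal.rpow_ne_top_of_nonneg (by linarith) (hx _)
      have key : c * X ^ p ≤ c * U ^ p + (1 + c) * ((X ^ (p - 1) - U ^ (p - 1)) * X) := by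
        rw [← ENNReal.add_le_add_iff_left hXp]
        calc X ^ p + c * X ^ p = (1 + c) * (X * X ^ (p - 1)) := by rw [rpow_split hp]; ring
          _ = (1 + c) * (X * (U ^ (p - 1) + (X ^ (p - 1) - U ^ (p - 1)))) := by
              rw [add_tsub_cancel_of_le (ENNReal.rpow_le_rpow h (by linarith))]
          _ = (1 + c) * (X * U ^ (p - 1)) + (1 + c) * ((X ^ (p - 1) - U ^ (p - 1)) * X) := by ring
          _ ≤ (X ^ p + c * U ^ p) + _ := by gcongr; exact youngE hp X U
          _ = _ := by ring
      exact key.trans (by gcongr)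

lemma up_det {p : ℝ} (hp : 1 < p) (a R : ℕ → ℝ≥0∞) (ha : Monotone a) (K : ℕ) (hK : a K ≠ ⊤)
    (h0 : a K ≤ R 0) (hs : ∀ k < K, a K ≤ a k + R (k + 1)) :
    a K ^ p ≤ (1 + ENNReal.ofReal (p - 1)) *
      ∑ k ∈ Finset.range (K + 1), inc (fun k => a k ^ (p - 1)) k * R k := by
  set c := ENNReal.ofReal (p - 1)
  have main : ∀ k ≤ K, (1 + c) * (a K * a k ^ (p - 1)) ≤
      (1 + c) * ∑ i ∈ Finset.range (k + 1), inc (fun k => a k ^ (p - 1)) i * R i + c * a k ^ p := by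
    intro k
    induction k with
    | zero =>
      intro _
      simp only [zero_add, Finset.range_one, Finset.sum_singleton, inc]
      refine le_add_right ?_
      rw [mul_comm (a K)]; gcongr
    | succ k ih =>
      intro hk
      have ih := ih (by omega)
      rw [Finset.sum_range_succ, inc]
      set x := a k
      set y := a (k + 1)
      have hxy : x ≤ y := ha (Nat.le_succ k)
      have hx : x ≠ ⊤ := ne_top_of_le_ne_top hK (ha (by omega))
      have hxp : x ^ p ≠ ⊤ := ENNReal.rpow_ne_top_of_nonneg (by linarith) hx
      set d := y ^ (p - 1) - x ^ (p - 1) with hd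
      have hd' : x ^ (p - 1) + d = y ^ (p - 1) := add_tsub_cancel_of_le (ENNReal.rpow_le_rpow hxy (by linarith))
      have key : c * x ^ p + (1 + c) * (x * d) ≤ c * y ^ p := by
        rw [← ENNReal.add_le_add_iff_left hxp]
        calc x ^ p + (c * x ^ p + (1 + c) * (x * d)) = (1 + c) * (x * (x ^ (p - 1) + d)) := by
              rw [mul_add x, rpow_split hp]; ring
          _ ≤ _ := by rw [hd']; exact youngE hp x y
      set S := ∑ i ∈ Finset.range (k + 1), inc (fun k => a k ^ (p - 1)) i * R i
      calc (1 + c) * (a K * y ^ (p - 1)) = (1 + c) * (a K * x ^ (p - 1)) + (1 + c) * (a K * d) := by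
            rw [← hd']; ring
        _ ≤ ((1 + c) * S + c * x ^ p) + (1 + c) * ((x + R (k + 1)) * d) := by
            gcongr; exact hs k (by omega)
        _ = (1 + c) * (S + d * R (k + 1)) + (c * x ^ p + (1 + c) * (x * d)) := by ring
        _ ≤ _ := by gcongr
  have h := main K le_rfl
  rw [rpow_split hp] at h
  have hKp : c * a K ^ p ≠ ⊤ := ENNReal.mul_ne_top ofReal_ne_top (ENNReal.rpow_ne_top_of_nonneg (by linarith) hK)
  rw [← ENNReal.add_le_add_iff_right hKp]
  calc _ = (1 + c) * a K ^ p := by ring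
    _ ≤ _ := h

lemma sum_pow_le {p : ℝ} (hp : 1 ≤ p) (K : ℕ) (x : ℕ → ℝ≥0∞) :
    (∑ k ∈ Finset.range K, x k) ^ p ≤ (K : ℝ≥0∞) ^ p * ∑ k ∈ Finset.range K, x k ^ p := by
  have hp0 : 0 < p := by linarith
  have h : ∑ k ∈ Finset.range K, x k ≤ K * (∑ k ∈ Finset.range K, x k ^ p) ^ (1 / p) := by
    have := Finset.sum_le_card_nsmul (Finset.range K) x ((∑ k ∈ Finset.range K, x k ^ p) ^ (1 / p)) (by
      intro k hk
      calc x k = (x k ^ p) ^ (1 / p) := by rw [← ENNReal.rpow_mul, mul_one_div_cancel hp0.ne', ENNReal.rpow_one]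
        _ ≤ _ := by
          gcongr
          exact Finset.single_le_sum (f := fun k => x k ^ p) (fun _ _ => zero_le) hk)
    simpa using this
  calc _ ≤ (K * (∑ k ∈ Finset.range K, x k ^ p) ^ (1 / p)) ^ p := by gcongr
    _ = _ := by
      rw [ENNReal.mul_rpow_of_nonneg _ _ hp0.le, ← ENNReal.rpow_mul, one_div_mul_cancel hp0.ne', ENNReal.rpow_one]

namespace Filt
variable {α : Type} [MeasurableSpace α] {μ : Measure α} [SigmaFinite μ] (F : Filt α μ)

lemma E_ne_top {k : ℕ} {f : α → ℝ≥0∞} (h : ∫⁻ x, f x ∂μ ≠ ⊤) (x : α) : F.E k f x ≠ ⊤ :=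
  ENNReal.mul_ne_top (ENNReal.inv_ne_top.2 (F.pos k x))
    (ne_top_of_le_ne_top h (setLIntegral_le_lintegral _ _))

lemma E_ne_top' {p : ℝ} (hp : 1 ≤ p) {k : ℕ} {f : α → ℝ≥0∞} (hf : Measurable f)
    (h : ∫⁻ x, f x ^ p ∂μ ≠ ⊤) (x : α) : F.E k f x ≠ ⊤ := by
  intro h2
  have h3 := F.jensen hp k hf x
  rw [h2, ENNReal.top_rpow_of_pos (by linarith)] at h3
  exact F.E_ne_top h x (top_le_iff.1 h3)

lemma sumE_ne_top {p : ℝ} (hp : 1 ≤ p) (K : ℕ) {f : α → ℝ≥0∞} (hf : Measurable f)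
    (h : ∫⁻ x, f x ^ p ∂μ ≠ ⊤) :
    ∫⁻ x, (∑ k ∈ Finset.range K, F.E k f x) ^ p ∂μ ≠ ⊤ := by
  have : ∫⁻ x, (∑ k ∈ Finset.range K, F.E k f x) ^ p ∂μ ≤
      (K : ℝ≥0∞) ^ p * ∑ k ∈ Finset.range K, ∫⁻ x, f x ^ p ∂μ := by
    calc _ ≤ ∫⁻ x, (K : ℝ≥0∞) ^ p * ∑ k ∈ Finset.range K, F.E k f x ^ p ∂μ :=
          lintegral_mono fun x => sum_pow_le hp K _
      _ = (K : ℝ≥0∞) ^ p * ∑ k ∈ Finset.range K, ∫⁻ x, F.E k f x ^ p ∂μ := by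
          rw [lintegral_const_mul, lintegral_finsetSum]
          · exact fun k _ => (F.measurable_E k hf).pow_const p
          · exact Finset.measurable_fun_sum _ fun k _ => (F.measurable_E k hf).pow_const p
      _ ≤ _ := by
          exact mul_le_mul' le_rfl (Finset.sum_le_sum fun k _ => F.lintegral_E_rpow hp k hf)
  refine ne_top_of_le_ne_top (ENNReal.mul_ne_top ?_ ?_) this
  · exact ENNReal.rpow_ne_top_of_nonneg (by linarith) (ENNReal.natCast_ne_top K)
  · simp [ENNReal.mul_eq_top, h]

/-- Doob's maximal inequality. -/
theorem doob {p : ℝ} (hp : 1 < p) (K : ℕ) {f : α → ℝ≥0∞} (hf : Measurable f) :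
    ∫⁻ x, F.mx K f x ^ p ∂μ ≤
      ((1 + ENNReal.ofReal (p - 1)) / ENNReal.ofReal (p - 1)) ^ p * ∫⁻ x, f x ^ p ∂μ := by
  set c := ENNReal.ofReal (p - 1) with hc
  have hc0 : c ≠ 0 := by simp [hc, hp]
  have hct : c ≠ ⊤ := ofReal_ne_top
  have hp0 : 0 < p := by linarith
  by_cases hfin : ∫⁻ x, f x ^ p ∂μ = ⊤
  · rw [hfin, ENNReal.mul_top]
    · exact le_top
    · simp [ENNReal.rpow_eq_zero_iff, ENNReal.div_eq_top, hc0, hct, hp0, not_lt.2 hp0.le]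
  apply selfimp hp
  · refine ne_top_of_le_ne_top (F.sumE_ne_top hp.le (K + 1) hf hfin) ?_
    exact lintegral_mono fun x => ENNReal.rpow_le_rpow (F.mx_le_sum K f x) hp0.le
  have hu : ∀ k, Measurable (F.mx k f) := fun k => F.measurable_mx k hf
  have hup : ∀ k, Measurable (fun x => F.mx k f x ^ (p - 1)) := fun k => (hu k).pow_const _
  have hinc : ∀ k, Measurable (fun x => inc (fun k => F.mx k f x ^ (p - 1)) k) := measurable_inc hup
  have hincad : ∀ k, F.Ad k (fun x => inc (fun k => F.mx k f x ^ (p - 1)) k) :=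
    F.inc_ad (a := fun k x => F.mx k f x ^ (p - 1)) fun k x y hy => by simp only [F.mx_ad k f x y hy]
  have h1 : c * ∫⁻ x, F.mx K f x ^ p ∂μ ≤ (1 + c) * ∫⁻ x, F.mx K f x ^ (p - 1) * f x ∂μ := by
    rw [← lintegral_const_mul _ ((hu K).pow_const p)]
    calc _ ≤ ∫⁻ x, (1 + c) * ∑ k ∈ Finset.range (K + 1), inc (fun k => F.mx k f x ^ (p - 1)) k * F.E k f x ∂μ :=
          lintegral_mono fun x => doob_det hp (fun k => F.E k f x) (fun k => F.mx k f x)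
            (fun k => F.E_ne_top' hp.le hf hfin x) (F.mx_zero f x) (fun k => F.mx_succ k f x) K
      _ = (1 + c) * ∑ k ∈ Finset.range (K + 1), ∫⁻ x, inc (fun k => F.mx k f x ^ (p - 1)) k * F.E k f x ∂μ := by
          rw [lintegral_const_mul, lintegral_finsetSum]
          · exact fun k _ => (hinc k).mul (F.measurable_E k hf)
          · exact Finset.measurable_fun_sum _ fun k _ => (hinc k).mul (F.measurable_E k hf)
      _ = (1 + c) * ∑ k ∈ Finset.range (K + 1), ∫⁻ x, inc (fun k => F.mx k f x ^ (p - 1)) k * f x ∂μ := by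
          congr 1
          exact Finset.sum_congr rfl fun k _ => F.lintegral_ad_mul_E (hincad k) (hinc k) hf
      _ = (1 + c) * ∫⁻ x, F.mx K f x ^ (p - 1) * f x ∂μ := by
          rw [← lintegral_finsetSum (f := fun k x => inc (fun k => F.mx k f x ^ (p - 1)) k * f x) _ fun k _ => (hinc k).mul hf]
          congr 1; congr 1 with x
          rw [← Finset.sum_mul, sum_inc_rpow (F.mx_monotone f x) (by linarith)]
  calc ∫⁻ x, F.mx K f x ^ p ∂μ = c⁻¹ * (c * ∫⁻ x, F.mx K f x ^ p ∂μ) := by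
        rw [← mul_assoc, ENNReal.inv_mul_cancel hc0 hct, one_mul]
    _ ≤ c⁻¹ * ((1 + c) * ∫⁻ x, F.mx K f x ^ (p - 1) * f x ∂μ) := by gcongr
    _ ≤ c⁻¹ * ((1 + c) * ((∫⁻ x, F.mx K f x ^ p ∂μ) ^ (1 - 1 / p) * (∫⁻ x, f x ^ p ∂μ) ^ (1 / p))) := by
        gcongr; exact holder1 hp (hu K) hf
    _ = _ := by rw [← mul_assoc, ENNReal.div_eq_inv_mul]

end Filt

/-- Lattice norms with integral Minkowski inequality. -/
structure LN {Y : Type} [MeasurableSpace Y] (ρ : (Y → ℝ≥0∞) → ℝ≥0∞) : Prop where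
  mono : ∀ g h : Y → ℝ≥0∞, (∀ y, g y ≤ h y) → ρ g ≤ ρ h
  add : ∀ g h : Y → ℝ≥0∞, Measurable g → Measurable h → ρ (fun y => g y + h y) ≤ ρ g + ρ h
  smul : ∀ (c : ℝ≥0∞) (g : Y → ℝ≥0∞), c ≠ ⊤ → ρ (fun y => c * g y) ≤ c * ρ g
  mink : ∀ {α : Type} [MeasurableSpace α] (μ : Measure α) [SigmaFinite μ] (f : α → Y → ℝ≥0∞),
    Measurable (Function.uncurry f) → ρ (fun y => ∫⁻ t, f t y ∂μ) ≤ ∫⁻ t, ρ (f t) ∂μ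
  meas : ∀ {α : Type} [MeasurableSpace α] (f : α → Y → ℝ≥0∞),
    Measurable (Function.uncurry f) → Measurable (fun t => ρ (f t))

namespace LN
variable {Y : Type} [MeasurableSpace Y] {ρ : (Y → ℝ≥0∞) → ℝ≥0∞} (h : LN ρ)
  {α : Type} [MeasurableSpace α] {μ : Measure α} [SigmaFinite μ] (F : Filt α μ)

lemma zero (h : LN ρ) : ρ (fun _ => 0) = 0 := by
  have := h.smul 0 (fun _ => 0) (by simp)
  simpa using this

lemma sum (h : LN ρ) {ι : Type} (s : Finset ι) (g : ι → Y → ℝ≥0∞) (hg : ∀ i, Measurable (g i)) :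
    ρ (fun y => ∑ i ∈ s, g i y) ≤ ∑ i ∈ s, ρ (g i) := by
  classical
  induction s using Finset.induction_on with
  | empty => simp [h.zero]
  | insert a s ha ih =>
    simp only [Finset.sum_insert ha]
    exact (h.add _ _ (hg a) (Finset.measurable_fun_sum _ fun i _ => hg i)).trans (by gcongr)

lemma E (h : LN ρ) {f : α → Y → ℝ≥0∞} (hf : Measurable (Function.uncurry f)) (k : ℕ) (t : α) :
    ρ (fun y => F.E k (fun s => f s y) t) ≤ F.E k (fun s => ρ (f s)) t := by
  unfold Filt.E
  refine (h.smul _ _ (ENNReal.inv_ne_top.2 (F.pos k t))).trans ?_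
  gcongr
  exact h.mink _ _ hf

end LN

/-- Vector-valued maximal bound. -/
def VB {Y : Type} {α : Type} [MeasurableSpace Y] [MeasurableSpace α] {μ : Measure α} (F : Filt α μ)
    (ρ : (Y → ℝ≥0∞) → ℝ≥0∞) (p : ℝ) (C : ℝ≥0∞) : Prop :=
  ∀ f : α → Y → ℝ≥0∞, Measurable (Function.uncurry f) → ∀ K,
    ∫⁻ t, ρ (fun y => F.mx K (fun s => f s y) t) ^ p ∂μ ≤ C * ∫⁻ t, ρ (f t) ^ p ∂μ

namespace Filt
variable {α : Type} [MeasurableSpace α] {μ : Measure α} (F : Filt α μ)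

/-- Tail maximal function. -/
def tl (k K : ℕ) (f : α → ℝ≥0∞) (x : α) : ℝ≥0∞ := ⨆ (i : ℕ) (_ : k ≤ i ∧ i ≤ K), F.E i f x

lemma E_le_tl {k i K : ℕ} (h1 : k ≤ i) (h2 : i ≤ K) (f : α → ℝ≥0∞) (x : α) :
    F.E i f x ≤ F.tl k K f x :=
  le_iSup₂ (f := fun i (_ : k ≤ i ∧ i ≤ K) => F.E i f x) i ⟨h1, h2⟩

lemma mx_le_tl (k K : ℕ) (f : α → ℝ≥0∞) (x : α) : F.mx K f x ≤ F.mx k f x + F.tl (k + 1) K f x := by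
  apply F.mx_le
  intro i hi
  rcases le_or_gt i k with h | h
  · exact (F.E_le_mx h f x).trans le_self_add
  · exact (F.E_le_tl h hi f x).trans le_add_self

lemma tl_le_local {k K : ℕ} {f : α → ℝ≥0∞} {x y : α} (hy : y ∈ F.P k x) :
    F.tl k K f y ≤ F.mx K (fun z => (F.P k x).indicator 1 z * f z) y := by
  refine iSup₂_le fun i hi => ?_
  refine le_trans (le_of_eq ?_) (F.E_le_mx hi.2 _ y)
  apply F.E_congr_on
  intro z hz
  have : z ∈ F.P k x := by
    have := F.anti' hi.1 y hz
    rwa [F.eq_of_mem k x y hy] at this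
  simp [this]

lemma tl_le_sum (k K : ℕ) (f : α → ℝ≥0∞) (x : α) :
    F.tl k K f x ≤ F.mx K f x :=
  iSup₂_le fun i hi => F.E_le_mx hi.2 f x

lemma measurable_tl2 [SigmaFinite μ] {β : Type} [MeasurableSpace β] (k K : ℕ) {f : α → β → ℝ≥0∞}
    (hf : Measurable (Function.uncurry f)) :
    Measurable (fun z : α × β => F.tl k K (fun t => f t z.2) z.1) := by
  unfold tl
  exact Measurable.iSup fun k => Measurable.iSup fun _ => F.measurable_E2 k hf

lemma measurable_Er [SigmaFinite μ] {β : Type} [MeasurableSpace β] (k : ℕ) {f : α → β → ℝ≥0∞}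
    (hf : Measurable (Function.uncurry f)) (t : α) : Measurable (fun y : β => F.E k (fun s => f s y) t) := by
  have h := F.measurable_E2 k hf
  exact h.of_uncurry_left (f := fun a y => F.E k (fun s => f s y) a) (x := t)

lemma measurable_mxr [SigmaFinite μ] {β : Type} [MeasurableSpace β] (k : ℕ) {f : α → β → ℝ≥0∞}
    (hf : Measurable (Function.uncurry f)) (t : α) : Measurable (fun y : β => F.mx k (fun s => f s y) t) := by
  unfold mx
  exact Measurable.iSup fun k => Measurable.iSup fun _ => F.measurable_Er k hf t

lemma measurable_tlr [SigmaFinite μ] {β : Type} [MeasurableSpace β] (k K : ℕ) {f : α → β → ℝ≥0∞}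
    (hf : Measurable (Function.uncurry f)) (t : α) : Measurable (fun y : β => F.tl k K (fun s => f s y) t) := by
  unfold tl
  exact Measurable.iSup fun k => Measurable.iSup fun _ => F.measurable_Er k hf t

end Filt

section V
variable {Y : Type} [MeasurableSpace Y]

lemma LN.mx_le {ρ : (Y → ℝ≥0∞) → ℝ≥0∞} (h : LN ρ) {α : Type} [MeasurableSpace α] {μ : Measure α}
    [SigmaFinite μ] (F : Filt α μ) {f : α → Y → ℝ≥0∞} (hf : Measurable (Function.uncurry f)) (K : ℕ)
    (t : α) : ρ (fun y => F.mx K (fun s => f s y) t) ≤ ∑ k ∈ Finset.range (K + 1), F.E k (fun s => ρ (f s)) t := by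
  refine (h.mono _ _ fun y => F.mx_le_sum K _ t).trans ?_
  refine (h.sum _ (fun k y => F.E k (fun s => f s y) t) fun k => ?_).trans ?_
  · exact F.measurable_Er k hf t
  · exact Finset.sum_le_sum fun k _ => h.E F hf k t

theorem VB.up {p₀ p : ℝ} (hp₀ : 1 ≤ p₀) (hp : p₀ < p) {C : ℝ≥0∞} (hC : C ≠ ⊤) :
    ∃ C' : ℝ≥0∞, C' ≠ ⊤ ∧ ∀ {α : Type} [MeasurableSpace α] {μ : Measure α} [SigmaFinite μ]
      (F : Filt α μ) {ρ : (Y → ℝ≥0∞) → ℝ≥0∞}, LN ρ → VB F ρ p₀ C → VB F ρ p C' := by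
  have hp1 : 1 < p := by linarith
  have hp0 : 0 < p := by linarith
  have hp00 : 0 < p₀ := by linarith
  have hs : 1 < p / p₀ := by rw [lt_div_iff₀ hp00]; linarith
  set c := ENNReal.ofReal (p - 1) with hc
  set d := ((1 + ENNReal.ofReal (p / p₀ - 1)) / ENNReal.ofReal (p / p₀ - 1)) ^ (p / p₀) with hd
  have hdt : d ≠ ⊤ := by
    refine ENNReal.rpow_ne_top_of_nonneg (by linarith) (ENNReal.div_ne_top (by simp) ?_)
    simp [hs]
  refine ⟨(1 + c) ^ p * (C ^ (p / p₀) * d) + 1, ?_, ?_⟩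
  · refine ENNReal.add_ne_top.2 ⟨ENNReal.mul_ne_top (ENNReal.rpow_ne_top_of_nonneg hp0.le (by simp [c]))
      (ENNReal.mul_ne_top (ENNReal.rpow_ne_top_of_nonneg (by linarith) hC) hdt), by simp⟩
  intro α _ μ _ F ρ h hV f hf K
  have hφ : Measurable (fun t => ρ (f t)) := h.meas f hf
  set φ := fun t => ρ (f t) with hφd
  by_cases hfin : ∫⁻ x, φ x ^ p ∂μ = ⊤
  · rw [hfin, ENNReal.mul_top (by simp)]; exact le_top
  refine le_trans ?_ (mul_le_mul' le_self_add le_rfl)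
  set A : ℕ → α → ℝ≥0∞ := fun k t => ρ (fun y => F.mx k (fun s => f s y) t) with hA
  set R : ℕ → α → ℝ≥0∞ := fun k t => ρ (fun y => F.tl k K (fun s => f s y) t) with hR
  have mA : ∀ k, Measurable (A k) := fun k => h.meas (fun t y => F.mx k (fun s => f s y) t) (F.measurable_mx2 k hf)
  have mR : ∀ k, Measurable (R k) := fun k => h.meas (fun t y => F.tl k K (fun s => f s y) t) (F.measurable_tl2 k K hf)
  have mono : ∀ t, Monotone (fun k => A k t) := fun t i j hij => h.mono _ _ fun y => F.mx_monotone _ t hij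
  have Ale : ∀ t, A K t ≤ ∑ k ∈ Finset.range (K + 1), F.E k φ t := h.mx_le F hf K
  have Afin : ∀ t, A K t ≠ ⊤ := fun t => ne_top_of_le_ne_top
    (ENNReal.sum_ne_top.2 fun k _ => F.E_ne_top' hp1.le hφ hfin t) (Ale t)
  have Aad : ∀ k, F.Ad k (A k) := fun k x y hy => by
    simp only [hA]; congr 1; funext z; exact F.mx_ad k _ x y hy
  have mAp : ∀ k, Measurable (fun x => A k x ^ (p - 1)) := fun k => (mA k).pow_const _
  have hinc : ∀ k, Measurable (fun x => inc (fun k => A k x ^ (p - 1)) k) := measurable_inc mAp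
  have hincad : ∀ k, F.Ad k (fun x => inc (fun k => A k x ^ (p - 1)) k) :=
    F.inc_ad (a := fun k x => A k x ^ (p - 1)) fun k x y hy => by simp only [Aad k x y hy]
  -- conditional estimate
  set ζ : α → ℝ≥0∞ := fun t => (C * F.mx K (fun s => φ s ^ p₀) t) ^ (1 / p₀) with hζ
  have mζ : Measurable ζ := ((F.measurable_mx K (hφ.pow_const _)).const_mul C).pow_const _
  have hER : ∀ k ≤ K, ∀ t, F.E k (R k) t ≤ ζ t := by
    intro k hk t
    have h1 : F.E k (fun s => R k s ^ p₀) t ≤ C * F.E k (fun s => φ s ^ p₀) t := by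
      have h2 := hV (fun s y => (F.P k t).indicator 1 s * f s y)
        (((measurable_one.indicator (F.mP k t)).comp measurable_fst).mul hf) K
      unfold Filt.E
      rw [mul_left_comm]
      gcongr
      calc ∫⁻ s in F.P k t, R k s ^ p₀ ∂μ
          ≤ ∫⁻ s in F.P k t, ρ (fun y => F.mx K (fun s => (F.P k t).indicator 1 s * f s y) s) ^ p₀ ∂μ := by
            refine setLIntegral_mono' (F.mP k t) fun s hs => ENNReal.rpow_le_rpow ?_ hp00.le
            exact h.mono _ _ fun y => F.tl_le_local hs
        _ ≤ ∫⁻ s, ρ (fun y => F.mx K (fun s => (F.P k t).indicator 1 s * f s y) s) ^ p₀ ∂μ :=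
            setLIntegral_le_lintegral _ _
        _ ≤ _ := h2
        _ = _ := by
          rw [← lintegral_indicator (F.mP k t)]
          congr 1; congr 1 with s
          by_cases hs : s ∈ F.P k t
          · simp [hs, hφd]
          · simp [hs, h.zero, hp00]
    calc F.E k (R k) t = (F.E k (R k) t ^ p₀) ^ (1 / p₀) := by
          rw [← ENNReal.rpow_mul, mul_one_div_cancel hp00.ne', ENNReal.rpow_one]
      _ ≤ _ := by
        refine ENNReal.rpow_le_rpow ?_ (by positivity)
        refine (F.jensen hp₀ k (mR k) t).trans (h1.trans ?_)
        gcongr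
        exact F.E_le_mx hk _ t
  have hζp : ∫⁻ t, ζ t ^ p ∂μ ≤ C ^ (p / p₀) * d * ∫⁻ t, φ t ^ p ∂μ := by
    have := F.doob hs K (hφ.pow_const p₀)
    simp only [← ENNReal.rpow_mul, mul_div_cancel₀ p hp00.ne'] at this
    calc ∫⁻ t, ζ t ^ p ∂μ = ∫⁻ t, C ^ (p / p₀) * (F.mx K (fun s => φ s ^ p₀) t) ^ (p / p₀) ∂μ := by
          congr 1 with t
          simp only [hζ]
          rw [← ENNReal.rpow_mul, one_div_mul_eq_div, ENNReal.mul_rpow_of_nonneg _ _ (by linarith)]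
      _ = C ^ (p / p₀) * ∫⁻ t, (F.mx K (fun s => φ s ^ p₀) t) ^ (p / p₀) ∂μ :=
          lintegral_const_mul _ ((F.measurable_mx K (hφ.pow_const _)).pow_const _)
      _ ≤ _ := by rw [mul_assoc]; gcongr
  have hI : ∫⁻ t, A K t ^ p ∂μ ≠ ⊤ := by
    refine ne_top_of_le_ne_top (F.sumE_ne_top hp1.le (K + 1) hφ hfin) ?_
    exact lintegral_mono fun x => ENNReal.rpow_le_rpow (Ale x) hp0.le
  have h1 : ∫⁻ t, A K t ^ p ∂μ ≤ (1 + c) * ∫⁻ t, A K t ^ (p - 1) * ζ t ∂μ := by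
    calc _ ≤ ∫⁻ x, (1 + c) * ∑ k ∈ Finset.range (K + 1), inc (fun k => A k x ^ (p - 1)) k * R k x ∂μ :=
          lintegral_mono fun x => up_det hp1 (fun k => A k x) (fun k => R k x) (mono x) K (Afin x)
            (h.mono _ _ fun y => F.mx_le fun k hk => F.E_le_tl (Nat.zero_le k) hk _ x)
            (fun k _ => (h.mono _ _ fun y => F.mx_le_tl k K _ x).trans (h.add _ _
              (F.measurable_mxr k hf x)
              (F.measurable_tlr (k + 1) K hf x)))
      _ = (1 + c) * ∑ k ∈ Finset.range (K + 1), ∫⁻ x, inc (fun k => A k x ^ (p - 1)) k * R k x ∂μ := by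
          rw [lintegral_const_mul, lintegral_finsetSum]
          · exact fun k _ => (hinc k).mul (mR k)
          · exact Finset.measurable_fun_sum _ fun k _ => (hinc k).mul (mR k)
      _ ≤ (1 + c) * ∑ k ∈ Finset.range (K + 1), ∫⁻ x, inc (fun k => A k x ^ (p - 1)) k * ζ x ∂μ := by
          refine mul_le_mul' le_rfl (Finset.sum_le_sum fun k hk => ?_)
          rw [← F.lintegral_ad_mul_E (hincad k) (hinc k) (mR k)]
          refine lintegral_mono fun x => mul_le_mul' le_rfl (hER k ?_ x)
          have := Finset.mem_range.1 hk; omega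
      _ = _ := by
          rw [← lintegral_finsetSum (f := fun k x => inc (fun k => A k x ^ (p - 1)) k * ζ x) _ fun k _ => (hinc k).mul mζ]
          congr 1; congr 1 with x
          rw [← Finset.sum_mul, sum_inc_rpow (mono x) (by linarith)]
  have h2 := selfimp hp1 hI (h1.trans (mul_le_mul' le_rfl (holder1 hp1 (mA K) mζ)))
  refine h2.trans ?_
  rw [mul_assoc]
  gcongr
end V

lemma down_real {r s D : ℝ} (hr : 0 < r) (hr1 : r < 1) (hs : 1 ≤ s) (hsD : s ≤ D) :
    s - s ^ (1 - r) ≤ D / (1 - r) * (s ^ (1 - r) - 1) := by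
  have hs0 : 0 < s := by linarith
  have h1r : 0 < 1 - r := by linarith
  have hB : (1 / s) ^ (1 - r) ≤ 1 + (1 - r) * (1 / s - 1) := by
    have := rpow_one_add_le_one_add_mul_self (s := 1 / s - 1) (p := 1 - r)
      (by have : 0 < 1 / s := by positivity
          linarith) h1r.le (by linarith)
    simpa using this
  have hge1 : 1 ≤ s ^ (1 - r) := Real.one_le_rpow hs h1r.le
  have h2 : (1 / s) ^ (1 - r) * s ^ (1 - r) = 1 := by
    rw [← Real.mul_rpow (by positivity) hs0.le, one_div_mul_cancel hs0.ne', Real.one_rpow]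
  set a := s ^ (1 - r)
  set e := (1 / s) ^ (1 - r)
  have h3 : 1 + (1 - r) * (1 - 1 / s) ≤ a := by
    have he : 1 + (1 - r) * (1 / s - 1) = 1 - (1 - r) * (1 - 1 / s) := by ring
    set w := (1 - r) * (1 - 1 / s)
    rw [he] at hB
    have h4 : 1 ≤ (1 - w) * a := by
      calc 1 = e * a := h2.symm
        _ ≤ _ := by gcongr
    have hw : 0 ≤ w := by
      have : 1 / s ≤ 1 := by rw [div_le_one hs0]; exact hs
      exact mul_nonneg h1r.le (by linarith)
    nlinarith
  have h5 : s - 1 ≤ D / (1 - r) * (a - 1) := by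
    have : s - 1 = s / (1 - r) * ((1 - r) * (1 - 1 / s)) := by field_simp
    rw [this]
    have h0 : 0 ≤ (1 - r) * (1 - 1 / s) := by
      have : 1 / s ≤ 1 := by rw [div_le_one hs0]; exact hs
      exact mul_nonneg h1r.le (by linarith)
    have hDp : 0 ≤ D / (1 - r) := div_nonneg (by linarith) h1r.le
    gcongr
    linarith
  linarith

lemma down_enn {r D : ℝ} (hr : 0 < r) (hr1 : r < 1) {x y : ℝ≥0∞} (hx0 : x ≠ 0) (hx : x ≠ ⊤)
    (hxy : x ≤ y) (hyD : y ≤ ENNReal.ofReal D * x) :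
    (x ^ (-r) - y ^ (-r)) * y ≤ ENNReal.ofReal (D / (1 - r)) * (y ^ (1 - r) - x ^ (1 - r)) := by
  have hy : y ≠ ⊤ := ne_top_of_le_ne_top (ENNReal.mul_ne_top ofReal_ne_top hx) hyD
  obtain ⟨a, ha, rfl⟩ : ∃ a : ℝ, 0 < a ∧ x = ENNReal.ofReal a :=
    ⟨x.toReal, ENNReal.toReal_pos hx0 hx, (ENNReal.ofReal_toReal hx).symm⟩
  obtain ⟨b, hb, rfl⟩ : ∃ b : ℝ, 0 < b ∧ y = ENNReal.ofReal b :=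
    ⟨y.toReal, ENNReal.toReal_pos (by intro h; simp [h] at hxy; linarith) hy, (ENNReal.ofReal_toReal hy).symm⟩
  have hab : a ≤ b := by rwa [ENNReal.ofReal_le_ofReal_iff hb.le] at hxy
  have hbD : b ≤ D * a := by
    rw [← ENNReal.ofReal_mul' ha.le] at hyD
    by_contra hcon
    push Not at hcon
    rw [ENNReal.ofReal_le_ofReal_iff'] at hyD
    rcases hyD with h | h <;> linarith
  have hs : 1 ≤ b / a := by rw [one_le_div ha]; exact hab
  have hsD : b / a ≤ D := by rw [div_le_iff₀ ha]; exact hbD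
  have hD : 0 ≤ D := by linarith
  have h := down_real hr hr1 hs hsD
  have h1r : 0 < 1 - r := by linarith
  rw [ENNReal.ofReal_rpow_of_pos ha, ENNReal.ofReal_rpow_of_pos hb, ENNReal.ofReal_rpow_of_pos ha, ENNReal.ofReal_rpow_of_pos hb,
    ← ENNReal.ofReal_sub _ (by positivity), ← ENNReal.ofReal_sub _ (by positivity),
    ← ENNReal.ofReal_mul' hb.le, ← ENNReal.ofReal_mul (by positivity)]
  apply ENNReal.ofReal_le_ofReal
  have e1 : b ^ (1 - r) = a ^ (1 - r) * (b / a) ^ (1 - r) := by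
    rw [← Real.mul_rpow ha.le (by positivity), mul_div_cancel₀ _ ha.ne']
  have e2 : a ^ (-r) * b = a ^ (1 - r) * (b / a) := by
    rw [show (1 : ℝ) - r = -r + 1 by ring, Real.rpow_add_one ha.ne']; field_simp
  have e3 : b ^ (-r) * b = b ^ (1 - r) := by
    rw [show (1 : ℝ) - r = -r + 1 by ring, Real.rpow_add_one hb.ne']
  rw [sub_mul, e2, e3, e1]
  have := mul_le_mul_of_nonneg_left h (Real.rpow_nonneg ha.le (1 - r))
  calc _ = a ^ (1 - r) * (b / a - (b / a) ^ (1 - r)) := by ring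
    _ ≤ _ := this
    _ = _ := by ring

lemma sum_sub_le (g : ℕ → ℝ≥0∞) (hg : Monotone g) (K : ℕ) :
    ∑ i ∈ Finset.range K, (g (i + 1) - g i) ≤ g K := by
  induction K with
  | zero => simp
  | succ K ih =>
    rw [Finset.sum_range_succ]
    calc _ ≤ g K + (g (K + 1) - g K) := by gcongr
      _ = _ := add_tsub_cancel_of_le (hg (Nat.le_succ K))

lemma sum_sub_anti (g : ℕ → ℝ≥0∞) (hg : Antitone g) {k K : ℕ} (h : k ≤ K) :
    g K + ∑ i ∈ Finset.Ico k K, (g i - g (i + 1)) = g k := by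
  induction K, h using Nat.le_induction with
  | base => simp
  | succ K hK ih =>
    rw [Finset.sum_Ico_succ_top hK, ← ih, add_comm (∑ i ∈ _, _), ← add_assoc,
      add_tsub_cancel_of_le (hg (Nat.le_succ K))]

/-- Existence of small positive functions. -/
lemma exists_small {α : Type} [MeasurableSpace α] (μ : Measure α) [SigmaFinite μ] {p : ℝ} (hp : 0 < p)
    {ε : ℝ≥0∞} (hε : ε ≠ 0) : ∃ η : α → ℝ≥0∞, Measurable η ∧ (∀ x, η x ≠ 0) ∧ ∫⁻ x, η x ^ p ∂μ ≤ ε := by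
  obtain ⟨g, hg, hm, hi⟩ := exists_pos_lintegral_lt_of_sigmaFinite μ hε
  refine ⟨fun x => (g x : ℝ≥0∞) ^ (1 / p), hm.coe_nnreal_ennreal.pow_const _, fun x => ?_, ?_⟩
  · have := (hg x).ne'
    simp [ENNReal.rpow_eq_zero_iff, this]
  · simp only [← ENNReal.rpow_mul, one_div_mul_cancel hp.ne', ENNReal.rpow_one]
    exact hi.le

section V
variable {Y : Type} [MeasurableSpace Y]

theorem VB.down_core {p₀ p : ℝ} (hp : 1 < p) (hpp : p < p₀) {C D : ℝ≥0∞} (hC : C ≠ ⊤) (hD : D ≠ ⊤) :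
    ∃ C' : ℝ≥0∞, C' ≠ ⊤ ∧ ∀ {α : Type} [MeasurableSpace α] {μ : Measure α} [SigmaFinite μ]
      (F : Filt α μ) {ρ : (Y → ℝ≥0∞) → ℝ≥0∞}, F.D = D → LN ρ → VB F ρ p₀ C →
      ∀ f : α → Y → ℝ≥0∞, Measurable (Function.uncurry f) → ∀ G : α → ℝ≥0∞, Measurable G →
      (∀ x, G x ≠ 0) → (∀ t, ρ (f t) ≤ G t) → ∫⁻ x, G x ^ p ∂μ ≠ ⊤ → ∀ K,
      ∫⁻ t, ρ (fun y => F.mx K (fun s => f s y) t) ^ p ∂μ ≤ C' * ∫⁻ x, G x ^ p ∂μ := by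
  have hp0 : 0 < p := by linarith
  have hp00 : 0 < p₀ := by linarith
  set r : ℝ := 1 - p / p₀ with hr
  have hr0 : 0 < r := by have : p / p₀ < 1 := by rw [div_lt_one hp00]; exact hpp
                         linarith
  have hr1 : r < 1 := by have : 0 < p / p₀ := by positivity
                         linarith
  set D' : ℝ := max 1 D.toReal with hD'
  have hD1 : 1 ≤ ENNReal.ofReal D' := by simp [hD']
  have hDD : D ≤ ENNReal.ofReal D' := by
    rw [← ENNReal.ofReal_toReal hD]; exact ENNReal.ofReal_le_ofReal (le_max_right _ _)
  set κ : ℝ≥0∞ := ENNReal.ofReal D' + ENNReal.ofReal (D' / (1 - r)) with hκ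
  set d := ((1 + ENNReal.ofReal (p - 1)) / ENNReal.ofReal (p - 1)) ^ p with hd
  have hdt : d ≠ ⊤ := by
    refine ENNReal.rpow_ne_top_of_nonneg (by linarith) (ENNReal.div_ne_top (by simp) ?_)
    simp [hp]
  refine ⟨(C * κ ^ p₀) ^ (p / p₀) * d, ?_, ?_⟩
  · refine ENNReal.mul_ne_top (ENNReal.rpow_ne_top_of_nonneg (by positivity) (ENNReal.mul_ne_top hC ?_)) hdt
    exact ENNReal.rpow_ne_top_of_nonneg (by positivity) (by simp [κ])
  intro α _ μ _ F ρ hFD h hV f hf G mG hG0 hφG hfin K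
  set v : ℕ → α → ℝ≥0∞ := fun k t => F.mx (k - 1) G t with hv
  have mv : ∀ k, Measurable (v k) := fun k => F.measurable_mx _ mG
  have vmono : ∀ t, Monotone (fun k => v k t) := fun t i j hij => F.mx_monotone G t (by omega)
  have EG0 : ∀ k t, F.E k G t ≠ 0 := by
    intro k t h0
    unfold Filt.E at h0
    rcases mul_eq_zero.1 h0 with h1 | h1
    · exact F.fin k t (ENNReal.inv_eq_zero.1 h1)
    · rw [lintegral_eq_zero_iff mG] at h1
      have : ∀ᵐ x ∂(μ.restrict (F.P k t)), False := by
        filter_upwards [h1] with x hx using hG0 x hx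
      have h2 : μ.restrict (F.P k t) = 0 := by
        simpa [Filter.eventually_false_iff_eq_bot, ae_eq_bot] using this
      exact F.pos k t (Measure.restrict_eq_zero.1 h2)
  have v0 : ∀ k t, v k t ≠ 0 := fun k t h0 => EG0 0 t (le_antisymm ((F.E_le_mx (Nat.zero_le _) G t).trans h0.le) zero_le)
  have vt : ∀ k t, v k t ≠ ⊤ := fun k t => ne_top_of_le_ne_top
    (ENNReal.sum_ne_top.2 fun k _ => F.E_ne_top' hp.le mG hfin t) (F.mx_le_sum _ G t)
  have vD : ∀ k t, v (k + 1) t ≤ ENNReal.ofReal D' * v k t := by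
    intro k t
    cases k with
    | zero => exact le_mul_of_one_le_left zero_le hD1
    | succ k =>
      simp only [hv, Nat.add_sub_cancel]
      rw [F.mx_succ]
      refine max_le (le_mul_of_one_le_left zero_le hD1) ?_
      refine (F.E_reg k G t).trans ?_
      rw [hFD]
      exact mul_le_mul' hDD (F.E_le_mx le_rfl G t)
  set w : ℕ → α → ℝ≥0∞ := fun k t => v k t ^ (-r) with hw
  have mw : ∀ k, Measurable (w k) := fun k => (mv k).pow_const _
  have wt : ∀ k t, w k t ≠ ⊤ := fun k t => by
    simp only [hw]; simp [ENNReal.rpow_eq_top_iff, v0, vt]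
  have wanti : ∀ t, Antitone (fun k => w k t) := fun t i j hij => by
    simp only [hw, ENNReal.rpow_neg]
    exact ENNReal.inv_le_inv.2 (ENNReal.rpow_le_rpow (vmono t hij) hr0.le)
  have wad : ∀ k, F.Ad k (w k) := fun k x y hy => by
    simp only [hw, hv]
    rw [F.mx_ad (k - 1) G x y (F.anti' (by omega) x hy)]
  have wad' : ∀ k, F.Ad k (w (k + 1)) := fun k x y hy => by
    simp only [hw, hv]
    rw [F.mx_ad (k + 1 - 1) G x y (F.anti' (by omega) x hy)]
  set c : ℕ → α → ℝ≥0∞ := fun i t => w i t - w (i + 1) t with hc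
  have mc : ∀ k, Measurable (c k) := fun k => (mw k).sub (mw _)
  have cad : ∀ k, F.Ad k (c k) := fun k x y hy => by
    simp only [hc]; rw [wad k x y hy, wad' k x y hy]
  have ct : ∀ k t, c k t ≠ ⊤ := fun k t => ne_top_of_le_ne_top (wt k t) tsub_le_self
  set N : α → Y → ℝ≥0∞ := fun t y => w K t * F.E K (fun s => f s y) t +
    ∑ i ∈ Finset.range K, c i t * F.E i (fun s => f s y) t with hN
  have mN : Measurable (Function.uncurry N) := by
    refine Measurable.add (((mw K).comp measurable_fst).mul (F.measurable_E2 K hf)) ?_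
    exact Finset.measurable_fun_sum _ fun i _ => ((mc i).comp measurable_fst).mul (F.measurable_E2 i hf)
  -- lower bound
  have low : ∀ k ≤ K, ∀ t y, w k t * F.E k (fun s => f s y) t ≤ F.E k (fun s => N s y) t := by
    intro k hk t y
    have mg : Measurable (fun s => f s y) := hf.of_uncurry_right
    set g := fun s => f s y with hg
    have e1 : ∀ i, k ≤ i → ∀ a : α → ℝ≥0∞, F.Ad i a → Measurable a →
        F.E k (fun s => a s * F.E i g s) t = F.E k (fun s => a s * g s) t := by
      intro i hi a ha ma
      rw [← F.tower hi (f := fun s => a s * g s) (ma.mul mg)]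
      congr 1; funext s; exact (F.E_ad_mul ha mg s).symm
    calc w k t * F.E k g t = F.E k (fun s => w k s * g s) t := (F.E_ad_mul (wad k) mg t).symm
      _ = F.E k (fun s => w K s * g s + ∑ i ∈ Finset.Ico k K, c i s * g s) t := by
          congr 1; funext s
          rw [← Finset.sum_mul, ← add_mul, sum_sub_anti (fun k => w k s) (wanti s) hk]
      _ = F.E k (fun s => w K s * F.E K g s + ∑ i ∈ Finset.Ico k K, c i s * F.E i g s) t := by
          rw [F.E_add (f := fun s => w K s * g s) ((mw K).mul mg),
            F.E_add (f := fun s => w K s * F.E K g s) ((mw K).mul (F.measurable_E K mg)),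
            F.E_sum _ (f := fun i s => c i s * g s) (fun i _ => (mc i).mul mg),
            F.E_sum _ (f := fun i s => c i s * F.E i g s) (fun i _ => (mc i).mul (F.measurable_E i mg)),
            e1 K hk (w K) (wad K) (mw K)]
          congr 1
          exact Finset.sum_congr rfl fun i hi => (e1 i (Finset.mem_Ico.1 hi).1 (c i) (cad i) (mc i)).symm
      _ ≤ _ := by
          refine F.E_mono (fun s => ?_) t
          simp only [hN]
          gcongr
          intro i hi
          exact Finset.mem_range.2 (Finset.mem_Ico.1 hi).2
  have low2 : ∀ t y, w K t * F.mx K (fun s => f s y) t ≤ F.mx K (fun s => N s y) t := by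
    intro t y
    unfold Filt.mx
    simp only [ENNReal.mul_iSup]
    refine iSup₂_le fun k hk => ?_
    exact (mul_le_mul' (wanti t hk) le_rfl).trans ((low k hk t y).trans (F.E_le_mx hk _ t))
  -- upper bound
  have upp : ∀ t, ρ (N t) ≤ κ * v K t ^ (1 - r) := by
    intro t
    have hE : ∀ i, F.E i (fun s => ρ (f s)) t ≤ v (i + 1) t := fun i =>
      (F.E_mono hφG t).trans (F.E_le_mx le_rfl G t)
    have hterm : ∀ i (a : ℝ≥0∞), a ≠ ⊤ → ρ (fun y => a * F.E i (fun s => f s y) t) ≤ a * v (i + 1) t := fun i a ha =>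
      (h.smul a _ ha).trans (mul_le_mul' le_rfl ((h.E F hf i t).trans (hE i)))
    calc ρ (N t) ≤ ρ (fun y => w K t * F.E K (fun s => f s y) t) +
          ρ (fun y => ∑ i ∈ Finset.range K, c i t * F.E i (fun s => f s y) t) :=
          h.add _ _ ((F.measurable_Er K hf t).const_mul _)
            (Finset.measurable_fun_sum _ fun i _ => (F.measurable_Er i hf t).const_mul _)
      _ ≤ w K t * v (K + 1) t + ∑ i ∈ Finset.range K, c i t * v (i + 1) t := by
          refine add_le_add (hterm K _ (wt K t)) ?_
          exact (h.sum _ (fun i y => c i t * F.E i (fun s => f s y) t) fun i =>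
            (F.measurable_Er i hf t).const_mul _).trans (Finset.sum_le_sum fun i _ => hterm i _ (ct i t))
      _ ≤ w K t * (ENNReal.ofReal D' * v K t) + ∑ i ∈ Finset.range K, ENNReal.ofReal (D' / (1 - r)) *
            (v (i + 1) t ^ (1 - r) - v i t ^ (1 - r)) := by
          refine add_le_add (mul_le_mul' le_rfl (vD K t)) (Finset.sum_le_sum fun i _ => ?_)
          exact down_enn hr0 hr1 (v0 i t) (vt i t) (vmono t (Nat.le_succ i)) (vD i t)
      _ ≤ ENNReal.ofReal D' * v K t ^ (1 - r) + ENNReal.ofReal (D' / (1 - r)) * v K t ^ (1 - r) := by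
          rw [← Finset.mul_sum]
          refine add_le_add (le_of_eq ?_) (mul_le_mul' le_rfl ?_)
          · rw [mul_left_comm]; congr 1
            simp only [hw]
            rw [show (1 : ℝ) - r = -r + 1 by ring, ENNReal.rpow_add _ _ (v0 K t) (vt K t), ENNReal.rpow_one]
          · exact sum_sub_le (fun i => v i t ^ (1 - r)) (fun i j hij => ENNReal.rpow_le_rpow (vmono t hij) (by linarith)) K
      _ = _ := by rw [hκ]; ring
  -- conclusion
  set I := ∫⁻ t, v K t ^ p ∂μ with hI
  have hId : I ≤ d * ∫⁻ x, G x ^ p ∂μ := F.doob hp (K - 1) mG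
  set A : α → ℝ≥0∞ := fun t => ρ (fun y => F.mx K (fun s => f s y) t) with hA
  have mA : Measurable A := h.meas (fun t y => F.mx K (fun s => f s y) t) (F.measurable_mx2 K hf)
  have h1 : ∫⁻ t, (w K t * A t) ^ p₀ ∂μ ≤ C * κ ^ p₀ * I := by
    calc _ ≤ ∫⁻ t, ρ (fun y => F.mx K (fun s => N s y) t) ^ p₀ ∂μ := by
          refine lintegral_mono fun t => ENNReal.rpow_le_rpow ?_ hp00.le
          have e : A t = (w K t)⁻¹ * (w K t * A t) := by
            rw [← mul_assoc, ENNReal.inv_mul_cancel _ (wt K t), one_mul]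
            simp only [hw]; simp [ENNReal.rpow_eq_zero_iff, v0, vt]
          have hw0 : w K t ≠ 0 := by simp only [hw]; simp [ENNReal.rpow_eq_zero_iff, v0, vt]
          have : A t ≤ (w K t)⁻¹ * ρ (fun y => F.mx K (fun s => N s y) t) := by
            refine le_trans (h.mono _ (fun y => (w K t)⁻¹ * F.mx K (fun s => N s y) t) fun y => ?_)
              (h.smul _ _ (ENNReal.inv_ne_top.2 hw0))
            calc _ = (w K t)⁻¹ * (w K t * F.mx K (fun s => f s y) t) := by
                  rw [← mul_assoc, ENNReal.inv_mul_cancel hw0 (wt K t), one_mul]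
              _ ≤ _ := by gcongr; exact low2 t y
          calc w K t * A t ≤ w K t * ((w K t)⁻¹ * ρ (fun y => F.mx K (fun s => N s y) t)) := by gcongr
            _ = _ := by rw [← mul_assoc, ENNReal.mul_inv_cancel hw0 (wt K t), one_mul]
      _ ≤ C * ∫⁻ t, ρ (N t) ^ p₀ ∂μ := hV N mN K
      _ ≤ C * ∫⁻ t, κ ^ p₀ * v K t ^ p ∂μ := by
          gcongr with t
          refine (ENNReal.rpow_le_rpow (upp t) hp00.le).trans (le_of_eq ?_)
          rw [ENNReal.mul_rpow_of_nonneg _ _ hp00.le, ← ENNReal.rpow_mul]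
          congr 2
          rw [hr]; field_simp; ring
      _ = _ := by rw [lintegral_const_mul _ ((mv K).pow_const p), mul_assoc]
  have hconj : (p₀ / p).HolderConjugate (1 / r) := by
    rw [Real.holderConjugate_iff]
    refine ⟨by rw [lt_div_iff₀ hp0]; linarith, ?_⟩
    rw [hr]; field_simp; ring
  have h2 := ENNReal.lintegral_mul_le_Lp_mul_Lq μ hconj (f := fun t => (w K t * A t) ^ p)
    (g := fun t => v K t ^ (r * p)) (((mw K).mul mA).pow_const p).aemeasurable ((mv K).pow_const _).aemeasurable
  calc ∫⁻ t, A t ^ p ∂μ = ∫⁻ t, ((fun t => (w K t * A t) ^ p) * (fun t => v K t ^ (r * p))) t ∂μ := by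
        congr 1 with t
        simp only [Pi.mul_apply]
        rw [ENNReal.rpow_mul, ← ENNReal.mul_rpow_of_nonneg _ _ hp0.le]
        congr 1
        rw [mul_right_comm]
        simp only [hw]
        rw [← ENNReal.rpow_add _ _ (v0 K t) (vt K t)]
        simp
    _ ≤ _ := h2
    _ = (∫⁻ t, (w K t * A t) ^ p₀ ∂μ) ^ (p / p₀) * I ^ r := by
        simp only [← ENNReal.rpow_mul]
        rw [show p * (p₀ / p) = p₀ by field_simp, show r * p * (1 / r) = p by field_simp,
          show 1 / (p₀ / p) = p / p₀ by field_simp, show 1 / (1 / r) = r by field_simp]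
    _ ≤ (C * κ ^ p₀ * I) ^ (p / p₀) * I ^ r := by gcongr
    _ = (C * κ ^ p₀) ^ (p / p₀) * I := by
        rw [ENNReal.mul_rpow_of_nonneg _ _ (by positivity), mul_assoc,
          ← ENNReal.rpow_add_of_nonneg _ _ (by positivity) hr0.le]
        rw [hr]; simp
    _ ≤ _ := by rw [mul_assoc]; gcongr

theorem VB.down {p₀ p : ℝ} (hp : 1 < p) (hpp : p < p₀) {C D : ℝ≥0∞} (hC : C ≠ ⊤) (hD : D ≠ ⊤) :
    ∃ C' : ℝ≥0∞, C' ≠ ⊤ ∧ ∀ {α : Type} [MeasurableSpace α] {μ : Measure α} [SigmaFinite μ]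
      (F : Filt α μ) {ρ : (Y → ℝ≥0∞) → ℝ≥0∞}, F.D = D → LN ρ → VB F ρ p₀ C → VB F ρ p C' := by
  obtain ⟨C', hC', H⟩ := VB.down_core (Y := Y) hp hpp hC hD
  have hp0 : 0 < p := by linarith
  set T := (2 : ℝ≥0∞) ^ (p - 1) with hT
  have hTt : T ≠ ⊤ := ENNReal.rpow_ne_top_of_nonneg (by linarith) (by simp)
  refine ⟨C' * T + 1, ENNReal.add_ne_top.2 ⟨ENNReal.mul_ne_top hC' hTt, by simp⟩, ?_⟩
  intro α _ μ _ F ρ hFD h hV f hf K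
  have hφ : Measurable (fun t => ρ (f t)) := h.meas f hf
  by_cases hfin : ∫⁻ x, ρ (f x) ^ p ∂μ = ⊤
  · rw [hfin, ENNReal.mul_top (by simp)]; exact le_top
  refine le_trans ?_ (mul_le_mul' le_self_add le_rfl)
  have key : ∀ ε : ℝ≥0∞, ε ≠ 0 → ε ≠ ⊤ → ∫⁻ t, ρ (fun y => F.mx K (fun s => f s y) t) ^ p ∂μ ≤
      C' * T * ∫⁻ x, ρ (f x) ^ p ∂μ + C' * T * ε := by
    intro ε hε hεt
    obtain ⟨η, mη, η0, hη⟩ := exists_small μ hp0 hε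
    have e : ∫⁻ x, (ρ (f x) + η x) ^ p ∂μ ≤ T * (∫⁻ x, ρ (f x) ^ p ∂μ + ε) := by
      calc _ ≤ ∫⁻ x, T * (ρ (f x) ^ p + η x ^ p) ∂μ :=
            lintegral_mono fun x => ENNReal.rpow_add_le_mul_rpow_add_rpow _ _ hp.le
        _ = T * (∫⁻ x, ρ (f x) ^ p ∂μ + ∫⁻ x, η x ^ p ∂μ) := by
            rw [lintegral_const_mul' _ _ hTt, lintegral_add_left (hφ.pow_const p)]
        _ ≤ _ := by gcongr
    have := H F hFD h hV f hf (fun x => ρ (f x) + η x) (hφ.add mη) (fun x => by simp [η0]) (fun t => le_self_add)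
      (ne_top_of_le_ne_top (ENNReal.mul_ne_top hTt (ENNReal.add_ne_top.2 ⟨hfin, hεt⟩)) e) K
    refine this.trans ((mul_le_mul' le_rfl e).trans (le_of_eq (by ring)))
  have hCT : C' * T ≠ ⊤ := ENNReal.mul_ne_top hC' hTt
  refine ENNReal.le_of_forall_pos_le_add fun δ hδ _ => ?_
  have hδ' : (δ : ℝ≥0∞) / (C' * T + 1) ≠ 0 := by
    simp [ENNReal.div_eq_zero_iff, hδ.ne', hCT]
  have hδt : (δ : ℝ≥0∞) / (C' * T + 1) ≠ ⊤ := ENNReal.div_ne_top (by simp) (by simp)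
  refine (key _ hδ' hδt).trans (add_le_add le_rfl ?_)
  calc _ ≤ (C' * T + 1) * ((δ : ℝ≥0∞) / (C' * T + 1)) := by gcongr; exact le_self_add
    _ ≤ _ := ENNReal.mul_div_le
end V

lemma measurable_snoc (n : ℕ) : Measurable (fun z : (Fin n → ℝ) × ℝ => (Fin.snoc z.1 z.2 : Fin (n + 1) → ℝ)) := by
  rw [measurable_pi_iff]
  intro i
  refine Fin.lastCases ?_ (fun j => ?_) i
  · simpa using measurable_snd
  · simpa [Function.comp_def] using (measurable_pi_apply j).comp (measurable_fst (α := Fin n → ℝ) (β := ℝ))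

lemma measurable_snoc' {n : ℕ} {β : Type} [MeasurableSpace β] {a : β → Fin n → ℝ} {b : β → ℝ}
    (ha : Measurable a) (hb : Measurable b) : Measurable (fun z => (Fin.snoc (a z) (b z) : Fin (n + 1) → ℝ)) :=
  (measurable_snoc n).comp (ha.prodMk hb)

lemma lint_succ {n : ℕ} {g : (Fin (n + 1) → ℝ) → ℝ≥0∞} (hg : Measurable g) :
    ∫⁻ x, g x = ∫⁻ t : ℝ, ∫⁻ y : Fin n → ℝ, g (Fin.snoc y t) := by
  have h := (volume_preserving_piFinSuccAbove (fun _ : Fin (n + 1) => ℝ) (Fin.last n)).symm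
  rw [← h.lintegral_comp hg, Measure.volume_eq_prod, lintegral_prod]
  · simp [MeasurableEquiv.piFinSuccAbove, Fin.insertNthEquiv, Fin.insertNth_last']
  · exact (hg.comp h.measurable).aemeasurable

lemma mln_succ (n : ℕ) (q : Fin (n + 1) → ℝ) (g : (Fin (n + 1) → ℝ) → ℝ≥0∞) :
    mixedLnorm (n + 1) q g = (∫⁻ t : ℝ, (mixedLnorm n (fun i => q i.castSucc)
          (fun y => g (Fin.snoc y t))) ^ q (Fin.last n)) ^ (1 / q (Fin.last n)) := rfl

lemma mln_zero (q : Fin 0 → ℝ) (g : (Fin 0 → ℝ) → ℝ≥0∞) (x : Fin 0 → ℝ) : mixedLnorm 0 q g = g x := by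
  have : x = fun i => i.elim0 := Subsingleton.elim _ _
  rw [this]; rfl

lemma lint_zero (g : (Fin 0 → ℝ) → ℝ≥0∞) (x : Fin 0 → ℝ) : ∫⁻ y, g y = g x := by
  have : ∀ y, g y = g x := fun y => by rw [Subsingleton.elim y x]
  simp [this, volume_pi, Measure.pi_of_empty]

lemma mln_mono {n : ℕ} {q : Fin n → ℝ} (hq : ∀ j, 0 < q j) {g h : (Fin n → ℝ) → ℝ≥0∞}
    (hgh : ∀ x, g x ≤ h x) : mixedLnorm n q g ≤ mixedLnorm n q h := by
  induction n with
  | zero => exact hgh _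
  | succ n ih =>
    rw [mln_succ, mln_succ]
    refine ENNReal.rpow_le_rpow (lintegral_mono fun t => ENNReal.rpow_le_rpow ?_ (hq _).le) (by have := hq (Fin.last n); positivity)
    exact ih (fun j => hq _) fun y => hgh _

lemma mln_meas {n : ℕ} {q : Fin n → ℝ} {α : Type} [MeasurableSpace α] {f : α → (Fin n → ℝ) → ℝ≥0∞}
    (hf : Measurable (Function.uncurry f)) : Measurable (fun a => mixedLnorm n q (f a)) := by
  induction n generalizing α with
  | zero => exact hf.of_uncurry_right (y := fun i => i.elim0)
  | succ n ih =>
    simp only [mln_succ]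
    refine Measurable.pow_const ?_ _
    refine Measurable.lintegral_prod_right' (f := fun z : α × ℝ => mixedLnorm n (fun i => q i.castSucc)
      (fun y => f z.1 (Fin.snoc y z.2)) ^ q (Fin.last n)) ?_
    refine Measurable.pow_const ?_ _
    refine ih (f := fun z : α × ℝ => fun y => f z.1 (Fin.snoc y z.2)) ?_
    exact hf.comp ((measurable_fst.comp measurable_fst).prodMk
      (measurable_snoc' measurable_snd (measurable_snd.comp measurable_fst)))

lemma mln_meas1 {n : ℕ} {q : Fin n → ℝ} {g : (Fin (n + 1) → ℝ) → ℝ≥0∞} (hg : Measurable g) :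
    Measurable (fun t => mixedLnorm n q (fun y => g (Fin.snoc y t))) :=
  mln_meas (f := fun t y => g (Fin.snoc y t)) (hg.comp (measurable_snoc' measurable_snd measurable_fst))

lemma mln_smul {n : ℕ} {q : Fin n → ℝ} (hq : ∀ j, 0 < q j) {c : ℝ≥0∞} (hc : c ≠ ⊤) (g : (Fin n → ℝ) → ℝ≥0∞) :
    mixedLnorm n q (fun x => c * g x) = c * mixedLnorm n q g := by
  induction n with
  | zero => rfl
  | succ n ih =>
    have hl := hq (Fin.last n)
    simp only [mln_succ, ih (fun j => hq _), ENNReal.mul_rpow_of_nonneg _ _ hl.le]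
    rw [lintegral_const_mul' _ _ (ENNReal.rpow_ne_top_of_nonneg hl.le hc),
      ENNReal.mul_rpow_of_nonneg _ _ (by positivity), ← ENNReal.rpow_mul, mul_one_div_cancel hl.ne', ENNReal.rpow_one]

lemma mln_iSup {n : ℕ} {q : Fin n → ℝ} (hq : ∀ j, 0 < q j) {g : ℕ → (Fin n → ℝ) → ℝ≥0∞}
    (hg : ∀ i, Measurable (g i)) (hm : Monotone g) :
    mixedLnorm n q (fun x => ⨆ i, g i x) = ⨆ i, mixedLnorm n q (g i) := by
  induction n with
  | zero => rfl
  | succ n ih =>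
    have hl := hq (Fin.last n)
    have e : ∀ t, mixedLnorm n (fun i => q i.castSucc) (fun y => ⨆ i, g i (Fin.snoc y t)) =
        ⨆ i, mixedLnorm n (fun i => q i.castSucc) (fun y => g i (Fin.snoc y t)) := fun t =>
      ih (g := fun i y => g i (Fin.snoc y t)) (fun j => hq _) (fun i => (hg i).comp (measurable_snoc' measurable_id measurable_const)) (fun i j hij y => hm hij _)
    simp only [mln_succ, e]
    have hpow : ∀ (s : ℝ), 0 < s → ∀ a : ℕ → ℝ≥0∞, (⨆ i, a i) ^ s = ⨆ i, a i ^ s := fun s hs a =>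
      (ENNReal.orderIsoRpow s hs).map_iSup a
    simp only [hpow _ hl]
    rw [lintegral_iSup, hpow _ (by positivity)]
    · exact fun i => (mln_meas1 (hg i)).pow_const _
    · intro i j hij t
      exact ENNReal.rpow_le_rpow (mln_mono (fun j => hq _) fun y => hm hij _) hl.le

lemma mln_prod {n m : ℕ} {q : Fin n → ℝ} {Q : Fin m → Fin n → ℝ} (hQ : ∀ k j, 0 < Q k j)
    (hq0 : ∀ j, 0 < q j) (hq : ∀ j, 1 / q j = ∑ k, 1 / Q k j) {h : Fin m → (Fin n → ℝ) → ℝ≥0∞} (hh : ∀ k, Measurable (h k)) :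
    mixedLnorm n q (fun x => ∏ k, h k x) ≤ ∏ k, mixedLnorm n (Q k) (h k) := by
  induction n with
  | zero => exact le_rfl
  | succ n ih =>
    have hl := hq0 (Fin.last n)
    set p := q (Fin.last n) with hp
    simp only [mln_succ]
    rw [← hp]
    have h1 : ∫⁻ t : ℝ, mixedLnorm n (fun i => q i.castSucc) (fun y => ∏ k, h k (Fin.snoc y t)) ^ p ≤
        ∏ k, (∫⁻ t : ℝ, mixedLnorm n (fun i => Q k i.castSucc) (fun y => h k (Fin.snoc y t)) ^ Q k (Fin.last n)) ^ (p / Q k (Fin.last n)) := by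
      refine le_trans (lintegral_mono fun t => ?_) (ENNReal.lintegral_prod_norm_pow_le (Finset.univ : Finset (Fin m))
        (f := fun k t => mixedLnorm n (fun i => Q k i.castSucc) (fun y => h k (Fin.snoc y t)) ^ Q k (Fin.last n))
        (p := fun k => p / Q k (Fin.last n)) (fun k _ => ((mln_meas1 (hh k)).pow_const _).aemeasurable) ?_ ?_)
      · simp only [← ENNReal.rpow_mul, mul_div_cancel₀ _ (hQ _ _).ne']
        rw [ENNReal.prod_rpow_of_nonneg hl.le]
        refine ENNReal.rpow_le_rpow ?_ hl.le
        exact ih (q := fun i => q i.castSucc) (Q := fun k i => Q k i.castSucc) (h := fun k y => h k (Fin.snoc y t))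
          (fun k j => hQ _ _) (fun j => hq0 _) (fun j => hq _) (fun k => (hh k).comp (measurable_snoc' measurable_id measurable_const))
      · have := hq (Fin.last n)
        simp only [div_eq_mul_one_div p]
        rw [← Finset.mul_sum, ← this, mul_one_div_cancel hl.ne']
      · intro k _
        have := hQ k (Fin.last n)
        positivity
    calc _ ≤ _ := ENNReal.rpow_le_rpow h1 (by positivity)
      _ = _ := by
        rw [← ENNReal.prod_rpow_of_nonneg (by positivity)]
        refine Finset.prod_congr rfl fun k _ => ?_
        rw [← ENNReal.rpow_mul]
        congr 1; field_simp

/-- The conjugate exponents. -/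
def cj {n : ℕ} (q : Fin n → ℝ) : Fin n → ℝ := fun j => (q j).conjExponent

lemma cj_gt {n : ℕ} {q : Fin n → ℝ} (hq : ∀ j, 1 < q j) (j : Fin n) : 1 < cj q j :=
  (Real.HolderConjugate.conjExponent (hq j)).symm.lt

lemma mln_holder {n : ℕ} {q : Fin n → ℝ} (hq : ∀ j, 1 < q j) {g h : (Fin n → ℝ) → ℝ≥0∞}
    (hg : Measurable g) (hh : Measurable h) : ∫⁻ x, g x * h x ≤ mixedLnorm n q g * mixedLnorm n (cj q) h := by
  induction n with
  | zero =>
    rw [lint_zero _ (fun i => i.elim0)]; exact le_rfl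
  | succ n ih =>
    rw [lint_succ (g := fun x => g x * h x) (hg.mul hh), mln_succ, mln_succ]
    refine le_trans (lintegral_mono fun t => ih (q := fun i => q i.castSucc) (fun j => hq _)
      (hg.comp (measurable_snoc' measurable_id measurable_const)) (hh.comp (measurable_snoc' measurable_id measurable_const))) ?_
    exact ENNReal.lintegral_mul_le_Lp_mul_Lq volume (Real.HolderConjugate.conjExponent (hq (Fin.last n)))
      (mln_meas1 hg).aemeasurable (mln_meas1 hh).aemeasurable

/-- Norming function. -/
def nf : (n : ℕ) → (Fin n → ℝ) → ((Fin n → ℝ) → ℝ≥0∞) → (Fin n → ℝ) → ℝ≥0∞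
  | 0, _, _, _ => 1
  | (n + 1), q, h, x => nf n (fun i => q i.castSucc) (fun y => h (Fin.snoc y (x (Fin.last n)))) (fun i => x i.castSucc) *
      (mixedLnorm n (fun i => q i.castSucc) (fun y => h (Fin.snoc y (x (Fin.last n)))) / mixedLnorm (n + 1) q h) ^ (q (Fin.last n) - 1)

lemma nf_snoc (n : ℕ) (q : Fin (n + 1) → ℝ) (h : (Fin (n + 1) → ℝ) → ℝ≥0∞) (y : Fin n → ℝ) (t : ℝ) :
    nf (n + 1) q h (Fin.snoc y t) = nf n (fun i => q i.castSucc) (fun y => h (Fin.snoc y t)) y *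
      (mixedLnorm n (fun i => q i.castSucc) (fun y => h (Fin.snoc y t)) / mixedLnorm (n + 1) q h) ^ (q (Fin.last n) - 1) := by
  rw [nf]; simp

lemma nf_meas {n : ℕ} {q : Fin n → ℝ} {α : Type} [MeasurableSpace α] {f : α → (Fin n → ℝ) → ℝ≥0∞}
    (hf : Measurable (Function.uncurry f)) : Measurable (fun z : α × (Fin n → ℝ) => nf n q (f z.1) z.2) := by
  induction n generalizing α with
  | zero => exact measurable_const
  | succ n ih =>
    simp only [nf]
    have hf' : Measurable (Function.uncurry fun (z : α × ℝ) (y : Fin n → ℝ) => f z.1 (Fin.snoc y z.2)) :=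
      hf.comp ((measurable_fst.comp measurable_fst).prodMk
        (measurable_snoc' measurable_snd (measurable_snd.comp measurable_fst)))
    have hl : Measurable (fun z : α × (Fin (n + 1) → ℝ) => (z.1, z.2 (Fin.last n))) :=
      measurable_fst.prodMk ((measurable_pi_apply _).comp measurable_snd)
    refine Measurable.mul ?_ (Measurable.pow_const (Measurable.div ?_ ?_) _)
    · exact (ih (q := fun i => q i.castSucc) hf').comp (hl.prodMk (measurable_pi_iff.2 fun i => (measurable_pi_apply _).comp measurable_snd))
    · exact (mln_meas (q := fun i => q i.castSucc) hf').comp hl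
    · exact (mln_meas hf).comp measurable_fst

lemma nf_meas1 {n : ℕ} {q : Fin n → ℝ} {f : (Fin n → ℝ) → ℝ≥0∞}
    (hf : Measurable f) : Measurable (nf n q f) := by
  have := nf_meas (q := q) (α := Unit) (f := fun _ => f) (hf.comp measurable_snd)
  exact this.comp (measurable_const (a := ()) |>.prodMk measurable_id)

lemma mln_rpow {n : ℕ} {q : Fin (n + 1) → ℝ} (hq : 0 < q (Fin.last n)) (g : (Fin (n + 1) → ℝ) → ℝ≥0∞) :
    mixedLnorm (n + 1) q g ^ q (Fin.last n) = ∫⁻ t : ℝ, (mixedLnorm n (fun i => q i.castSucc)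
          (fun y => g (Fin.snoc y t))) ^ q (Fin.last n) := by
  rw [mln_succ, ← ENNReal.rpow_mul, one_div_mul_cancel hq.ne', ENNReal.rpow_one]

lemma mln_ae_top {n : ℕ} {q : Fin (n + 1) → ℝ} (hq : 0 < q (Fin.last n)) {g : (Fin (n + 1) → ℝ) → ℝ≥0∞}
    (hg : Measurable g) (h : mixedLnorm (n + 1) q g ≠ ⊤) :
    ∀ᵐ t : ℝ, mixedLnorm n (fun i => q i.castSucc) (fun y => g (Fin.snoc y t)) ≠ ⊤ := by
  have h1 := ENNReal.rpow_ne_top_of_nonneg hq.le h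
  rw [mln_rpow hq] at h1
  filter_upwards [ae_lt_top ((mln_meas1 hg).pow_const _) h1] with t ht h2
  rw [h2, ENNReal.top_rpow_of_pos hq] at ht
  exact lt_irrefl _ ht

lemma mln_ae_zero {n : ℕ} {q : Fin (n + 1) → ℝ} (hq : 0 < q (Fin.last n)) {g : (Fin (n + 1) → ℝ) → ℝ≥0∞}
    (hg : Measurable g) (h : mixedLnorm (n + 1) q g = 0) :
    ∀ᵐ t : ℝ, mixedLnorm n (fun i => q i.castSucc) (fun y => g (Fin.snoc y t)) = 0 := by
  have h1 := mln_rpow hq g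
  rw [h, ENNReal.zero_rpow_of_pos hq] at h1
  have h2 := (lintegral_eq_zero_iff ((mln_meas1 hg).pow_const _)).1 h1.symm
  filter_upwards [h2] with t ht
  simpa [ENNReal.rpow_eq_zero_iff, hq, hq.le, not_lt.2 hq.le] using ht

lemma nf_le {n : ℕ} {q : Fin n → ℝ} (hq : ∀ j, 1 < q j) {h : (Fin n → ℝ) → ℝ≥0∞} (hh : Measurable h) :
    mixedLnorm n (cj q) (nf n q h) ≤ 1 := by
  induction n with
  | zero => exact le_rfl
  | succ n ih =>
    rw [mln_succ]
    have hl := hq (Fin.last n)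
    have hl0 : 0 < q (Fin.last n) := by linarith
    have hc0 : 0 < cj q (Fin.last n) := by linarith [cj_gt hq (Fin.last n)]
    have hcj : (fun i : Fin n => cj q i.castSucc) = cj (fun i : Fin n => q i.castSucc) := rfl
    set ρ := mixedLnorm (n + 1) q h with hρ
    set a : ℝ → ℝ≥0∞ := fun t => mixedLnorm n (fun i => q i.castSucc) (fun y => h (Fin.snoc y t)) with ha
    have ma : Measurable a := mln_meas1 hh
    have hfin : ∀ᵐ t : ℝ, a t / ρ ≠ ⊤ := by
      rcases eq_or_ne ρ 0 with h0 | h0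
      · filter_upwards [mln_ae_zero hl0 hh h0] with t ht
        simp [ha, ht]
      rcases eq_or_ne ρ ⊤ with ht | ht
      · exact Filter.Eventually.of_forall fun t => by simp [ht]
      · filter_upwards [mln_ae_top hl0 hh ht] with t ht'
        exact ENNReal.div_ne_top ht' h0
    refine ENNReal.rpow_le_one ?_ (by positivity)
    calc _ ≤ ∫⁻ t, (a t / ρ) ^ q (Fin.last n) := by
          refine lintegral_mono_ae ?_
          filter_upwards [hfin] with t ht
          have hk : (a t / ρ) ^ (q (Fin.last n) - 1) ≠ ⊤ := ENNReal.rpow_ne_top_of_nonneg (by linarith) ht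
          simp only [nf_snoc]
          have e : mixedLnorm n (fun i => cj q i.castSucc) (fun y => nf n (fun i => q i.castSucc) (fun y => h (Fin.snoc y t)) y * (a t / ρ) ^ (q (Fin.last n) - 1)) ≤ (a t / ρ) ^ (q (Fin.last n) - 1) := by
            simp only [mul_comm _ ((a t / ρ) ^ (q (Fin.last n) - 1))]
            rw [mln_smul (fun j => by have := cj_gt hq j.castSucc; linarith) hk]
            refine mul_le_of_le_one_right' ?_
            exact ih (fun j => hq _) (hh.comp (measurable_snoc' measurable_id measurable_const))
          refine (ENNReal.rpow_le_rpow e hc0.le).trans (le_of_eq ?_)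
          rw [← ENNReal.rpow_mul]
          congr 1
          have : cj q (Fin.last n) = q (Fin.last n) / (q (Fin.last n) - 1) := rfl
          rw [this, mul_div_cancel₀]
          linarith
      _ = ∫⁻ t, (ρ⁻¹) ^ q (Fin.last n) * a t ^ q (Fin.last n) := by
          congr 1 with t
          rw [ENNReal.div_eq_inv_mul, ENNReal.mul_rpow_of_nonneg _ _ hl0.le]
      _ = (ρ⁻¹ * ρ) ^ q (Fin.last n) := by
          rw [lintegral_const_mul _ (ma.pow_const _), ENNReal.mul_rpow_of_nonneg _ _ hl0.le, hρ, mln_rpow hl0]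
      _ ≤ 1 := ENNReal.rpow_le_one (ENNReal.inv_mul_le_one _) hl0.le

lemma nf_ge {n : ℕ} {q : Fin n → ℝ} (hq : ∀ j, 1 < q j) {h : (Fin n → ℝ) → ℝ≥0∞} (hh : Measurable h)
    (hfin : mixedLnorm n q h ≠ ⊤) : mixedLnorm n q h ≤ ∫⁻ x, h x * nf n q h x := by
  induction n with
  | zero => rw [lint_zero _ (fun i => i.elim0)]; simp [nf, mixedLnorm]
  | succ n ih =>
    have hl := hq (Fin.last n)
    have hl0 : 0 < q (Fin.last n) := by linarith
    set ρ := mixedLnorm (n + 1) q h with hρ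
    rcases eq_or_ne ρ 0 with h0 | h0
    · rw [h0]; exact zero_le
    set a : ℝ → ℝ≥0∞ := fun t => mixedLnorm n (fun i => q i.castSucc) (fun y => h (Fin.snoc y t)) with ha
    have ma : Measurable a := mln_meas1 hh
    rw [lint_succ (g := fun x => h x * nf (n + 1) q h x) (hh.mul (nf_meas1 hh))]
    calc ρ = (ρ⁻¹) ^ (q (Fin.last n) - 1) * ρ ^ q (Fin.last n) := by
          rw [← rpow_split hl ρ, mul_left_comm, ← ENNReal.mul_rpow_of_nonneg _ _ (by linarith),
            ENNReal.inv_mul_cancel h0 hfin, ENNReal.one_rpow, mul_one]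
      _ = ∫⁻ t, (ρ⁻¹) ^ (q (Fin.last n) - 1) * a t ^ q (Fin.last n) := by
          rw [lintegral_const_mul _ (ma.pow_const _), hρ, mln_rpow hl0]
      _ ≤ _ := by
          refine lintegral_mono_ae ?_
          filter_upwards [mln_ae_top hl0 hh hfin] with t ht
          simp only [nf_snoc, ← mul_assoc]
          have mt : Measurable (fun y : Fin n → ℝ => h (Fin.snoc y t)) := hh.comp (measurable_snoc' measurable_id measurable_const)
          rw [lintegral_mul_const (f := fun y => h (Fin.snoc y t) * nf n (fun i => q i.castSucc) (fun y => h (Fin.snoc y t)) y) _ (mt.mul (nf_meas1 mt))]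
          calc _ = a t * (a t / ρ) ^ (q (Fin.last n) - 1) := by
                rw [ENNReal.div_eq_inv_mul, ENNReal.mul_rpow_of_nonneg _ _ (by linarith), mul_left_comm, rpow_split hl]
            _ ≤ _ := by
                refine mul_le_mul' ?_ le_rfl
                exact ih (fun j => hq _) mt ht

/-- Indicator of a box. -/
def bx (n : ℕ) (R : ℝ) (x : Fin n → ℝ) : ℝ≥0∞ := {x : Fin n → ℝ | ∀ i, |x i| ≤ R}.indicator 1 x

lemma bx_meas (n : ℕ) (R : ℝ) : Measurable (bx n R) := by
  refine measurable_one.indicator ?_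
  simp only [setOf_forall]
  exact MeasurableSet.iInter fun i => measurableSet_le (measurable_pi_apply i).abs measurable_const

lemma bx_le (n : ℕ) (R : ℝ) (x : Fin n → ℝ) : bx n R x ≤ 1 := by
  unfold bx
  by_cases h : x ∈ {x : Fin n → ℝ | ∀ i, |x i| ≤ R}
  · rw [indicator_of_mem h]; exact le_rfl
  · rw [indicator_of_notMem h]; exact zero_le

lemma bx_fin (n : ℕ) (R : ℝ) {q : Fin n → ℝ} (hq : ∀ j, 0 < q j) : mixedLnorm n q (bx n R) ≠ ⊤ := by
  induction n with
  | zero => rw [mln_zero _ _ (fun i => i.elim0)]; simp [bx]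
  | succ n ih =>
    have hl := hq (Fin.last n)
    rw [mln_succ]
    have e : ∀ t, mixedLnorm n (fun i => q i.castSucc) (fun y => bx (n + 1) R (Fin.snoc y t)) ^ q (Fin.last n) ≤
      (Icc (-R) R).indicator (fun _ => mixedLnorm n (fun i => q i.castSucc) (bx n R) ^ q (Fin.last n)) t := by
      intro t
      by_cases ht : |t| ≤ R
      · rw [indicator_of_mem (show t ∈ Icc (-R) R from abs_le.1 ht)]
        refine ENNReal.rpow_le_rpow (mln_mono (fun j => hq _) fun y => ?_) hl.le
        simp only [bx]
        by_cases hy : ∀ i, |y i| ≤ R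
        · simp [Set.indicator, hy, Set.indicator_apply, apply_ite]
          split_ifs <;> simp
        · have : ¬ ∀ i, |(Fin.snoc y t : Fin (n + 1) → ℝ) i| ≤ R := by
            intro h; exact hy fun i => by simpa using h i.castSucc
          simp [Set.indicator, hy, this]
      · have : (fun y : Fin n → ℝ => bx (n + 1) R (Fin.snoc y t)) = fun y => 0 * bx n R y := by
          funext y
          have : ¬ ∀ i, |(Fin.snoc y t : Fin (n + 1) → ℝ) i| ≤ R := by
            intro h; exact ht (by simpa using h (Fin.last n))
          simp [bx, Set.indicator, this]
        rw [this, mln_smul (fun j => hq _) (by simp), zero_mul, ENNReal.zero_rpow_of_pos hl]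
        exact zero_le
    refine ENNReal.rpow_ne_top_of_nonneg (by positivity) (ne_top_of_le_ne_top ?_ (lintegral_mono e))
    rw [lintegral_indicator measurableSet_Icc]
    simp only [lintegral_const, Measure.restrict_apply MeasurableSet.univ, univ_inter]
    exact ENNReal.mul_ne_top (ENNReal.rpow_ne_top_of_nonneg hl.le (ih fun j => hq _)) (by simp)

lemma mln_dual {n : ℕ} {q : Fin n → ℝ} (hq : ∀ j, 1 < q j) {h : (Fin n → ℝ) → ℝ≥0∞} (hh : Measurable h)
    {C : ℝ≥0∞} (H : ∀ g, Measurable g → ∫⁻ x, h x * g x ≤ C * mixedLnorm n (cj q) g) : mixedLnorm n q h ≤ C := by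
  have hq0 : ∀ j, 0 < q j := fun j => by linarith [hq j]
  set hj : ℕ → (Fin n → ℝ) → ℝ≥0∞ := fun j x => min (h x) j * bx n j x with hhj
  have mj : ∀ j, Measurable (hj j) := fun j => (hh.min measurable_const).mul (bx_meas n j)
  have hmono : Monotone hj := by
    intro i j hij x
    simp only [hhj]
    gcongr
    simp only [bx]
    refine Set.indicator_le_indicator_of_subset (fun x hx k => (hx k).trans (by exact_mod_cast hij)) (fun _ => zero_le) x
  have hle : ∀ j x, hj j x ≤ h x := fun j x => by
    simp only [hhj]
    exact (mul_le_of_le_one_right' (bx_le n j x)).trans (min_le_left _ _)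
  have hsup : ∀ x, h x = ⨆ j, hj j x := by
    intro x
    apply le_antisymm _ (iSup_le fun j => hle j x)
    obtain ⟨J, hJ⟩ : ∃ J : ℕ, ∀ i, |x i| ≤ J := by
      obtain ⟨J, hJ⟩ := exists_nat_ge (∑ i, |x i|)
      exact ⟨J, fun i => (Finset.single_le_sum (f := fun i => |x i|) (fun _ _ => abs_nonneg _) (Finset.mem_univ i)).trans hJ⟩
    have e : ∀ j : ℕ, min (h x) (j : ℝ≥0∞) ≤ hj (max j J) x := by
      intro j
      have : bx n ((max j J : ℕ) : ℝ) x = 1 := by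
        simp only [bx]
        rw [indicator_of_mem]; · rfl
        intro i; exact (hJ i).trans (by exact_mod_cast le_max_right _ _)
      simp only [hhj, this, mul_one]
      gcongr; exact le_max_left _ _
    calc h x = min (h x) (⨆ j : ℕ, (j : ℝ≥0∞)) := by simp [ENNReal.iSup_natCast]
      _ = ⨆ j : ℕ, min (h x) j := inf_iSup_eq _ _
      _ ≤ _ := iSup_le fun j => (e j).trans (le_iSup (fun j => hj j x) _)
  have e2 : mixedLnorm n q h = ⨆ j, mixedLnorm n q (hj j) := by
    rw [← mln_iSup hq0 mj hmono]; congr 1; funext x; exact hsup x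
  rw [e2]
  refine iSup_le fun j => ?_
  have hf : mixedLnorm n q (hj j) ≠ ⊤ := by
    have : mixedLnorm n q (hj j) ≤ mixedLnorm n q (fun x => (j : ℝ≥0∞) * bx n j x) :=
      mln_mono hq0 fun x => mul_le_mul' (min_le_right _ _) le_rfl
    rw [mln_smul hq0 (by simp)] at this
    exact ne_top_of_le_ne_top (ENNReal.mul_ne_top (by simp) (bx_fin n j hq0)) this
  calc _ ≤ ∫⁻ x, hj j x * nf n q (hj j) x := nf_ge hq (mj j) hf
    _ ≤ ∫⁻ x, h x * nf n q (hj j) x := lintegral_mono fun x => mul_le_mul' (hle j x) le_rfl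
    _ ≤ C * mixedLnorm n (cj q) (nf n q (hj j)) := H _ (nf_meas1 (mj j))
    _ ≤ C := mul_le_of_le_one_right' (nf_le hq (mj j))

theorem mln_LN {n : ℕ} {q : Fin n → ℝ} (hq : ∀ j, 1 < q j) : LN (mixedLnorm n q) := by
  have hq0 : ∀ j, 0 < q j := fun j => by linarith [hq j]
  refine ⟨fun g h => mln_mono hq0, ?_, fun c g hc => (mln_smul hq0 hc g).le, ?_, fun f => mln_meas⟩
  · intro g h mg mh
    refine mln_dual (h := fun y => g y + h y) hq (mg.add mh) fun φ mφ => ?_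
    simp only [add_mul]
    rw [lintegral_add_left (f := fun x => g x * φ x) (mg.mul mφ)]
    exact add_le_add (mln_holder hq mg mφ) (mln_holder hq mh mφ)
  · intro α _ μ _ f hf
    refine mln_dual (h := fun y => ∫⁻ t, f t y ∂μ) hq (Measurable.lintegral_prod_left' hf) fun φ mφ => ?_
    calc _ = ∫⁻ x, (∫⁻ t, f t x * φ x ∂μ) := by
          congr 1 with x
          rw [lintegral_mul_const _ hf.of_uncurry_right]
      _ = ∫⁻ t, (∫⁻ x, f t x * φ x) ∂μ := by
          rw [lintegral_lintegral_swap]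
          exact ((hf.comp measurable_swap).mul (mφ.comp measurable_fst)).aemeasurable
      _ ≤ ∫⁻ t, mixedLnorm n q (f t) * mixedLnorm n (cj q) φ ∂μ :=
          lintegral_mono fun t => mln_holder hq hf.of_uncurry_left mφ
      _ = _ := lintegral_mul_const _ (mln_meas hf)

lemma Filt.measurable_mx3 {α : Type} [MeasurableSpace α] {μ : Measure α} [SigmaFinite μ] (F : Filt α μ)
    {β δ : Type} [MeasurableSpace β] [MeasurableSpace δ] (K : ℕ) {g : α → β → δ → ℝ≥0∞}
    (hg : Measurable (Function.uncurry fun (s : α) (w : β × δ) => g s w.1 w.2)) :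
    Measurable (Function.uncurry fun (z : α × β) (y : δ) => F.mx K (fun s => g s z.2 y) z.1) := by
  have h1 : Measurable (fun z : α × (β × δ) => F.mx K (fun s => g s z.2.1 z.2.2) z.1) := F.measurable_mx2 K hg
  generalize hG : (fun z : α × (β × δ) => F.mx K (fun s => g s z.2.1 z.2.2) z.1) = G at h1
  have h2 : Measurable (fun z : (α × β) × δ => (z.1.1, (z.1.2, z.2))) :=
    (measurable_fst.comp measurable_fst).prodMk ((measurable_snd.comp measurable_fst).prodMk measurable_snd)
  have e : (Function.uncurry fun (z : α × β) (y : δ) => F.mx K (fun s => g s z.2 y) z.1) =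
      fun z : (α × β) × δ => G (z.1.1, (z.1.2, z.2)) := by
    rw [← hG]; rfl
  rw [e]
  exact Measurable.comp h1 h2

lemma mln_VB_base {n : ℕ} {q : Fin (n + 1) → ℝ} (hl0 : 0 < q (Fin.last n)) {C : ℝ≥0∞} (hC : C ≠ ⊤)
    {α : Type} [MeasurableSpace α] {μ : Measure α} [SigmaFinite μ] (F : Filt α μ)
    (H : VB F (mixedLnorm n (fun i => q i.castSucc)) (q (Fin.last n)) C) :
    VB F (mixedLnorm (n + 1) q) (q (Fin.last n)) C := by
      intro f hf K
      simp only [mln_rpow hl0]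
      have hf' : Measurable (Function.uncurry fun (z : α × ℝ) (y : Fin n → ℝ) => f z.1 (Fin.snoc y z.2)) :=
        hf.comp ((measurable_fst.comp measurable_fst).prodMk
          (measurable_snoc' measurable_snd (measurable_snd.comp measurable_fst)))
      have hft : ∀ t : ℝ, Measurable (Function.uncurry fun (a : α) (y : Fin n → ℝ) => f a (Fin.snoc y t)) := fun t =>
        hf.comp (measurable_fst.prodMk (measurable_snoc' measurable_snd measurable_const))
      have hM' : Measurable (Function.uncurry fun (z : α × ℝ) (y : Fin n → ℝ) => F.mx K (fun s => f s (Fin.snoc y z.2)) z.1) := by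
        have h0 : Measurable (Function.uncurry fun (s : α) (w : ℝ × (Fin n → ℝ)) => f s (Fin.snoc w.2 w.1)) :=
          hf.comp (measurable_fst.prodMk (measurable_snoc' (measurable_snd.comp measurable_snd) (measurable_fst.comp measurable_snd)))
        exact F.measurable_mx3 K (g := fun s t y => f s (Fin.snoc y t)) h0
      have m1 : Measurable (Function.uncurry fun (a : α) (t : ℝ) => mixedLnorm n (fun i => q i.castSucc)
          (fun y => F.mx K (fun s => f s (Fin.snoc y t)) a) ^ q (Fin.last n)) := (mln_meas (q := fun i => q i.castSucc) hM').pow_const _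
      have m2 : Measurable (Function.uncurry fun (a : α) (t : ℝ) => mixedLnorm n (fun i => q i.castSucc)
          (fun y => f a (Fin.snoc y t)) ^ q (Fin.last n)) := (mln_meas (q := fun i => q i.castSucc) hf').pow_const _
      have s1 := lintegral_lintegral_swap (μ := μ) (ν := (volume : Measure ℝ)) m1.aemeasurable
      have s2 := lintegral_lintegral_swap (μ := μ) (ν := (volume : Measure ℝ)) m2.aemeasurable
      refine s1.trans_le ?_
      rw [s2, ← lintegral_const_mul' _ _ hC]
      exact lintegral_mono fun t => H (fun a y => f a (Fin.snoc y t)) (hft t) K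

theorem mln_VB {n : ℕ} {q : Fin n → ℝ} (hq : ∀ j, 1 < q j) {p : ℝ} (hp : 1 < p) {D : ℝ≥0∞} (hD : D ≠ ⊤) :
    ∃ C : ℝ≥0∞, C ≠ ⊤ ∧ ∀ {α : Type} [MeasurableSpace α] {μ : Measure α} [SigmaFinite μ] (F : Filt α μ),
      F.D = D → VB F (mixedLnorm n q) p C := by
  induction n generalizing p with
  | zero =>
    refine ⟨((1 + ENNReal.ofReal (p - 1)) / ENNReal.ofReal (p - 1)) ^ p, ?_, ?_⟩
    · refine ENNReal.rpow_ne_top_of_nonneg (by linarith) (ENNReal.div_ne_top (by simp) ?_)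
      simp [hp]
    · intro α _ μ _ F _ f hf K
      exact F.doob hp K hf.of_uncurry_right
  | succ n ih =>
    have hl := hq (Fin.last n)
    have hl0 : 0 < q (Fin.last n) := by linarith
    obtain ⟨C, hC, H⟩ := ih (q := fun i => q i.castSucc) (fun j => hq _) hl
    have base : ∀ {α : Type} [MeasurableSpace α] {μ : Measure α} [SigmaFinite μ] (F : Filt α μ),
      F.D = D → VB F (mixedLnorm (n + 1) q) (q (Fin.last n)) C := fun F hFD => mln_VB_base hl0 hC F (H F hFD)
    rcases lt_trichotomy p (q (Fin.last n)) with h | h | h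
    · obtain ⟨C', hC', H'⟩ := VB.down (Y := Fin (n + 1) → ℝ) hp h hC hD
      exact ⟨C', hC', fun F hFD => H' F hFD (mln_LN hq) (base F hFD)⟩
    · rw [h]; exact ⟨C, hC, base⟩
    · obtain ⟨C', hC', H'⟩ := VB.up (Y := Fin (n + 1) → ℝ) hl.le h hC
      exact ⟨C', hC', fun F hFD => H' F (mln_LN hq) (base F hFD)⟩

/-- Side length of cells. -/
def sz (N k : ℕ) : ℝ := 2 ^ N / 2 ^ k

/-- Cell index. -/
def ci (N k : ℕ) (t : ℝ) : ℤ := ⌊t / sz N k⌋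

lemma sz_pos (N k : ℕ) : 0 < sz N k := by unfold sz; positivity

lemma sz_succ (N k : ℕ) : sz N k = 2 * sz N (k + 1) := by unfold sz; field_simp; ring

lemma ci_iff (N k : ℕ) (t : ℝ) (m : ℤ) : ci N k t = m ↔ m * sz N k ≤ t ∧ t < (m + 1) * sz N k := by
  unfold ci
  rw [Int.floor_eq_iff, le_div_iff₀ (sz_pos N k), div_lt_iff₀ (sz_pos N k)]

lemma ci_succ {N k : ℕ} {s t : ℝ} (h : ci N (k + 1) s = ci N (k + 1) t) : ci N k s = ci N k t := by
  have key : ∀ u, ci N k u = ci N (k + 1) u / 2 := by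
    intro u
    rw [ci_iff]
    obtain ⟨h1, h2⟩ := (ci_iff N (k + 1) u _).1 rfl
    set m := ci N (k + 1) u
    rw [sz_succ]
    have hs := sz_pos N (k + 1)
    have a1 : ((m / 2 : ℤ) : ℝ) * 2 ≤ m := by
      have : (m / 2) * 2 ≤ m := by omega
      exact_mod_cast this
    have a2 : (m : ℝ) + 1 ≤ ((m / 2 : ℤ) + 1) * 2 := by
      have : m + 1 ≤ ((m / 2 : ℤ) + 1) * 2 := by omega
      exact_mod_cast this
    constructor
    · nlinarith
    · nlinarith
  rw [key, key, h]

lemma ci_meas (N k : ℕ) : Measurable (ci N k) := Int.measurable_floor.comp (measurable_id.div_const _)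

/-- Grid cell in `ℝ^n`. -/
def cell (n N : ℕ) (τ : Fin n → ℝ) (k : ℕ) (x : Fin n → ℝ) : Set (Fin n → ℝ) :=
  {y | ∀ i, ci N k (y i - τ i) = ci N k (x i - τ i)}

/-- Grid cell in `ℝ`. -/
def cell1 (N : ℕ) (τ : ℝ) (k : ℕ) (x : ℝ) : Set ℝ := {y | ci N k (y - τ) = ci N k (x - τ)}

lemma cell1_eq (N : ℕ) (τ : ℝ) (k : ℕ) (x : ℝ) : cell1 N τ k x =
    Ico (ci N k (x - τ) * sz N k + τ) ((ci N k (x - τ) + 1) * sz N k + τ) := by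
  ext y
  simp only [cell1, mem_setOf_eq, ci_iff, mem_Ico]
  constructor <;> rintro ⟨h1, h2⟩ <;> constructor <;> linarith

lemma vol_cell1 (N : ℕ) (τ : ℝ) (k : ℕ) (x : ℝ) : volume (cell1 N τ k x) = ENNReal.ofReal (sz N k) := by
  rw [cell1_eq, Real.volume_Ico]; congr 1; ring

lemma cell_eq (n N : ℕ) (τ : Fin n → ℝ) (k : ℕ) (x : Fin n → ℝ) :
    cell n N τ k x = Set.pi univ fun i => cell1 N (τ i) k (x i) := by
  ext y; simp [cell, cell1]

lemma vol_cell (n N : ℕ) (τ : Fin n → ℝ) (k : ℕ) (x : Fin n → ℝ) :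
    volume (cell n N τ k x) = ENNReal.ofReal (sz N k) ^ n := by
  rw [cell_eq, volume_pi_pi]; simp [vol_cell1]

lemma ofReal_sz_ne (N k : ℕ) : ENNReal.ofReal (sz N k) ≠ 0 := by
  simp [sz_pos]

/-- Grid filtration of `ℝ`. -/
def G1 (N : ℕ) (τ : ℝ) : Filt ℝ volume where
  P := cell1 N τ
  D := 2
  hD := by simp
  self_mem k x := rfl
  eq_of_mem k x y h := by
    ext z; simp only [cell1, mem_setOf_eq] at h ⊢; rw [h]
  anti k x y h := ci_succ h
  meas k := measurableSet_eq_fun ((ci_meas N k).comp (measurable_snd.sub_const _)) ((ci_meas N k).comp (measurable_fst.sub_const _))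
  pos k x := by rw [vol_cell1]; exact ofReal_sz_ne N k
  fin k x := by rw [vol_cell1]; exact ENNReal.ofReal_ne_top
  reg k x := by
    rw [vol_cell1, vol_cell1, sz_succ, ENNReal.ofReal_mul (by norm_num)]; simp

/-- Grid filtration of `ℝ^n`. -/
def Gn (n N : ℕ) (τ : Fin n → ℝ) : Filt (Fin n → ℝ) volume where
  P := cell n N τ
  D := 2 ^ n
  hD := by simp
  self_mem k x := fun _ => rfl
  eq_of_mem k x y h := by
    ext z; simp only [cell, mem_setOf_eq] at h ⊢; simp only [h]
  anti k x y h := fun i => ci_succ (h i)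
  meas k := by
    have e : {z : (Fin n → ℝ) × (Fin n → ℝ) | z.2 ∈ cell n N τ k z.1} =
        ⋂ i, {z | ci N k (z.2 i - τ i) = ci N k (z.1 i - τ i)} := by
      ext z; simp [cell]
    rw [e]
    refine MeasurableSet.iInter fun i => ?_
    exact measurableSet_eq_fun ((ci_meas N k).comp (((measurable_pi_apply i).comp measurable_snd).sub_const _))
      ((ci_meas N k).comp (((measurable_pi_apply i).comp measurable_fst).sub_const _))
  pos k x := by rw [vol_cell]; exact pow_ne_zero _ (ofReal_sz_ne N k)
  fin k x := by rw [vol_cell]; exact ENNReal.pow_ne_top ENNReal.ofReal_ne_top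
  reg k x := by
    rw [vol_cell, vol_cell, sz_succ, ENNReal.ofReal_mul (by norm_num), mul_pow]; simp

lemma mem_cell_snoc (n N : ℕ) (τ : Fin (n + 1) → ℝ) (k : ℕ) (y z : Fin n → ℝ) (t s : ℝ) :
    (Fin.snoc z s : Fin (n + 1) → ℝ) ∈ cell (n + 1) N τ k (Fin.snoc y t) ↔
      z ∈ cell n N (fun i => τ i.castSucc) k y ∧ s ∈ cell1 N (τ (Fin.last n)) k t := by
  simp only [cell, cell1, mem_setOf_eq, Fin.forall_fin_succ', Fin.snoc_castSucc, Fin.snoc_last]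

lemma Gn_E_succ (n N : ℕ) (τ : Fin (n + 1) → ℝ) (k : ℕ) {f : (Fin (n + 1) → ℝ) → ℝ≥0∞} (hf : Measurable f)
    (y : Fin n → ℝ) (t : ℝ) : (Gn (n + 1) N τ).E k f (Fin.snoc y t) =
      (G1 N (τ (Fin.last n))).E k (fun s => (Gn n N (fun i => τ i.castSucc)).E k (fun z => f (Fin.snoc z s)) y) t := by
  have mc := (Gn (n + 1) N τ).mP k (Fin.snoc y t)
  have mc1 := (G1 N (τ (Fin.last n))).mP k t
  have mc2 := (Gn n N (fun i => τ i.castSucc)).mP k y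
  change MeasurableSet (cell (n + 1) N τ k (Fin.snoc y t)) at mc
  change MeasurableSet (cell1 N _ k t) at mc1
  change MeasurableSet (cell n N _ k y) at mc2
  change (volume (cell (n + 1) N τ k (Fin.snoc y t)))⁻¹ * ∫⁻ x in cell (n + 1) N τ k (Fin.snoc y t), f x =
    (volume (cell1 N (τ (Fin.last n)) k t))⁻¹ * ∫⁻ s in cell1 N (τ (Fin.last n)) k t,
      (volume (cell n N (fun i => τ i.castSucc) k y))⁻¹ * ∫⁻ z in cell n N (fun i => τ i.castSucc) k y, f (Fin.snoc z s)
  rw [lintegral_const_mul' _ _ (by rw [vol_cell]; exact ENNReal.inv_ne_top.2 (pow_ne_zero _ (ofReal_sz_ne N k))), ← mul_assoc,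
    vol_cell, vol_cell, vol_cell1, pow_succ']
  rw [ENNReal.mul_inv (Or.inl (ofReal_sz_ne N k)) (Or.inl ENNReal.ofReal_ne_top)]
  congr 1
  rw [← lintegral_indicator mc, lint_succ (hf.indicator mc), ← lintegral_indicator mc1]
  congr 1 with s
  by_cases hs : s ∈ cell1 N (τ (Fin.last n)) k t
  · rw [indicator_of_mem hs, ← lintegral_indicator mc2]
    congr 1 with z
    by_cases hz : z ∈ cell n N (fun i => τ i.castSucc) k y
    · rw [indicator_of_mem hz, indicator_of_mem ((mem_cell_snoc ..).2 ⟨hz, hs⟩)]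
    · rw [indicator_of_notMem hz, indicator_of_notMem fun h => hz ((mem_cell_snoc ..).1 h).1]
  · rw [indicator_of_notMem hs]
    have : ∀ z : Fin n → ℝ, (cell (n + 1) N τ k (Fin.snoc y t)).indicator f (Fin.snoc z s) = 0 := fun z =>
      indicator_of_notMem (fun h => hs ((mem_cell_snoc ..).1 h).2) _
    simp [this]

lemma Filt.measurable_mx2s {α : Type} [MeasurableSpace α] {μ : Measure α} [SigmaFinite μ] (F : Filt α μ)
    {β : Type} [MeasurableSpace β] (K : ℕ) {g : α → β → ℝ≥0∞} (hg : Measurable (Function.uncurry g)) :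
    Measurable (Function.uncurry fun (b : β) (a : α) => F.mx K (fun s => g s b) a) := by
  have h1 := F.measurable_mx2 K hg
  generalize hG : (fun z : α × β => F.mx K (fun s => g s z.2) z.1) = G at h1
  have e : (Function.uncurry fun (b : β) (a : α) => F.mx K (fun s => g s b) a) =
      fun z : β × α => G (z.2, z.1) := by
    rw [← hG]; rfl
  rw [e]
  exact Measurable.comp h1 (measurable_snd.prodMk measurable_fst)

/-- Maximal theorem on mixed Lebesgue spaces for grid filtrations. -/
theorem T3 {n : ℕ} {q : Fin n → ℝ} (hq : ∀ j, 1 < q j) : ∃ C : ℝ≥0∞, C ≠ ⊤ ∧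
    ∀ (N K : ℕ) (τ : Fin n → ℝ) (f : (Fin n → ℝ) → ℝ≥0∞), Measurable f →
      mixedLnorm n q ((Gn n N τ).mx K f) ≤ C * mixedLnorm n q f := by
  induction n with
  | zero =>
    refine ⟨1, by simp, fun N K τ f hf => ?_⟩
    rw [mln_zero _ _ (fun i => i.elim0), mln_zero _ _ (fun i => i.elim0), one_mul]
    refine Filt.mx_le _ fun k _ => ?_
    rw [Filt.E_of_ad]
    intro x y _
    rw [Subsingleton.elim x y]
  | succ n ih =>
    have hl := hq (Fin.last n)
    have hl0 : 0 < q (Fin.last n) := by linarith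
    obtain ⟨C₁, hC₁, H₁⟩ := ih (q := fun i => q i.castSucc) (fun j => hq _)
    obtain ⟨C₂, hC₂, H₂⟩ := mln_VB (q := fun i : Fin n => q i.castSucc) (fun j => hq _) hl (D := 2) (by simp)
    refine ⟨(C₂ * C₁ ^ q (Fin.last n)) ^ (1 / q (Fin.last n)), ?_, fun N K τ f hf => ?_⟩
    · exact ENNReal.rpow_ne_top_of_nonneg (by positivity) (ENNReal.mul_ne_top hC₂ (ENNReal.rpow_ne_top_of_nonneg hl0.le hC₁))
    rw [mln_succ, mln_succ, ← ENNReal.mul_rpow_of_nonneg _ _ (by positivity)]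
    refine ENNReal.rpow_le_rpow ?_ (by positivity)
    set G := Gn n N (fun i => τ i.castSucc) with hG
    set g : ℝ → (Fin n → ℝ) → ℝ≥0∞ := fun s y => G.mx K (fun z => f (Fin.snoc z s)) y with hg
    have mfs : Measurable (Function.uncurry fun (z : Fin n → ℝ) (s : ℝ) => f (Fin.snoc z s)) :=
      hf.comp (measurable_snoc' measurable_fst measurable_snd)
    have mg : Measurable (Function.uncurry g) := by
      exact G.measurable_mx2s K mfs
    calc _ ≤ ∫⁻ t : ℝ, mixedLnorm n (fun i => q i.castSucc) (fun y => (G1 N (τ (Fin.last n))).mx K (fun s => g s y) t) ^ q (Fin.last n) := by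
          refine lintegral_mono fun t => ENNReal.rpow_le_rpow (mln_mono (fun j => by linarith [hq j.castSucc]) fun y => ?_) hl0.le
          refine Filt.mx_le _ fun k hk => ?_
          rw [Gn_E_succ n N τ k hf y t]
          refine le_trans ?_ (Filt.E_le_mx _ hk _ _)
          exact Filt.E_mono _ (fun s => G.E_le_mx hk _ _) _
      _ ≤ C₂ * ∫⁻ t : ℝ, mixedLnorm n (fun i => q i.castSucc) (g t) ^ q (Fin.last n) := H₂ _ rfl g mg K
      _ ≤ C₂ * ∫⁻ t : ℝ, C₁ ^ q (Fin.last n) * mixedLnorm n (fun i => q i.castSucc) (fun y => f (Fin.snoc y t)) ^ q (Fin.last n) := by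
          gcongr with t
          rw [← ENNReal.mul_rpow_of_nonneg _ _ hl0.le]
          exact ENNReal.rpow_le_rpow (H₁ N K _ _ mfs.of_uncurry_right) hl0.le
      _ = _ := by
          rw [lintegral_const_mul' _ _ (ENNReal.rpow_ne_top_of_nonneg hl0.le hC₁), mul_assoc]

namespace Filt
variable {α : Type} [MeasurableSpace α] {μ : Measure α} (F : Filt α μ)

lemma E_ad_E [SigmaFinite μ] {j k : ℕ} (hjk : j ≤ k) {h f : α → ℝ≥0∞} (hh : F.Ad k h) (mh : Measurable h)
    (mf : Measurable f) (x : α) : F.E j (fun y => h y * f y) x = F.E j (fun y => h y * F.E k f y) x := by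
  rw [← F.tower hjk (f := fun y => h y * f y) (mh.mul mf) x]
  congr 1; funext y
  exact F.E_ad_mul hh mf y

/-- BMO with respect to a filtration. -/
structure BM (b : α → ℝ) (β : ℕ → α → ℝ) (B : ℝ≥0∞) : Prop where
  mb : Measurable b
  mβ : ∀ k, Measurable (β k)
  ad : ∀ k, F.Ad k (β k)
  osc : ∀ k x, F.E k (fun y => edist (b y) (β k y)) x ≤ B
  fin : B ≠ ⊤
  pos : B ≠ 0

/-- Maximal oscillation from time `j`. -/
def W (β : ℕ → α → ℝ) (j l : ℕ) (x : α) : ℝ≥0∞ := ⨆ (i : ℕ) (_ : i ≤ l), edist (β (j + i) x) (β j x)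

namespace BM
variable {F} {b : α → ℝ} {β : ℕ → α → ℝ} {B : ℝ≥0∞}

section
variable (β)
lemma le_W {j i l : ℕ} (h : i ≤ l) (x : α) : edist (β (j + i) x) (β j x) ≤ W β j l x :=
  le_iSup₂ (f := fun i (_ : i ≤ l) => edist (β (j + i) x) (β j x)) i h

lemma W_zero (j : ℕ) (x : α) : W β j 0 x = 0 := by
  apply le_antisymm _ zero_le
  refine iSup₂_le fun i hi => ?_
  rw [Nat.le_zero.1 hi]; simp

lemma W_mono (j : ℕ) (x : α) : Monotone (fun l => W β j l x) := fun a c hac =>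
  iSup₂_le fun i hi => le_W β (hi.trans hac) x

lemma W_ne_top (j l : ℕ) (x : α) : W β j l x ≠ ⊤ := by
  have : W β j l x ≤ ∑ i ∈ Finset.range (l + 1), edist (β (j + i) x) (β j x) :=
    iSup₂_le fun i hi => Finset.single_le_sum (f := fun i => edist (β (j + i) x) (β j x)) (fun _ _ => zero_le)
      (Finset.mem_range.2 (Nat.lt_succ_of_le hi))
  exact ne_top_of_le_ne_top (ENNReal.sum_ne_top.2 fun i _ => edist_ne_top _ _) this

lemma W_split {j i l : ℕ} (h : i ≤ l) (x : α) : W β j l x ≤ W β j i x + W β (j + i) (l - i) x := by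
  refine iSup₂_le fun k hk => ?_
  rcases le_total k i with hki | hki
  · exact (le_W β hki x).trans le_self_add
  · have e := le_W β (j := j + i) (i := k - i) (l := l - i) (by omega) x
    rw [show j + i + (k - i) = j + k by omega] at e
    calc edist (β (j + k) x) (β j x) ≤ edist (β (j + k) x) (β (j + i) x) + edist (β (j + i) x) (β j x) := edist_triangle _ _ _
      _ ≤ _ := by rw [add_comm]; exact add_le_add (le_W β le_rfl x) e
end

variable [SigmaFinite μ]

lemma mW (H : F.BM b β B) (j l : ℕ) : Measurable (W β j l) := by
  unfold W
  exact Measurable.iSup fun i => Measurable.iSup fun _ => (H.mβ _).edist (H.mβ _)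

lemma W_ad (H : F.BM b β B) (j l : ℕ) : F.Ad (j + l) (W β j l) := by
  intro x y hy
  refine iSup_congr fun i => iSup_congr fun hi => ?_
  rw [(H.ad (j + i)).mono (by omega) x y hy, (H.ad j).mono (by omega) x y hy]

lemma mo (H : F.BM b β B) (j : ℕ) : Measurable (fun y => edist (b y) (β j y)) := H.mb.edist (H.mβ j)

lemma dist_le (H : F.BM b β B) {j k : ℕ} (hjk : j ≤ k) (x : α) :
    edist (β k x) (β j x) ≤ B + F.E k (fun y => edist (b y) (β j y)) x := by
  have ha : F.Ad k (fun y => edist (β k y) (β j y)) := fun x y hy => by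
    simp only; rw [H.ad k x y hy, (H.ad j).mono hjk x y hy]
  calc _ = F.E k (fun y => edist (β k y) (β j y)) x := (F.E_of_ad ha x).symm
    _ ≤ F.E k (fun y => edist (b y) (β k y) + edist (b y) (β j y)) x := F.E_mono (fun y => by
        rw [edist_comm (b y) (β k y)]; exact edist_triangle _ _ _) x
    _ = _ := F.E_add (H.mo k) _ x
    _ ≤ _ := add_le_add (H.osc k x) le_rfl

/-- Jump bound. -/
lemma jump (H : F.BM b β B) (k : ℕ) (x : α) : edist (β (k + 1) x) (β k x) ≤ B + F.D * B :=
  (H.dist_le (Nat.le_succ k) x).trans (add_le_add le_rfl ((F.E_reg k _ x).trans (mul_le_mul' le_rfl (H.osc k x))))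

lemma W_succ_le (H : F.BM b β B) (j i : ℕ) (x : α) : W β j (i + 1) x ≤ W β j i x + (B + F.D * B) := by
  refine (W_split β (Nat.le_succ i) x).trans (add_le_add le_rfl ?_)
  refine iSup₂_le fun k hk => ?_
  rw [show i + 1 - i = 1 by omega] at hk
  interval_cases k
  · simp
  · exact H.jump (j + i) x

open Classical in
/-- First passage indicator. -/
def χ (β : ℕ → α → ℝ) (j : ℕ) (c : ℝ≥0∞) (i : ℕ) (x : α) : ℝ≥0∞ :=
  if (∀ i' < i, edist (β (j + i') x) (β j x) ≤ c) ∧ c < edist (β (j + i) x) (β j x) then 1 else 0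

lemma χ_ad (H : F.BM b β B) (j : ℕ) (c : ℝ≥0∞) (i : ℕ) : F.Ad (j + i) (χ β j c i) := by
  intro x y hy
  have e : ∀ i' ≤ i, edist (β (j + i') y) (β j y) = edist (β (j + i') x) (β j x) := fun i' hi' => by
    rw [(H.ad (j + i')).mono (by omega) x y hy, (H.ad j).mono (by omega) x y hy]
  have : ((∀ i' < i, edist (β (j + i') y) (β j y) ≤ c) ∧ c < edist (β (j + i) y) (β j y)) ↔
    ((∀ i' < i, edist (β (j + i') x) (β j x) ≤ c) ∧ c < edist (β (j + i) x) (β j x)) := by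
    rw [e i le_rfl]
    refine and_congr_left fun _ => forall_congr' fun i' => forall_congr' fun hi' => ?_
    rw [e i' hi'.le]
  simp only [χ, this]

lemma χ_meas (H : F.BM b β B) (j : ℕ) (c : ℝ≥0∞) (i : ℕ) : Measurable (χ β j c i) := by
  classical
  unfold χ
  refine Measurable.ite ?_ measurable_const measurable_const
  have e : {x | (∀ i' < i, edist (β (j + i') x) (β j x) ≤ c) ∧ c < edist (β (j + i) x) (β j x)} =
      (⋂ i', ⋂ (_ : i' < i), {x | edist (β (j + i') x) (β j x) ≤ c}) ∩ {x | c < edist (β (j + i) x) (β j x)} := by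
    ext x; simp
  rw [e]
  exact (MeasurableSet.iInter fun i' => MeasurableSet.iInter fun _ => measurableSet_le ((H.mβ _).edist (H.mβ _)) measurable_const).inter
    (measurableSet_lt measurable_const ((H.mβ _).edist (H.mβ _)))

lemma χ_sum (β : ℕ → α → ℝ) (j : ℕ) (c : ℝ≥0∞) (l : ℕ) (x : α) : ∑ i ∈ Finset.range (l + 1), χ β j c i x ≤ 1 := by
  classical
  by_cases h : ∃ i, c < edist (β (j + i) x) (β j x)
  · have e : ∀ i ∈ Finset.range (l + 1), χ β j c i x ≤ if i = Nat.find h then 1 else 0 := by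
      intro i _
      unfold χ
      split_ifs with h1 h2 h2
      · exact le_rfl
      · exfalso
        apply h2
        refine ((Nat.find_eq_iff h).2 ⟨h1.2, fun k hk => not_lt.2 (h1.1 k hk)⟩).symm
      · exact zero_le
      · exact le_rfl
    refine (Finset.sum_le_sum e).trans ?_
    rw [Finset.sum_ite_eq']
    split_ifs <;> simp
  · have : ∀ i ∈ Finset.range (l + 1), χ β j c i x = 0 := fun i _ => by
      unfold χ; rw [if_neg]; rintro ⟨-, h2⟩; exact h ⟨i, h2⟩
    rw [Finset.sum_eq_zero this]; exact zero_le

lemma W_le_χ (H : F.BM b β B) (j : ℕ) (c : ℝ≥0∞) (l : ℕ) (x : α) : W β j l x ≤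
    c + ∑ i ∈ Finset.range (l + 1), χ β j c i x * ((B + F.D * B) + W β (j + i) (l - i) x) := by
  classical
  by_cases h : ∃ i, i ≤ l ∧ c < edist (β (j + i) x) (β j x)
  · set i := Nat.find h
    obtain ⟨hi1, hi2⟩ := Nat.find_spec h
    change i ≤ l at hi1
    change c < edist (β (j + i) x) (β j x) at hi2
    have hmin : ∀ i' < i, edist (β (j + i') x) (β j x) ≤ c := fun i' hi' => by
      have := Nat.find_min h hi'
      push Not at this
      exact this (by omega)
    have hχ : χ β j c i x = 1 := by unfold χ; rw [if_pos ⟨hmin, hi2⟩]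
    have hi0 : i ≠ 0 := by
      intro h0; rw [h0] at hi2; simp at hi2
    obtain ⟨p, hp⟩ := Nat.exists_eq_succ_of_ne_zero hi0
    have hW : W β j i x ≤ c + (B + F.D * B) := by
      rw [hp]
      refine (H.W_succ_le j p x).trans (add_le_add ?_ le_rfl)
      exact iSup₂_le fun k hk => hmin k (by omega)
    calc W β j l x ≤ W β j i x + W β (j + i) (l - i) x := W_split β hi1 x
      _ ≤ c + (χ β j c i x * ((B + F.D * B) + W β (j + i) (l - i) x)) := by
          rw [hχ, one_mul, ← add_assoc]; exact add_le_add hW le_rfl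
      _ ≤ _ := add_le_add le_rfl (Finset.single_le_sum (f := fun i => χ β j c i x * ((B + F.D * B) + W β (j + i) (l - i) x)) (fun _ _ => zero_le) (Finset.mem_range.2 (by omega)))
  · push Not at h
    exact (iSup₂_le fun i hi => h i hi).trans le_self_add


lemma χ_half (H : F.BM b β B) (j l : ℕ) (x : α) :
    ∑ i ∈ Finset.range (l + 1), F.E j (χ β j (3 * B) i) x ≤ 2⁻¹ := by
  have key : 2 * B * ∑ i ∈ Finset.range (l + 1), F.E j (χ β j (3 * B) i) x ≤ B := by
    rw [Finset.mul_sum]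
    calc _ ≤ ∑ i ∈ Finset.range (l + 1), F.E j (fun y => χ β j (3 * B) i y * edist (b y) (β j y)) x := by
          refine Finset.sum_le_sum fun i _ => ?_
          rw [← F.E_const_mul _ (H.χ_meas j _ i), F.E_ad_E (Nat.le_add_right j i) (H.χ_ad j _ i) (H.χ_meas j _ i) (H.mo j)]
          refine F.E_mono (fun y => ?_) x
          rw [mul_comm]
          by_cases hy : (∀ i' < i, edist (β (j + i') y) (β j y) ≤ 3 * B) ∧ 3 * B < edist (β (j + i) y) (β j y)
          · refine mul_le_mul' le_rfl ?_
            have h2 := hy.2.le.trans (H.dist_le (Nat.le_add_right j i) y)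
            rw [show (3 : ℝ≥0∞) * B = B + 2 * B by ring] at h2
            exact (ENNReal.add_le_add_iff_left H.fin).1 h2
          · simp [χ, hy]
      _ = F.E j (fun y => ∑ i ∈ Finset.range (l + 1), χ β j (3 * B) i y * edist (b y) (β j y)) x :=
          (F.E_sum _ (fun i _ => (H.χ_meas j _ i).mul (H.mo j)) x).symm
      _ ≤ F.E j (fun y => edist (b y) (β j y)) x := by
          refine F.E_mono (fun y => ?_) x
          rw [← Finset.sum_mul]
          exact mul_le_of_le_one_left' (χ_sum β j _ l y)
      _ ≤ B := H.osc j x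
  rw [mul_comm 2 B, mul_assoc] at key
  have k2 : (2 : ℝ≥0∞) * ∑ i ∈ Finset.range (l + 1), F.E j (χ β j (3 * B) i) x ≤ 1 := by
    rw [← ENNReal.mul_le_mul_iff_right H.pos H.fin, mul_one]; exact key
  rwa [ENNReal.le_inv_iff_mul_le, mul_comm]

/-- John–Nirenberg type bound. -/
lemma E_W (H : F.BM b β B) (l : ℕ) : ∀ (j : ℕ) (x : α), F.E j (W β j l) x ≤ 6 * B + (B + F.D * B) := by
  induction l using Nat.strong_induction_on with
  | _ l ih =>
  intro j x
  set J := B + F.D * B with hJ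
  have mterm : ∀ i, Measurable (fun y => J + W β (j + i) (l - i) y) := fun i => measurable_const.add (H.mW _ _)
  calc F.E j (W β j l) x ≤ F.E j (fun y => 3 * B + ∑ i ∈ Finset.range (l + 1), χ β j (3 * B) i y * (J + W β (j + i) (l - i) y)) x :=
        F.E_mono (fun y => H.W_le_χ j _ l y) x
    _ = 3 * B + ∑ i ∈ Finset.range (l + 1), F.E j (fun y => χ β j (3 * B) i y * (J + W β (j + i) (l - i) y)) x := by
        rw [F.E_add measurable_const, F.E_const, F.E_sum (f := fun i y => χ β j (3 * B) i y * (J + W β (j + i) (l - i) y)) _ (fun i _ => (H.χ_meas j _ i).mul (mterm i))]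
    _ ≤ 3 * B + ∑ i ∈ Finset.range (l + 1), (J + (6 * B + J)) * F.E j (χ β j (3 * B) i) x := by
        gcongr with i hi
        rw [F.E_ad_E (Nat.le_add_right j i) (H.χ_ad j _ i) (H.χ_meas j _ i) (mterm i), ← F.E_const_mul _ (H.χ_meas j _ i)]
        refine F.E_mono (fun y => ?_) x
        rw [mul_comm]
        rcases Nat.eq_zero_or_pos i with rfl | hi0
        · simp [χ]
        · refine mul_le_mul' ?_ le_rfl
          rw [F.E_add measurable_const, F.E_const]
          refine add_le_add le_rfl (ih (l - i) ?_ (j + i) y)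
          have := Finset.mem_range.1 hi
          omega
    _ ≤ 3 * B + (J + (6 * B + J)) * 2⁻¹ := by
        rw [← Finset.mul_sum]
        gcongr
        exact H.χ_half j l x
    _ = 6 * B + J := by
        rw [show J + (6 * B + J) = (3 * B + J) * 2 by ring, mul_assoc, ENNReal.mul_inv_cancel (by simp) (by simp), mul_one]
        ring

end BM
end Filt

lemma det_G {a m X : ℕ → ℝ≥0∞} (ha : Monotone a) (hfin : ∀ i, a i ≠ ⊤) (hm : Monotone m) (l : ℕ)
    (h0 : a l ≤ X 0) (h1 : ∀ i < l, a l ≤ a i + X (i + 1)) :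
    ∑ i ∈ Finset.range (l + 1), inc a i * m i ≤ ∑ i ∈ Finset.range (l + 1), inc m i * X i := by
  calc ∑ i ∈ Finset.range (l + 1), inc a i * m i
      = ∑ i ∈ Finset.Ico 0 (l + 1), ∑ i' ∈ Finset.Ico 0 (i + 1), inc m i' * inc a i := by
        rw [Finset.range_eq_Ico]
        refine Finset.sum_congr rfl fun i _ => ?_
        rw [← Finset.sum_mul, ← Finset.range_eq_Ico, sum_inc hm, mul_comm]
    _ = ∑ i' ∈ Finset.Ico 0 (l + 1), ∑ i ∈ Finset.Ico i' (l + 1), inc m i' * inc a i :=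
        (Finset.sum_Ico_Ico_comm _ _ _).symm
    _ ≤ _ := by
        rw [Finset.range_eq_Ico]
        refine Finset.sum_le_sum fun i' hi' => ?_
        rw [← Finset.mul_sum]
        refine mul_le_mul' le_rfl ?_
        cases i' with
        | zero => rw [← Finset.range_eq_Ico, sum_inc ha]; exact h0
        | succ p =>
          have hp : p + 1 < l + 1 := (Finset.mem_Ico.1 hi').2
          have e := Finset.sum_range_add_sum_Ico (inc a) hp.le
          rw [sum_inc ha, sum_inc ha] at e
          have := h1 p (by omega)
          rw [← e] at this
          exact (ENNReal.add_le_add_iff_left (hfin p)).1 this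

namespace Filt
variable {α : Type} [MeasurableSpace α] {μ : Measure α} (F : Filt α μ)

lemma inc_ad' {a : ℕ → α → ℝ≥0∞} {j : ℕ} (ha : ∀ k, F.Ad (j + k) (a k)) (k : ℕ) :
    F.Ad (j + k) (fun x => inc (fun k => a k x) k) := by
  intro x y hy
  cases k with
  | zero => exact ha 0 x y hy
  | succ k =>
    simp only [inc]
    rw [ha (k + 1) x y hy, (ha k).mono (by omega) x y hy]

/-- Supremum of the truncated maximal functions. -/
def mxs (f : α → ℝ≥0∞) (x : α) : ℝ≥0∞ := ⨆ L, F.mx L f x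

namespace BM
variable {F} {b : α → ℝ} {β : ℕ → α → ℝ} {B : ℝ≥0∞} [SigmaFinite μ]

/-- The constant. -/
def cc (F : Filt α μ) (B : ℝ≥0∞) : ℝ≥0∞ := (B + F.D * B) + (6 * B + (B + F.D * B))

lemma E_Wg (H : F.BM b β B) (j l : ℕ) {g : α → ℝ≥0∞} (mg : Measurable g) (x : α) :
    F.E j (fun y => W β j l y * g y) x ≤ cc F B * F.E j (F.mx (j + l) g) x := by
  set J := B + F.D * B with hJ
  set w : ℕ → α → ℝ≥0∞ := fun i y => inc (fun k => W β j k y) i with hw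
  set d : ℕ → α → ℝ≥0∞ := fun i y => inc (fun k => F.mx (j + k) g y) i with hd
  have mw : ∀ i, Measurable (w i) := fun i => measurable_inc (fun k => H.mW j k) i
  have md : ∀ i, Measurable (d i) := fun i => measurable_inc (a := fun k => F.mx (j + k) g) (fun k => F.measurable_mx _ mg) i
  have aw : ∀ i, F.Ad (j + i) (w i) := fun i => F.inc_ad' (fun k => H.W_ad j k) i
  have ad : ∀ i, F.Ad (j + i) (d i) := fun i => F.inc_ad' (a := fun k => F.mx (j + k) g) (fun k => F.mx_ad (j + k) g) i
  have mX : ∀ i, Measurable (fun y => J + W β (j + i) (l - i) y) := fun i => measurable_const.add (H.mW _ _)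
  have mM : ∀ i, Measurable (F.mx (j + i) g) := fun i => F.measurable_mx _ mg
  have hm : ∀ y, Monotone (fun k => F.mx (j + k) g y) := fun y a c hac => F.mx_monotone g y (by simpa using hac)
  calc F.E j (fun y => W β j l y * g y) x
      = F.E j (fun y => ∑ i ∈ Finset.range (l + 1), w i y * g y) x := by
        congr 1; funext y
        rw [← Finset.sum_mul, sum_inc (W_mono β j y)]
    _ = ∑ i ∈ Finset.range (l + 1), F.E j (fun y => w i y * g y) x :=
        F.E_sum (f := fun i y => w i y * g y) _ (fun i _ => (mw i).mul mg) x
    _ ≤ ∑ i ∈ Finset.range (l + 1), F.E j (fun y => w i y * F.mx (j + i) g y) x := by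
        refine Finset.sum_le_sum fun i _ => ?_
        rw [F.E_ad_E (Nat.le_add_right j i) (aw i) (mw i) mg]
        exact F.E_mono (fun y => mul_le_mul' le_rfl (F.E_le_mx le_rfl g y)) x
    _ = F.E j (fun y => ∑ i ∈ Finset.range (l + 1), w i y * F.mx (j + i) g y) x :=
        (F.E_sum (f := fun i y => w i y * F.mx (j + i) g y) _ (fun i _ => (mw i).mul (mM i)) x).symm
    _ ≤ F.E j (fun y => ∑ i ∈ Finset.range (l + 1), d i y * (J + W β (j + i) (l - i) y)) x := by
        refine F.E_mono (fun y => ?_) x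
        refine det_G (X := fun i => J + W β (j + i) (l - i) y) (W_mono β j y) (fun i => W_ne_top β j i y) (hm y) l ?_ ?_
        · exact le_add_self
        · intro i hi
          refine (W_split β (i := i + 1) (by omega) y).trans ?_
          exact (add_le_add (H.W_succ_le j i y) le_rfl).trans (le_of_eq (add_assoc _ _ _))
    _ = ∑ i ∈ Finset.range (l + 1), F.E j (fun y => d i y * (J + W β (j + i) (l - i) y)) x :=
        F.E_sum (f := fun i y => d i y * (J + W β (j + i) (l - i) y)) _ (fun i _ => (md i).mul (mX i)) x
    _ ≤ ∑ i ∈ Finset.range (l + 1), F.E j (fun y => cc F B * d i y) x := by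
        refine Finset.sum_le_sum fun i _ => ?_
        rw [F.E_ad_E (Nat.le_add_right j i) (ad i) (md i) (mX i)]
        refine F.E_mono (fun y => ?_) x
        rw [mul_comm]
        refine mul_le_mul' ?_ le_rfl
        rw [F.E_add measurable_const, F.E_const]
        exact add_le_add le_rfl (H.E_W (l - i) (j + i) y)
    _ = F.E j (fun y => ∑ i ∈ Finset.range (l + 1), cc F B * d i y) x :=
        (F.E_sum (f := fun i y => cc F B * d i y) _ (fun i _ => (md i).const_mul _) x).symm
    _ = F.E j (fun y => cc F B * F.mx (j + l) g y) x := by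
        congr 1; funext y
        rw [← Finset.mul_sum, sum_inc (hm y)]
    _ = _ := F.E_const_mul _ (mM l) x

/-- First part of the dyadic commutator. -/
def D1 (F : Filt α μ) (β : ℕ → α → ℝ) (K : ℕ) (f : α → ℝ≥0∞) (x : α) : ℝ≥0∞ :=
  ⨆ (k : ℕ) (_ : k ≤ K), edist (β K x) (β k x) * F.E k f x

lemma D1_meas (H : F.BM b β B) (K : ℕ) {f : α → ℝ≥0∞} (mf : Measurable f) : Measurable (D1 F β K f) := by
  unfold D1
  exact Measurable.iSup fun k => Measurable.iSup fun _ => ((H.mβ _).edist (H.mβ _)).mul (F.measurable_E k mf)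

lemma D1_le (β : ℕ → α → ℝ) (K : ℕ) (f : α → ℝ≥0∞) (x : α) : D1 F β K f x ≤
    2 * ∑ j ∈ Finset.range (K + 1), inc (fun k => F.mx k f x) j * W β j (K - j) x := by
  refine iSup₂_le fun k hk => ?_
  calc edist (β K x) (β k x) * F.E k f x ≤ edist (β K x) (β k x) * ∑ j ∈ Finset.range (k + 1), inc (fun k => F.mx k f x) j := by
        rw [sum_inc (F.mx_monotone f x)]; exact mul_le_mul' le_rfl (F.E_le_mx le_rfl f x)
    _ = ∑ j ∈ Finset.range (k + 1), edist (β K x) (β k x) * inc (fun k => F.mx k f x) j := Finset.mul_sum _ _ _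
    _ ≤ ∑ j ∈ Finset.range (k + 1), 2 * (inc (fun k => F.mx k f x) j * W β j (K - j) x) := by
        refine Finset.sum_le_sum fun j hj => ?_
        have hjk : j ≤ k := Nat.lt_succ_iff.1 (Finset.mem_range.1 hj)
        rw [mul_left_comm 2, mul_comm _ (inc _ j)]
        refine mul_le_mul' le_rfl ?_
        have e1 := le_W β (j := j) (i := K - j) (l := K - j) le_rfl x
        have e2 := le_W β (j := j) (i := k - j) (l := K - j) (by omega) x
        rw [show j + (K - j) = K by omega] at e1
        rw [show j + (k - j) = k by omega] at e2
        rw [two_mul]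
        exact (edist_triangle_right _ _ (β j x)).trans (add_le_add e1 e2)
    _ ≤ ∑ j ∈ Finset.range (K + 1), 2 * (inc (fun k => F.mx k f x) j * W β j (K - j) x) :=
        Finset.sum_le_sum_of_subset (Finset.range_mono (by omega))
    _ = _ := (Finset.mul_sum _ _ _).symm

lemma int_D1 (H : F.BM b β B) (K : ℕ) {f g : α → ℝ≥0∞} (mf : Measurable f) (mg : Measurable g) :
    ∫⁻ x, D1 F β K f x * g x ∂μ ≤ 2 * cc F B * ∫⁻ x, F.mx K f x * F.mx K (F.mx K g) x ∂μ := by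
  set d : ℕ → α → ℝ≥0∞ := fun j x => inc (fun k => F.mx k f x) j with hd
  have md : ∀ i, Measurable (d i) := fun i => measurable_inc (a := fun k => F.mx k f) (fun k => F.measurable_mx _ mf) i
  have ad : ∀ i, F.Ad i (d i) := fun i => F.inc_ad (a := fun k => F.mx k f) (fun k => F.mx_ad k f) i
  have mWg : ∀ j, Measurable (fun x => W β j (K - j) x * g x) := fun j => (H.mW _ _).mul mg
  have mMg := F.measurable_mx K mg
  have mMMg := F.measurable_mx K mMg
  calc ∫⁻ x, D1 F β K f x * g x ∂μ ≤ ∫⁻ x, ∑ j ∈ Finset.range (K + 1), 2 * (d j x * (W β j (K - j) x * g x)) ∂μ := by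
        refine lintegral_mono fun x => ?_
        refine (mul_le_mul' (D1_le β K f x) le_rfl).trans (le_of_eq ?_)
        rw [mul_assoc, Finset.sum_mul, Finset.mul_sum]
        refine Finset.sum_congr rfl fun j _ => ?_
        simp only [hd]; ring
    _ = ∑ j ∈ Finset.range (K + 1), 2 * ∫⁻ x, d j x * (W β j (K - j) x * g x) ∂μ := by
        rw [lintegral_finsetSum (f := fun j x => 2 * (d j x * (W β j (K - j) x * g x))) _ (fun j _ => ((md j).mul (mWg j)).const_mul 2)]
        refine Finset.sum_congr rfl fun j _ => ?_
        rw [lintegral_const_mul' _ _ (by simp)]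
    _ ≤ ∑ j ∈ Finset.range (K + 1), 2 * ∫⁻ x, cc F B * (d j x * F.mx K (F.mx K g) x) ∂μ := by
        refine Finset.sum_le_sum fun j hj => mul_le_mul' le_rfl ?_
        have hjK : j ≤ K := Nat.lt_succ_iff.1 (Finset.mem_range.1 hj)
        rw [← F.lintegral_ad_mul_E (ad j) (md j) (mWg j)]
        refine lintegral_mono fun x => ?_
        rw [mul_left_comm]
        refine mul_le_mul' le_rfl ((H.E_Wg j (K - j) mg x).trans (mul_le_mul' le_rfl ?_))
        rw [show j + (K - j) = K by omega]
        exact F.E_le_mx hjK _ x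
    _ = ∑ j ∈ Finset.range (K + 1), 2 * cc F B * ∫⁻ x, d j x * F.mx K (F.mx K g) x ∂μ := by
        refine Finset.sum_congr rfl fun j _ => ?_
        rw [lintegral_const_mul (f := fun x => d j x * F.mx K (F.mx K g) x) _ ((md j).mul mMMg), mul_assoc]
    _ = 2 * cc F B * ∫⁻ x, ∑ j ∈ Finset.range (K + 1), d j x * F.mx K (F.mx K g) x ∂μ := by
        rw [lintegral_finsetSum (f := fun j x => d j x * F.mx K (F.mx K g) x) _ (fun j _ => (md j).mul mMMg), Finset.mul_sum]
    _ = _ := by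
        congr 2; funext x
        rw [← Finset.sum_mul, sum_inc (F.mx_monotone f x)]

open Filter Topology in
lemma edist_mul_le (β : ℕ → α → ℝ) {x : α} (hx : Tendsto (fun k => β k x) atTop (𝓝 (b x))) (c : ℝ) (v : ℝ≥0∞) :
    edist (b x) c * v ≤ liminf (fun k => edist (β k x) c * v) atTop := by
  by_cases h : edist (b x) c = 0
  · rw [h, zero_mul]; exact zero_le
  · have t1 : Tendsto (fun k => edist (β k x) c) atTop (𝓝 (edist (b x) c)) := hx.edist tendsto_const_nhds
    exact (ENNReal.Tendsto.mul_const t1 (Or.inl h)).liminf_eq.ge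

open Filter Topology in
lemma D2_le (H : F.BM b β B) (hc : ∀ᵐ x ∂μ, Tendsto (fun k => β k x) atTop (𝓝 (b x))) (j : ℕ) {f : α → ℝ≥0∞}
    (mf : Measurable f) (x : α) :
    F.E j (fun y => edist (b y) (β j y) * f y) x ≤ cc F B * F.E j (F.mxs f) x := by
  calc _ ≤ F.E j (fun y => liminf (fun L => edist (β (L + j) y) (β j y) * f y) atTop) x := by
        refine F.E_ae_mono ?_ x
        filter_upwards [hc] with y hy
        exact edist_mul_le (fun k => β (k + j)) ((tendsto_add_atTop_iff_nat j).2 hy) (β j y) (f y)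
    _ ≤ liminf (fun L => F.E j (fun y => edist (β (L + j) y) (β j y) * f y) x) atTop :=
        F.E_liminf (f := fun L y => edist (β (L + j) y) (β j y) * f y) (fun L => ((H.mβ _).edist (H.mβ _)).mul mf) x
    _ ≤ liminf (fun _ : ℕ => cc F B * F.E j (F.mxs f) x) atTop := by
        refine liminf_le_liminf (Eventually.of_forall fun L => ?_)
        calc _ ≤ F.E j (fun y => W β j L y * f y) x := F.E_mono (fun y => mul_le_mul' (by
              rw [add_comm L j]; exact le_W β le_rfl y) le_rfl) x
          _ ≤ _ := H.E_Wg j L mf x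
          _ ≤ _ := mul_le_mul' le_rfl (F.E_mono (fun y => le_iSup (fun L => F.mx L f y) _) x)
    _ = _ := liminf_const _

/-- Dyadic maximal commutator bound. -/
def DD (F : Filt α μ) (β : ℕ → α → ℝ) (B : ℝ≥0∞) (f : α → ℝ≥0∞) (x : α) : ℝ≥0∞ :=
  Filter.liminf (fun K => D1 F β K f x) Filter.atTop + cc F B * F.mxs (F.mxs f) x

open Filter Topology in
lemma le_DD (H : F.BM b β B) (hc : ∀ᵐ x ∂μ, Tendsto (fun k => β k x) atTop (𝓝 (b x))) (k : ℕ) {f : α → ℝ≥0∞}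
    (mf : Measurable f) {x : α} (hx : Tendsto (fun k => β k x) atTop (𝓝 (b x))) :
    F.E k (fun y => edist (b x) (b y) * f y) x ≤ DD F β B f x := by
  calc _ ≤ F.E k (fun y => edist (b x) (β k x) * f y + edist (b y) (β k y) * f y) x := by
        refine F.E_mono_on x fun y hy => ?_
        rw [← add_mul, H.ad k x y hy]
        exact mul_le_mul' (edist_triangle_right _ _ _) le_rfl
    _ = edist (b x) (β k x) * F.E k f x + F.E k (fun y => edist (b y) (β k y) * f y) x := by
        rw [F.E_add (f := fun y => edist (b x) (β k x) * f y) (mf.const_mul _), F.E_const_mul _ mf]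
    _ ≤ _ := by
        refine add_le_add ?_ ((H.D2_le hc k mf x).trans (mul_le_mul' le_rfl ?_))
        · refine (edist_mul_le β hx (β k x) _).trans (liminf_le_liminf ?_)
          filter_upwards [eventually_ge_atTop k] with K hK
          exact le_iSup₂ (f := fun k (_ : k ≤ K) => edist (β K x) (β k x) * F.E k f x) k hK
        · exact (F.E_le_mx le_rfl _ x).trans (le_iSup (fun L => F.mx L (F.mxs f) x) k)

end BM

lemma mxs_meas [SigmaFinite μ] {f : α → ℝ≥0∞} (mf : Measurable f) : Measurable (F.mxs f) :=
  Measurable.iSup fun L => F.measurable_mx L mf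

lemma BM.DD_meas [SigmaFinite μ] {F : Filt α μ} {b : α → ℝ} {β : ℕ → α → ℝ} {B : ℝ≥0∞} (H : F.BM b β B) {f : α → ℝ≥0∞} (mf : Measurable f) :
    Measurable (BM.DD F β B f) :=
  (Measurable.liminf fun K => H.D1_meas K mf).add ((F.mxs_meas (F.mxs_meas mf)).const_mul _)

end Filt

lemma mln_liminf {n : ℕ} {q : Fin n → ℝ} (hq : ∀ j, 1 < q j) {h : ℕ → (Fin n → ℝ) → ℝ≥0∞} (mh : ∀ i, Measurable (h i))
    {C : ℝ≥0∞} (H : ∀ i, mixedLnorm n q (h i) ≤ C) : mixedLnorm n q (fun x => Filter.liminf (fun i => h i x) Filter.atTop) ≤ C := by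
  refine mln_dual hq (Measurable.liminf mh) fun g mg => ?_
  calc _ ≤ ∫⁻ x, Filter.liminf (fun i => h i x * g x) Filter.atTop := by
        refine lintegral_mono fun x => ?_
        have := ENNReal.le_liminf_mul (u := fun i => h i x) (v := fun _ => g x) (f := Filter.atTop)
        rwa [Filter.liminf_const] at this
    _ ≤ Filter.liminf (fun i => ∫⁻ x, h i x * g x) Filter.atTop := lintegral_liminf_le fun i => (mh i).mul mg
    _ ≤ Filter.liminf (fun _ : ℕ => C * mixedLnorm n (cj q) g) Filter.atTop :=
        Filter.liminf_le_liminf (Filter.Eventually.of_forall fun i => (mln_holder hq (mh i) mg).trans (mul_le_mul' (H i) le_rfl))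
    _ = _ := Filter.liminf_const _

lemma mxs_bound {n : ℕ} {q : Fin n → ℝ} (hq : ∀ j, 1 < q j) {C : ℝ≥0∞} {F : Filt (Fin n → ℝ) volume}
    (H : ∀ (K : ℕ) (f : (Fin n → ℝ) → ℝ≥0∞), Measurable f → mixedLnorm n q (F.mx K f) ≤ C * mixedLnorm n q f)
    {f : (Fin n → ℝ) → ℝ≥0∞} (mf : Measurable f) : mixedLnorm n q (F.mxs f) ≤ C * mixedLnorm n q f := by
  have : mixedLnorm n q (F.mxs f) = ⨆ L, mixedLnorm n q (F.mx L f) :=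
    mln_iSup (fun j => by linarith [hq j]) (fun L => F.measurable_mx L mf) (fun a c hac x => F.mx_monotone f x hac)
  rw [this]
  exact iSup_le fun L => H L f mf

theorem DD_bound {n : ℕ} {q : Fin n → ℝ} (hq : ∀ j, 1 < q j) : ∃ C : ℝ≥0∞, C ≠ ⊤ ∧
    ∀ (N : ℕ) (τ : Fin n → ℝ) (b : (Fin n → ℝ) → ℝ) (β : ℕ → (Fin n → ℝ) → ℝ) (B : ℝ≥0∞), (Gn n N τ).BM b β B →
    ∀ f : (Fin n → ℝ) → ℝ≥0∞, Measurable f →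
      mixedLnorm n q (Filt.BM.DD (Gn n N τ) β B f) ≤ C * B * mixedLnorm n q f := by
  obtain ⟨C₁, hC₁, H₁⟩ := T3 hq
  obtain ⟨C₂, hC₂, H₂⟩ := T3 (cj_gt hq)
  set c₀ : ℝ≥0∞ := (1 + 2 ^ n) + (6 + (1 + 2 ^ n)) with hc₀
  have hc₀t : c₀ ≠ ⊤ := by simp [hc₀]
  refine ⟨2 * c₀ * (C₁ * (C₂ * C₂)) + c₀ * (C₁ * C₁), ?_, fun N τ b β B H f mf => ?_⟩
  · exact ENNReal.add_ne_top.2 ⟨by finiteness, by finiteness⟩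
  set F := Gn n N τ
  have hcc : Filt.BM.cc F B = c₀ * B := by
    have : F.D = 2 ^ n := rfl
    unfold Filt.BM.cc; rw [this, hc₀]; ring
  have hccT : Filt.BM.cc F B ≠ ⊤ := by rw [hcc]; exact ENNReal.mul_ne_top hc₀t H.fin
  have h1 : ∀ K, mixedLnorm n q (Filt.BM.D1 F β K f) ≤ 2 * (c₀ * B) * (C₁ * (C₂ * C₂)) * mixedLnorm n q f := by
    intro K
    refine mln_dual hq (H.D1_meas K mf) fun g mg => (H.int_D1 K mf mg).trans ?_
    rw [hcc]
    have mMg := F.measurable_mx K mg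
    calc _ ≤ 2 * (c₀ * B) * ((C₁ * mixedLnorm n q f) * (C₂ * (C₂ * mixedLnorm n (cj q) g))) := by
          refine mul_le_mul' le_rfl ((mln_holder hq (F.measurable_mx K mf) (F.measurable_mx K mMg)).trans ?_)
          exact mul_le_mul' (H₁ N K τ f mf) ((H₂ N K τ _ mMg).trans (mul_le_mul' le_rfl (H₂ N K τ g mg)))
      _ = _ := by ring
  have h2 := mxs_bound hq (H₁ N · τ) mf
  have h3 := mxs_bound hq (H₁ N · τ) (F.mxs_meas mf)
  refine ((mln_LN hq).add (fun x => Filter.liminf (fun K => Filt.BM.D1 F β K f x) Filter.atTop)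
    (fun x => Filt.BM.cc F B * F.mxs (F.mxs f) x)
    (Measurable.liminf fun K => H.D1_meas K mf) ((F.mxs_meas (F.mxs_meas mf)).const_mul _)).trans ?_
  rw [mln_smul (fun j => by linarith [hq j]) hccT, hcc]
  calc _ ≤ 2 * (c₀ * B) * (C₁ * (C₂ * C₂)) * mixedLnorm n q f + c₀ * B * (C₁ * (C₁ * mixedLnorm n q f)) := by
        refine add_le_add (mln_liminf hq (fun K => H.D1_meas K mf) h1) (mul_le_mul' le_rfl ?_)
        exact h3.trans (mul_le_mul' le_rfl h2)
    _ = _ := by ring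

lemma eudist_cont (n : ℕ) (x : Fin n → ℝ) : Continuous (eudist n x) := by
  unfold eudist; fun_prop

lemma eball_open (n : ℕ) (x : Fin n → ℝ) (r : ℝ) : IsOpen (eball n x r) :=
  isOpen_lt (eudist_cont n x) continuous_const

lemma eball_sub (n : ℕ) (x : Fin n → ℝ) {r : ℝ} (hr : 0 < r) : eball n x r ⊆ Metric.ball x r := by
  intro y hy
  rw [Metric.mem_ball, dist_pi_lt_iff hr]
  intro i
  rw [Real.dist_eq, abs_sub_comm]
  refine lt_of_le_of_lt ?_ hy
  unfold eudist
  rw [← Real.sqrt_sq_eq_abs]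
  exact Real.sqrt_le_sqrt (Finset.single_le_sum (f := fun i => (x i - y i) ^ 2) (fun j _ => sq_nonneg _) (Finset.mem_univ i))

lemma sub_eball {n : ℕ} (hn : 0 < n) (x : Fin n → ℝ) {r : ℝ} (hr : 0 < r) : Metric.ball x (r / n) ⊆ eball n x r := by
  intro y hy
  have hn' : (0 : ℝ) < n := by exact_mod_cast hn
  rw [Metric.mem_ball, dist_pi_lt_iff (by positivity)] at hy
  show Real.sqrt _ < r
  calc Real.sqrt (∑ i, (x i - y i) ^ 2) ≤ ∑ i, |x i - y i| := by
        rw [Real.sqrt_le_left (Finset.sum_nonneg fun _ _ => abs_nonneg _)]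
        calc _ = ∑ i, |x i - y i| ^ 2 := by simp
          _ ≤ _ := Finset.sum_sq_le_sq_sum_of_nonneg fun _ _ => abs_nonneg _
    _ < ∑ i : Fin n, r / n := by
        refine Finset.sum_lt_sum_of_nonempty ⟨⟨0, hn⟩, Finset.mem_univ _⟩ fun i _ => ?_
        have := hy i
        rwa [Real.dist_eq, abs_sub_comm] at this
    _ = r := by simp; field_simp

lemma vol_eball_le (n : ℕ) (x : Fin n → ℝ) {r : ℝ} (hr : 0 < r) : volume (eball n x r) ≤ ENNReal.ofReal ((2 * r) ^ n) := by
  refine (measure_mono (eball_sub n x hr)).trans ?_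
  rw [Real.volume_pi_ball _ hr]; simp

lemma le_vol_eball {n : ℕ} (hn : 0 < n) (x : Fin n → ℝ) {r : ℝ} (hr : 0 < r) :
    ENNReal.ofReal ((2 * (r / n)) ^ n) ≤ volume (eball n x r) := by
  have hn' : (0 : ℝ) < n := by exact_mod_cast hn
  refine le_trans ?_ (measure_mono (sub_eball hn x hr))
  rw [Real.volume_pi_ball _ (by positivity)]; simp

lemma vol_eball_ne_top (n : ℕ) (x : Fin n → ℝ) {r : ℝ} (hr : 0 < r) : volume (eball n x r) ≠ ⊤ :=
  ne_top_of_le_ne_top ENNReal.ofReal_ne_top (vol_eball_le n x hr)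

lemma vol_eball_ne_zero {n : ℕ} (hn : 0 < n) (x : Fin n → ℝ) {r : ℝ} (hr : 0 < r) : volume (eball n x r) ≠ 0 := by
  have hn' : (0 : ℝ) < n := by exact_mod_cast hn
  intro h
  have := le_vol_eball hn x hr
  rw [h, nonpos_iff_eq_zero, ENNReal.ofReal_eq_zero] at this
  have : 0 < (2 * (r / n)) ^ n := by positivity
  linarith

lemma int_eball {n : ℕ} {b : (Fin n → ℝ) → ℝ} (hb : LocallyIntegrable b) (x : Fin n → ℝ) {r : ℝ} (hr : 0 < r) :
    IntegrableOn b (eball n x r) :=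
  (hb.integrableOn_isCompact (isCompact_closedBall x r)).mono_set ((eball_sub n x hr).trans Metric.ball_subset_closedBall)

lemma bmo_lint {n : ℕ} (hn : 0 < n) {b : (Fin n → ℝ) → ℝ} (hb : LocallyIntegrable b) (x : Fin n → ℝ) {r : ℝ} (hr : 0 < r) :
    ∫⁻ y in eball n x r, edist (b y) (⨍ z in eball n x r, b z) ≤ volume (eball n x r) * bmoNorm n b := by
  set c := ⨍ z in eball n x r, b z with hc
  have h0 := vol_eball_ne_zero hn x hr
  have h1 := vol_eball_ne_top n x hr
  have hi : IntegrableOn (fun y => |b y - c|) (eball n x r) :=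
    ((int_eball hb x hr).sub (integrableOn_const h1)).abs
  have h2 : ENNReal.ofReal ((volume (eball n x r)).toReal⁻¹ * ∫ y in eball n x r, |b y - c|) ≤ bmoNorm n b := by
    unfold bmoNorm
    exact le_iSup_of_le x (le_iSup_of_le r (le_iSup_of_le hr le_rfl))
  rw [ENNReal.ofReal_mul (by positivity), ENNReal.ofReal_inv_of_pos (ENNReal.toReal_pos h0 h1), ENNReal.ofReal_toReal h1,
    ofReal_integral_eq_lintegral_ofReal hi (ae_of_all _ fun y => abs_nonneg _)] at h2
  calc _ = ∫⁻ y in eball n x r, ENNReal.ofReal |b y - c| := by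
        refine lintegral_congr fun y => ?_
        rw [edist_dist, Real.dist_eq]
    _ = volume (eball n x r) * ((volume (eball n x r))⁻¹ * ∫⁻ y in eball n x r, ENNReal.ofReal |b y - c|) := by
        rw [← mul_assoc, ENNReal.mul_inv_cancel h0 h1, one_mul]
    _ ≤ _ := by gcongr

lemma avg_edist {n : ℕ} {b : (Fin n → ℝ) → ℝ} {S : Set (Fin n → ℝ)} (hb : IntegrableOn b S) (h0 : volume S ≠ 0)
    (h1 : volume S ≠ ⊤) (c : ℝ) : edist c (⨍ z in S, b z) ≤ (volume S)⁻¹ * ∫⁻ y in S, edist (b y) c := by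
  have e : (⨍ z in S, b z) - c = ⨍ z in S, (b z - c) := by
    rw [setAverage_eq, setAverage_eq, integral_sub hb (integrableOn_const h1)]
    have : (volume.real S) ≠ 0 := (ENNReal.toReal_pos h0 h1).ne'
    simp only [integral_const, smul_eq_mul, measureReal_restrict_apply_univ]
    field_simp
  rw [edist_comm, edist_eq_enorm_sub, e]
  refine (enorm_integral_le_lintegral_enorm _).trans ?_
  rw [lintegral_smul_measure]
  simp [edist_eq_enorm_sub]

lemma osc_le {n : ℕ} (hn : 0 < n) {b : (Fin n → ℝ) → ℝ} (hb : LocallyIntegrable b) {P S : Set (Fin n → ℝ)} {x : Fin n → ℝ} {r : ℝ}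
    (hr : 0 < r) (hPS : P ⊆ S) (hS : S ⊆ eball n x r) (hv : volume S = volume P) (h0 : volume P ≠ 0) {A : ℝ≥0∞}
    (hA : volume (eball n x r) ≤ A * volume P) :
    (volume P)⁻¹ * ∫⁻ y in P, edist (b y) (⨍ z in S, b z) ≤ 2 * A * bmoNorm n b := by
  have h1 : volume P ≠ ⊤ := ne_top_of_le_ne_top (vol_eball_ne_top n x hr) (measure_mono (hPS.trans hS))
  set c := ⨍ z in eball n x r, b z with hc
  set I := ∫⁻ y in eball n x r, edist (b y) c with hI
  have hIS : ∫⁻ y in S, edist (b y) c ≤ I := lintegral_mono_set hS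
  have hIP : ∫⁻ y in P, edist (b y) c ≤ I := lintegral_mono_set (hPS.trans hS)
  have k1 : edist c (⨍ z in S, b z) ≤ (volume P)⁻¹ * I := by
    rw [← hv]
    exact (avg_edist ((int_eball hb x hr).mono_set hS) (by rwa [hv]) (by rwa [hv]) c).trans (by gcongr)
  have k2 : (volume P)⁻¹ * I ≤ A * bmoNorm n b := by
    calc _ ≤ (volume P)⁻¹ * (A * volume P * bmoNorm n b) := by
          gcongr
          exact (bmo_lint hn hb x hr).trans (by gcongr)
      _ = ((volume P)⁻¹ * volume P) * (A * bmoNorm n b) := by ring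
      _ = _ := by rw [ENNReal.inv_mul_cancel h0 h1, one_mul]
  calc _ ≤ (volume P)⁻¹ * ∫⁻ y in P, (edist (b y) c + edist c (⨍ z in S, b z)) := by
        gcongr with y; exact edist_triangle _ _ _
    _ = (volume P)⁻¹ * (∫⁻ y in P, edist (b y) c) + ((volume P)⁻¹ * volume P) * edist c (⨍ z in S, b z) := by
        rw [lintegral_add_right _ measurable_const]; simp; ring
    _ ≤ (volume P)⁻¹ * I + (volume P)⁻¹ * I := by
        rw [ENNReal.inv_mul_cancel h0 h1, one_mul]; gcongr
    _ ≤ A * bmoNorm n b + A * bmoNorm n b := by gcongr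
    _ = _ := by ring

/-- Center of a grid cell. -/
def ctr (n N : ℕ) (τ : Fin n → ℝ) (k : ℕ) (v : Fin n → ℤ) : Fin n → ℝ := fun i => (v i + 1 / 2) * sz N k + τ i

/-- Cell averages. -/
def bet (n N : ℕ) (τ : Fin n → ℝ) (b : (Fin n → ℝ) → ℝ) (k : ℕ) (x : Fin n → ℝ) : ℝ :=
  ⨍ z in Metric.closedBall (ctr n N τ k fun i => ci N k (x i - τ i)) (sz N k / 2), b z

lemma bet_meas (n N : ℕ) (τ : Fin n → ℝ) (b : (Fin n → ℝ) → ℝ) (k : ℕ) : Measurable (bet n N τ b k) := by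
  have h1 : Measurable (fun v : Fin n → ℤ => ⨍ z in Metric.closedBall (ctr n N τ k v) (sz N k / 2), b z) :=
    measurable_of_countable _
  have h2 : Measurable (fun (x : Fin n → ℝ) (i : Fin n) => ci N k (x i - τ i)) :=
    measurable_pi_lambda _ fun i => (ci_meas N k).comp ((measurable_pi_apply i).sub_const _)
  exact h1.comp h2

lemma cell_sub_ctr (n N : ℕ) (τ : Fin n → ℝ) (k : ℕ) (x : Fin n → ℝ) :
    cell n N τ k x ⊆ Metric.closedBall (ctr n N τ k fun i => ci N k (x i - τ i)) (sz N k / 2) := by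
  intro y hy
  have hs := sz_pos N k
  rw [Metric.mem_closedBall, dist_pi_le_iff (by positivity)]
  intro i
  obtain ⟨h1, h2⟩ := (ci_iff N k _ _).1 (hy i)
  rw [Real.dist_eq, abs_le]
  unfold ctr
  constructor <;> nlinarith

lemma sz_tendsto (N : ℕ) : Filter.Tendsto (fun k => sz N k / 2) Filter.atTop (nhdsWithin 0 (Ioi 0)) := by
  rw [tendsto_nhdsWithin_iff]
  refine ⟨?_, Filter.Eventually.of_forall fun k => by have := sz_pos N k; simp only [mem_Ioi]; positivity⟩
  have h : Filter.Tendsto (fun k : ℕ => (2 ^ N / 2) * (1 / 2 : ℝ) ^ k) Filter.atTop (nhds ((2 ^ N / 2) * 0)) :=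
    (_root_.tendsto_pow_atTop_nhds_zero_of_lt_one (by norm_num) (by norm_num)).const_mul _
  rw [mul_zero] at h
  refine h.congr fun k => ?_
  unfold sz; rw [one_div, inv_pow]; field_simp

lemma bet_tendsto (n : ℕ) {b : (Fin n → ℝ) → ℝ} (hb : LocallyIntegrable b) : ∀ᵐ x : Fin n → ℝ,
    ∀ (N : ℕ) (τ : Fin n → ℝ), Filter.Tendsto (fun k => bet n N τ b k x) Filter.atTop (nhds (b x)) := by
  filter_upwards [IsUnifLocDoublingMeasure.ae_tendsto_average volume hb 1] with x hx N τ
  refine hx (l := Filter.atTop) (fun k => ctr n N τ k fun i => ci N k (x i - τ i)) (fun k => sz N k / 2) (sz_tendsto N) ?_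
  refine Filter.Eventually.of_forall fun k => ?_
  rw [one_mul]
  exact cell_sub_ctr n N τ k x (fun i => rfl)

/-- BMO constant for grids. -/
def An (n : ℕ) : ℝ≥0∞ := 2 * ENNReal.ofReal ((2 * n) ^ n)

lemma grid_BM {n : ℕ} (hn : 0 < n) {b : (Fin n → ℝ) → ℝ} (hb : LocallyIntegrable b) (mb : Measurable b) {B : ℝ≥0∞}
    (hB : bmoNorm n b ≤ B) (h0 : B ≠ 0) (h1 : B ≠ ⊤) (N : ℕ) (τ : Fin n → ℝ) : (Gn n N τ).BM b (bet n N τ b) (An n * B) where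
  mb := mb
  mβ := bet_meas n N τ b
  ad := by
    intro k x y hy
    have : (fun i => ci N k (y i - τ i)) = fun i => ci N k (x i - τ i) := funext hy
    unfold bet; rw [this]
  osc := by
    intro k x
    have hs := sz_pos N k
    have hn' : (0 : ℝ) < n := by exact_mod_cast hn
    have hv := vol_cell n N τ k x
    have h0 : volume (cell n N τ k x) ≠ 0 := by rw [hv]; exact pow_ne_zero _ (ofReal_sz_ne N k)
    show (volume (cell n N τ k x))⁻¹ * ∫⁻ y in cell n N τ k x, edist (b y) (bet n N τ b k y) ≤ _
    have e : ∫⁻ y in cell n N τ k x, edist (b y) (bet n N τ b k y) = ∫⁻ y in cell n N τ k x, edist (b y) (bet n N τ b k x) := by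
      refine setLIntegral_congr_fun ((Gn n N τ).mP k x) fun y hy => ?_
      have : (fun i => ci N k (y i - τ i)) = fun i => ci N k (x i - τ i) := funext hy
      show edist (b y) (bet n N τ b k y) = _
      unfold bet; rw [this]
    rw [e]
    refine (osc_le hn hb (x := ctr n N τ k fun i => ci N k (x i - τ i)) (r := n * sz N k) (A := ENNReal.ofReal ((2 * n) ^ n)) (by positivity)
      (cell_sub_ctr n N τ k x) ?_ ?_ h0 ?_).trans ?_
    · refine (Metric.closedBall_subset_ball ?_).trans (sub_eball hn _ (by positivity))
      field_simp; norm_num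
    · rw [hv, Real.volume_pi_closedBall _ (by positivity), ← ENNReal.ofReal_pow hs.le]
      simp; congr 2; ring
    · refine (vol_eball_le n _ (by positivity)).trans ?_
      rw [hv, ← ENNReal.ofReal_pow hs.le, ← ENNReal.ofReal_mul (by positivity), ← mul_pow, mul_assoc]
    · unfold An; gcongr
  fin := ENNReal.mul_ne_top (ENNReal.mul_ne_top (by simp) ENNReal.ofReal_ne_top) h1
  pos := by
    have hn' : (0 : ℝ) < n := by exact_mod_cast hn
    refine mul_ne_zero (mul_ne_zero (by simp) ?_) h0
    rw [Ne, ENNReal.ofReal_eq_zero, not_le]; positivity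

lemma ci_ne {N k : ℕ} {u v : ℝ} (h : ci N k u ≠ ci N k v) : ∃ a : ℤ, |a * sz N k - u| ≤ |v - u| := by
  have hs := sz_pos N k
  obtain ⟨u1, u2⟩ := (ci_iff N k u _).1 rfl
  obtain ⟨v1, v2⟩ := (ci_iff N k v _).1 rfl
  rcases lt_or_gt_of_ne h with h | h
  · refine ⟨ci N k v, ?_⟩
    have h' : ((ci N k u : ℤ) : ℝ) + 1 ≤ ci N k v := by exact_mod_cast h
    have : u ≤ ci N k v * sz N k := by nlinarith
    rw [abs_of_nonneg (by linarith), abs_of_nonneg (by linarith)]; linarith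
  · refine ⟨ci N k u, ?_⟩
    have h' : ((ci N k v : ℤ) : ℝ) + 1 ≤ ci N k u := by exact_mod_cast h
    have : v ≤ ci N k u * sz N k := by nlinarith
    rw [abs_of_nonpos (by linarith), abs_of_nonpos (by linarith)]; linarith

/-- Shifts of the dyadic grids. -/
def th (N : ℕ) (a : Bool) : ℝ := if a then 2 ^ N / 3 else 0

lemma third {N k : ℕ} {x r : ℝ} (h : 6 * r ≤ sz N k) :
    ∃ a : Bool, ∀ y, |y - x| < r → ci N k (y - th N a) = ci N k (x - th N a) := by
  by_contra hc
  push Not at hc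
  obtain ⟨y, hy, h1⟩ := hc true
  obtain ⟨z, hz, h2⟩ := hc false
  have hs := sz_pos N k
  obtain ⟨a, ha⟩ := ci_ne h1.symm
  obtain ⟨c, hc⟩ := ci_ne h2.symm
  simp only [th, if_true, Bool.false_eq_true, if_false, sub_zero] at ha hc
  have ha' : |a * sz N k - (x - 2 ^ N / 3)| < r := by
    refine lt_of_le_of_lt ha ?_
    have e0 : y - 2 ^ N / 3 - (x - 2 ^ N / 3) = y - x := by ring
    rwa [e0]
  have hc' := lt_of_le_of_lt hc hz
  have e : (2 : ℝ) ^ N = 2 ^ k * sz N k := by unfold sz; field_simp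
  rw [e] at ha'
  rw [abs_lt] at ha' hc'
  have k1 : (3 * (c - a) - 2 ^ k : ℝ) * sz N k < 1 * sz N k := by nlinarith
  have k2 : (-1) * sz N k < (3 * (c - a) - 2 ^ k : ℝ) * sz N k := by nlinarith
  have k1 := lt_of_mul_lt_mul_right k1 hs.le
  have k2 := lt_of_mul_lt_mul_right k2 hs.le
  have k1' : 3 * (c - a) - 2 ^ k < (1 : ℤ) := by exact_mod_cast k1
  have k2' : (-1 : ℤ) < 3 * (c - a) - 2 ^ k := by exact_mod_cast k2
  have k3 : (2 : ℤ) ^ k = 3 * (c - a) := by omega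
  have k4 : (3 : ℤ) ∣ 2 ^ k := ⟨_, k3⟩
  have k5 := Int.Prime.dvd_pow' (p := 3) (by norm_num) k4
  norm_num at k5

lemma third_n {n N k : ℕ} {x : Fin n → ℝ} {r : ℝ} (hr : 0 < r) (h : 6 * r ≤ sz N k) :
    ∃ α : Fin n → Bool, eball n x r ⊆ cell n N (fun i => th N (α i)) k x := by
  choose α hα using fun i => third (x := x i) h
  refine ⟨α, fun y hy i => hα i (y i) ?_⟩
  have := eball_sub n x hr hy
  rw [Metric.mem_ball, dist_pi_lt_iff hr] at this
  simpa [Real.dist_eq] using this i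

lemma exists_k {N : ℕ} {r : ℝ} (hr : 0 < r) (h : 6 * r ≤ 2 ^ N) : ∃ k, 6 * r ≤ sz N k ∧ sz N k ≤ 12 * r := by
  have h6 : 0 < 6 * r := by positivity
  obtain ⟨k, h1, h2⟩ := exists_nat_pow_near (x := (2 : ℝ) ^ N / (6 * r)) (y := 2) (by rwa [le_div_iff₀ h6, one_mul]) (by norm_num)
  refine ⟨k, ?_, ?_⟩
  · unfold sz
    rw [le_div_iff₀ (by positivity)]
    rw [le_div_iff₀ h6] at h1; linarith
  · unfold sz
    rw [div_le_iff₀ (by positivity)]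
    rw [div_lt_iff₀ h6, pow_succ] at h2; linarith

/-- Shifted grid. -/
def Ga (n N : ℕ) (α : Fin n → Bool) : Filt (Fin n → ℝ) volume := Gn n N (fun i => th N (α i))

/-- Transfer constant. -/
def Tn (n : ℕ) : ℝ≥0∞ := ENNReal.ofReal ((6 * n) ^ n)

lemma transfer {n : ℕ} (hn : 0 < n) {N : ℕ} (x : Fin n → ℝ) {r : ℝ} (hr : 0 < r) (h : 6 * r ≤ 2 ^ N) :
    ∃ (α : Fin n → Bool) (k : ℕ), ∀ g : (Fin n → ℝ) → ℝ≥0∞,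
      (volume (eball n x r))⁻¹ * ∫⁻ y in eball n x r, g y ≤ Tn n * (Ga n N α).E k g x := by
  obtain ⟨k, h1, h2⟩ := exists_k hr h
  obtain ⟨α, hα⟩ := third_n (x := x) hr h1
  refine ⟨α, k, fun g => ?_⟩
  have hn' : (0 : ℝ) < n := by exact_mod_cast hn
  have hs := sz_pos N k
  have hv := vol_cell n N (fun i => th N (α i)) k x
  set P := cell n N (fun i => th N (α i)) k x with hP
  have p0 : volume P ≠ 0 := by rw [hv]; exact pow_ne_zero _ (ofReal_sz_ne N k)
  have p1 : volume P ≠ ⊤ := by rw [hv]; exact ENNReal.pow_ne_top ENNReal.ofReal_ne_top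
  have b0 := vol_eball_ne_zero hn x hr
  have b1 := vol_eball_ne_top n x hr
  have hvol : volume P ≤ Tn n * volume (eball n x r) := by
    rw [hv, ← ENNReal.ofReal_pow hs.le]
    calc ENNReal.ofReal (sz N k ^ n) ≤ ENNReal.ofReal ((6 * n) ^ n * (2 * (r / n)) ^ n) := by
          refine ENNReal.ofReal_le_ofReal ?_
          rw [← mul_pow]
          refine pow_le_pow_left₀ hs.le (h2.trans (le_of_eq ?_)) _
          field_simp; norm_num
      _ = Tn n * ENNReal.ofReal ((2 * (r / n)) ^ n) := by unfold Tn; rw [ENNReal.ofReal_mul (by positivity)]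
      _ ≤ _ := by gcongr; exact le_vol_eball hn x hr
  have hinv : (volume (eball n x r))⁻¹ ≤ Tn n * (volume P)⁻¹ := by
    calc (volume (eball n x r))⁻¹ = (volume P * (volume P)⁻¹) * (volume (eball n x r))⁻¹ := by
          rw [ENNReal.mul_inv_cancel p0 p1, one_mul]
      _ ≤ (Tn n * volume (eball n x r) * (volume P)⁻¹) * (volume (eball n x r))⁻¹ := by gcongr
      _ = (Tn n * (volume P)⁻¹) * (volume (eball n x r) * (volume (eball n x r))⁻¹) := by ring
      _ = _ := by rw [ENNReal.mul_inv_cancel b0 b1, mul_one]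
  calc _ ≤ (Tn n * (volume P)⁻¹) * ∫⁻ y in P, g y := mul_le_mul' hinv (lintegral_mono_set hα)
    _ = _ := mul_assoc _ _ _

lemma ev_pow (r : ℝ) : ∀ᶠ N : ℕ in Filter.atTop, 6 * r ≤ 2 ^ N :=
  (tendsto_pow_atTop_atTop_of_one_lt (r := (2 : ℝ)) (by norm_num)).eventually_ge_atTop _

lemma Tn_ne (n : ℕ) : Tn n ≠ ⊤ := ENNReal.ofReal_ne_top

/-- Combination over the shifted grids. -/
def cmb (n : ℕ) (h : ℕ → (Fin n → Bool) → (Fin n → ℝ) → ℝ≥0∞) (x : Fin n → ℝ) : ℝ≥0∞ :=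
  Filter.liminf (fun N => Tn n * ∑ α, h N α x) Filter.atTop

lemma cmb_meas {n : ℕ} {h : ℕ → (Fin n → Bool) → (Fin n → ℝ) → ℝ≥0∞} (mh : ∀ N α, Measurable (h N α)) :
    Measurable (cmb n h) :=
  Measurable.liminf fun N => (Finset.measurable_fun_sum _ fun α _ => mh N α).const_mul _

lemma cmb_bound {n : ℕ} {q : Fin n → ℝ} (hq : ∀ j, 1 < q j) {h : ℕ → (Fin n → Bool) → (Fin n → ℝ) → ℝ≥0∞}
    (mh : ∀ N α, Measurable (h N α)) {C : ℝ≥0∞} (H : ∀ N α, mixedLnorm n q (h N α) ≤ C) :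
    mixedLnorm n q (cmb n h) ≤ Tn n * 2 ^ n * C := by
  refine mln_liminf hq (fun N => (Finset.measurable_fun_sum _ fun α _ => mh N α).const_mul _) fun N => ?_
  rw [mln_smul (fun j => by linarith [hq j]) (Tn_ne n), mul_assoc]
  gcongr
  refine ((mln_LN hq).sum Finset.univ (fun α => h N α) (mh N)).trans ?_
  calc _ ≤ ∑ α : Fin n → Bool, C := Finset.sum_le_sum fun α _ => H N α
    _ = _ := by simp

lemma le_cmb {n : ℕ} (hn : 0 < n) {h : ℕ → (Fin n → Bool) → (Fin n → ℝ) → ℝ≥0∞} {g : (Fin n → ℝ) → ℝ≥0∞} {x : Fin n → ℝ}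
    (H : ∀ N α k, (Ga n N α).E k g x ≤ h N α x) {r : ℝ} (hr : 0 < r) :
    (volume (eball n x r))⁻¹ * ∫⁻ y in eball n x r, g y ≤ cmb n h x := by
  refine Filter.le_liminf_of_le (by isBoundedDefault) ?_
  filter_upwards [ev_pow r] with N hN
  obtain ⟨α, k, hk⟩ := transfer hn x hr hN
  refine (hk g).trans ?_
  gcongr
  exact (H N α k).trans (Finset.single_le_sum (f := fun α => h N α x) (fun _ _ => zero_le) (Finset.mem_univ α))

theorem HL {n : ℕ} (hn : 0 < n) {q : Fin n → ℝ} (hq : ∀ j, 1 < q j) : ∃ C : ℝ≥0∞, C ≠ ⊤ ∧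
    ∀ f : (Fin n → ℝ) → ℝ, Measurable f → ∃ U : (Fin n → ℝ) → ℝ≥0∞, Measurable U ∧
      (∀ x, hlMax n f x ≤ U x) ∧ mixedLnorm n q U ≤ C * mixedNorm n q f := by
  obtain ⟨C, hC, H⟩ := T3 hq
  refine ⟨Tn n * 2 ^ n * C, ENNReal.mul_ne_top (ENNReal.mul_ne_top (Tn_ne n) (by simp)) hC, fun f mf => ?_⟩
  have mf' : Measurable (fun y => ENNReal.ofReal |f y|) := mf.abs.ennreal_ofReal
  set g := fun y => ENNReal.ofReal |f y| with hg
  have mm : ∀ (N : ℕ) (α : Fin n → Bool), Measurable ((Ga n N α).mxs g) := fun N α => (Ga n N α).mxs_meas mf'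
  refine ⟨cmb n fun N α => (Ga n N α).mxs g, cmb_meas mm, fun x => ?_, ?_⟩
  · refine iSup₂_le fun r hr => le_cmb hn (g := g) (fun N α k => ?_) hr
    exact ((Ga n N α).E_le_mx le_rfl _ x).trans (le_iSup (fun L => (Ga n N α).mx L g x) k)
  · refine (cmb_bound hq mm (C := C * mixedLnorm n q g) fun N α => mxs_bound hq (fun K f mf => H N K _ f mf) mf').trans (le_of_eq ?_)
    exact (mul_assoc _ _ _).symm

lemma mln_null {n : ℕ} {q : Fin n → ℝ} (hq : ∀ j, 1 < q j) {Z : Set (Fin n → ℝ)} (mZ : MeasurableSet Z) (hZ : volume Z = 0) :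
    mixedLnorm n q (Z.indicator fun _ => ⊤) = 0 := by
  rw [← nonpos_iff_eq_zero]
  refine mln_dual hq (measurable_const.indicator mZ) fun g mg => ?_
  rw [zero_mul, nonpos_iff_eq_zero]
  refine lintegral_eq_zero_of_ae_eq_zero ?_
  have : ∀ᵐ x, x ∉ Z := measure_eq_zero_iff_ae_notMem.1 hZ
  filter_upwards [this] with x hx
  simp [hx]

lemma bmo_congr {n : ℕ} {b c : (Fin n → ℝ) → ℝ} (h : b =ᵐ[volume] c) : bmoNorm n b = bmoNorm n c := by
  unfold bmoNorm
  congr! 7 with x r hr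
  have e : (⨍ z in eball n x r, b z) = ⨍ z in eball n x r, c z := average_congr (ae_restrict_of_ae h)
  refine integral_congr_ae ?_
  filter_upwards [ae_restrict_of_ae h] with y hy
  rw [e, hy]

theorem MC {n : ℕ} (hn : 0 < n) {q : Fin n → ℝ} (hq : ∀ j, 1 < q j) : ∃ C : ℝ≥0∞, C ≠ ⊤ ∧
    ∀ b : (Fin n → ℝ) → ℝ, LocallyIntegrable b → ∀ B : ℝ≥0∞, bmoNorm n b ≤ B → B ≠ 0 → B ≠ ⊤ →
    ∀ f : (Fin n → ℝ) → ℝ, Measurable f → ∃ U : (Fin n → ℝ) → ℝ≥0∞, Measurable U ∧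
      (∀ x, maxComm n b f x ≤ U x) ∧ mixedLnorm n q U ≤ C * B * mixedNorm n q f := by
  obtain ⟨C, hC, H⟩ := DD_bound hq
  refine ⟨Tn n * 2 ^ n * (C * An n), ENNReal.mul_ne_top (ENNReal.mul_ne_top (Tn_ne n) (by simp)) (ENNReal.mul_ne_top hC
    (ENNReal.mul_ne_top (by simp) ENNReal.ofReal_ne_top)), fun b₀ hb₀ B hB₀ B0 B1 f mf => ?_⟩
  obtain ⟨b, mb, hbe⟩ : ∃ b : (Fin n → ℝ) → ℝ, Measurable b ∧ b₀ =ᵐ[volume] b :=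
    ⟨hb₀.aestronglyMeasurable.mk b₀, hb₀.aestronglyMeasurable.stronglyMeasurable_mk.measurable, hb₀.aestronglyMeasurable.ae_eq_mk⟩
  have hb : LocallyIntegrable b := fun x => by
    obtain ⟨s, hs, hi⟩ := hb₀ x
    exact ⟨s, hs, hi.congr (ae_restrict_of_ae hbe)⟩
  have hB : bmoNorm n b ≤ B := by rwa [← bmo_congr hbe]
  have mf' : Measurable (fun y => ENNReal.ofReal |f y|) := mf.abs.ennreal_ofReal
  set g := fun y => ENNReal.ofReal |f y| with hg
  have hBM : ∀ (N : ℕ) (α : Fin n → Bool), (Ga n N α).BM b (bet n N (fun i => th N (α i)) b) (An n * B) :=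
    fun N α => grid_BM hn hb mb hB B0 B1 N _
  set hh : ℕ → (Fin n → Bool) → (Fin n → ℝ) → ℝ≥0∞ := fun N α =>
    Filt.BM.DD (Ga n N α) (bet n N (fun i => th N (α i)) b) (An n * B) g with hhh
  have mm : ∀ (N : ℕ) (α : Fin n → Bool), Measurable (hh N α) := fun N α => (hBM N α).DD_meas mf'
  have ht := bet_tendsto n hb
  obtain ⟨Z, hZs, mZ, hZ⟩ := exists_measurable_superset_of_null (measure_eq_zero_iff_ae_notMem.2 ((hbe.and ht).mono fun x hx => not_not.2 hx) :
    volume {x | ¬ (b₀ x = b x ∧ ∀ (N : ℕ) (τ : Fin n → ℝ), Filter.Tendsto (fun k => bet n N τ b k x) Filter.atTop (nhds (b x)))} = 0)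
  have mZi : Measurable (Z.indicator fun _ : Fin n → ℝ => (⊤ : ℝ≥0∞)) := measurable_const.indicator mZ
  refine ⟨fun x => cmb n hh x + Z.indicator (fun _ => ⊤) x, (cmb_meas mm).add mZi, fun x => ?_, ?_⟩
  · by_cases hx : x ∈ Z
    · simp [hx]
    have hx' : b₀ x = b x ∧ ∀ (N : ℕ) (τ : Fin n → ℝ), Filter.Tendsto (fun k => bet n N τ b k x) Filter.atTop (nhds (b x)) := by
      by_contra hc; exact hx (hZs hc)
    refine le_trans (iSup₂_le fun r hr => ?_) (le_add_right (le_refl (cmb n hh x)))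
    have e : ∫⁻ y in eball n x r, ENNReal.ofReal (|b₀ x - b₀ y| * |f y|) = ∫⁻ y in eball n x r, edist (b x) (b y) * g y := by
      refine lintegral_congr_ae ?_
      filter_upwards [ae_restrict_of_ae hbe] with y hy
      rw [hy, hx'.1, ENNReal.ofReal_mul (abs_nonneg _), edist_dist, Real.dist_eq]
    rw [e]
    refine le_cmb hn (g := fun y => edist (b x) (b y) * g y) (fun N α k => ?_) hr
    exact (hBM N α).le_DD (ht.mono fun x hx => hx N _) k mf' (hx'.2 N _)
  · refine ((mln_LN hq).add _ _ (cmb_meas mm) mZi).trans ?_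
    rw [mln_null hq mZ hZ, add_zero]
    refine (cmb_bound hq mm (C := C * (An n * B) * mixedLnorm n q g) fun N α => H N _ _ _ _ (hBM N α) g mf').trans (le_of_eq ?_)
    show _ = _ * mixedLnorm n q g
    ring

lemma le_of_eps {X A B : ℝ≥0∞} (hA : A ≠ ⊤) (H : ∀ ε : ℝ≥0∞, ε ≠ 0 → ε ≠ ⊤ → X ≤ A * (B + ε)) : X ≤ A * B := by
  have h1 : Filter.Tendsto (fun j : ℕ => A * (B + (j : ℝ≥0∞)⁻¹)) Filter.atTop (nhds (A * (B + 0))) :=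
    ENNReal.Tendsto.const_mul (tendsto_const_nhds.add ENNReal.tendsto_inv_nat_nhds_zero) (Or.inr hA)
  rw [add_zero] at h1
  refine ge_of_tendsto h1 ?_
  filter_upwards [Filter.eventually_ge_atTop 1] with j hj
  refine H _ (by simp) ?_
  simp; omega

lemma mmc_le {n m : ℕ} {b f : Fin m → (Fin n → ℝ) → ℝ} {B : ℝ≥0∞} (B0 : B ≠ 0) (B1 : B ≠ ⊤)
    {H U : Fin m → (Fin n → ℝ) → ℝ≥0∞} (hH : ∀ k x, maxComm n (b k) (f k) x ≤ H k x)
    (hU : ∀ k x, hlMax n (f k) x ≤ U k x) (i : Fin m) (x : Fin n → ℝ) :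
    multiMaxComm n m b i f x ≤ (B ^ (m - 1))⁻¹ * ∏ k, (H k x + B * U k x) := by
  have h1 : multiMaxComm n m b i f x ≤ H i x * ∏ k ∈ Finset.univ.erase i, U k x := by
    refine mul_le_mul' (hH i x) (iSup₂_le fun r hr => Finset.prod_le_prod' fun k _ => le_trans ?_ (hU k x))
    exact le_iSup₂ (f := fun (r : ℝ) (_ : 0 < r) => (volume (eball n x r))⁻¹ * ∫⁻ y in eball n x r, ENNReal.ofReal |f k y|) r hr
  have hp0 : B ^ (m - 1) ≠ 0 := pow_ne_zero _ B0
  have hp1 : B ^ (m - 1) ≠ ⊤ := ENNReal.pow_ne_top B1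
  calc _ ≤ _ := h1
    _ = (B ^ (m - 1))⁻¹ * (H i x * (B ^ (m - 1) * ∏ k ∈ Finset.univ.erase i, U k x)) := by
        rw [mul_left_comm (H i x), ← mul_assoc, ENNReal.inv_mul_cancel hp0 hp1, one_mul]
    _ = (B ^ (m - 1))⁻¹ * (H i x * ∏ k ∈ Finset.univ.erase i, (B * U k x)) := by
        rw [Finset.prod_mul_distrib]; simp
    _ ≤ (B ^ (m - 1))⁻¹ * ((H i x + B * U i x) * ∏ k ∈ Finset.univ.erase i, (H k x + B * U k x)) := by
        gcongr
        · exact le_self_add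
        · exact le_add_self
    _ = _ := by rw [Finset.mul_prod_erase Finset.univ (fun k => H k x + B * U k x) (Finset.mem_univ i)]

theorem main_bound {n m : ℕ} (hn : 0 < n) (hm : 2 ≤ m)
    {Q : Fin m → Fin n → ℝ} (hQ : ∀ k j, 1 < Q k j)
    {q : Fin n → ℝ} (hq0 : ∀ j, 0 < q j) (hq : ∀ j, 1 / q j = ∑ k, 1 / Q k j) : ∃ D : ℝ≥0∞, D ≠ ⊤ ∧
    ∀ b : Fin m → ((Fin n → ℝ) → ℝ), (∀ k, LocallyIntegrable (b k)) → ∀ B : ℝ≥0∞, (∀ k, bmoNorm n (b k) ≤ B) → B ≠ 0 → B ≠ ⊤ →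
    ∀ f : Fin m → ((Fin n → ℝ) → ℝ), (∀ k, Measurable (f k)) →
      mixedLnorm n q (fun x => ∑ i, multiMaxComm n m b i f x) ≤ D * B * ∏ k, mixedNorm n (Q k) (f k) := by
  choose C₁ hC₁ H₁ using fun k => HL hn (hQ k)
  choose C₂ hC₂ H₂ using fun k => MC hn (hQ k)
  refine ⟨m * ∏ k, (C₂ k + C₁ k), ENNReal.mul_ne_top (by simp) (ENNReal.prod_ne_top fun k _ => by simp [hC₁ k, hC₂ k]), ?_⟩
  intro b hb B hB B0 B1 f mf
  choose U mU hU nU using fun k => H₁ k (f k) (mf k)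
  choose V mV hV nV using fun k => H₂ k (b k) (hb k) B (hB k) B0 B1 (f k) (mf k)
  have hp0 : B ^ (m - 1) ≠ 0 := pow_ne_zero _ B0
  have hp1 : B ^ (m - 1) ≠ ⊤ := ENNReal.pow_ne_top B1
  have hc : (m : ℝ≥0∞) * (B ^ (m - 1))⁻¹ ≠ ⊤ := ENNReal.mul_ne_top (by simp) (ENNReal.inv_ne_top.2 hp0)
  calc _ ≤ mixedLnorm n q (fun x => ((m : ℝ≥0∞) * (B ^ (m - 1))⁻¹) * ∏ k, (V k x + B * U k x)) := by
        refine mln_mono hq0 fun x => ?_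
        calc _ ≤ ∑ i : Fin m, (B ^ (m - 1))⁻¹ * ∏ k, (V k x + B * U k x) :=
              Finset.sum_le_sum fun i _ => mmc_le B0 B1 hV hU i x
          _ = _ := by simp [mul_assoc]
    _ = ((m : ℝ≥0∞) * (B ^ (m - 1))⁻¹) * mixedLnorm n q (fun x => ∏ k, (V k x + B * U k x)) := mln_smul hq0 hc _
    _ ≤ ((m : ℝ≥0∞) * (B ^ (m - 1))⁻¹) * ∏ k, ((C₂ k + C₁ k) * (B * mixedNorm n (Q k) (f k))) := by
        gcongr
        refine (mln_prod (fun k j => by linarith [hQ k j]) hq0 hq (h := fun k x => V k x + B * U k x)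
          fun k => (mV k).add ((mU k).const_mul B)).trans (Finset.prod_le_prod' fun k _ => ?_)
        refine ((mln_LN (hQ k)).add _ _ (mV k) ((mU k).const_mul B)).trans ?_
        rw [mln_smul (fun j => by linarith [hQ k j]) B1]
        calc _ ≤ C₂ k * B * mixedNorm n (Q k) (f k) + B * (C₁ k * mixedNorm n (Q k) (f k)) :=
              add_le_add (nV k) (mul_le_mul' le_rfl (nU k))
          _ = _ := by ring
    _ = _ := by
        rw [Finset.prod_mul_distrib, Finset.prod_mul_distrib]
        have e : ∏ _k : Fin m, B = B ^ (m - 1) * B := by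
          simp only [Finset.prod_const, Finset.card_univ, Fintype.card_fin]
          rw [← pow_succ]; congr 1; omega
        rw [e]
        calc _ = ((B ^ (m - 1))⁻¹ * B ^ (m - 1)) * (m * (∏ k, (C₂ k + C₁ k)) * B * ∏ k, mixedNorm n (Q k) (f k)) := by ring
          _ = _ := by rw [ENNReal.inv_mul_cancel hp0 hp1, one_mul]

theorem stmt12 (n m : ℕ) (hn : 0 < n) (hm : 2 ≤ m)
    (Q : Fin m → Fin n → ℝ) (hQ : ∀ k j, 1 < Q k j)
    (q : Fin n → ℝ) (hq : ∀ j, 1 / q j = ∑ k, 1 / Q k j)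
    (b : Fin m → ((Fin n → ℝ) → ℝ))
    (hbloc : ∀ k, LocallyIntegrable (b k)) (hb : ∀ k, bmoNorm n (b k) ≠ ⊤) :
    ∃ C : ℝ, 0 < C ∧ ∀ f : Fin m → ((Fin n → ℝ) → ℝ),
      (∀ k, Measurable (f k)) → (∀ k, mixedNorm n (Q k) (f k) ≠ ⊤) →
      (∀ i : Fin m,
        mixedLnorm n q (multiMaxComm n m b i f)
          ≤ ENNReal.ofReal C * (⨆ k, bmoNorm n (b k))
              * ∏ k, mixedNorm n (Q k) (f k)) ∧
      mixedLnorm n q (fun x => ∑ i, multiMaxComm n m b i f x)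
        ≤ ENNReal.ofReal C * (⨆ k, bmoNorm n (b k))
            * ∏ k, mixedNorm n (Q k) (f k) := by
  have hq0 : ∀ j, 0 < q j := by
    intro j
    have : 0 < 1 / q j := by
      rw [hq j]
      exact Finset.sum_pos (fun k _ => by have := hQ k j; positivity) ⟨⟨0, by omega⟩, Finset.mem_univ _⟩
    exact one_div_pos.1 this
  obtain ⟨D, hD, H⟩ := main_bound hn hm hQ hq0 hq
  refine ⟨D.toReal + 1, by positivity, fun f mf hf => ?_⟩
  set B := ⨆ k, bmoNorm n (b k) with hB
  have hBt : B ≠ ⊤ := by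
    rw [hB, ← Finset.sup_univ_eq_iSup]
    exact ((Finset.sup_lt_iff (by simp)).2 fun k _ => (hb k).lt_top).ne
  have hDC : D ≤ ENNReal.ofReal (D.toReal + 1) := by
    conv_lhs => rw [← ENNReal.ofReal_toReal hD]
    exact ENNReal.ofReal_le_ofReal (by linarith)
  have hP : ∏ k, mixedNorm n (Q k) (f k) ≠ ⊤ := ENNReal.prod_ne_top fun k _ => hf k
  have key : mixedLnorm n q (fun x => ∑ i, multiMaxComm n m b i f x)
        ≤ ENNReal.ofReal (D.toReal + 1) * B * ∏ k, mixedNorm n (Q k) (f k) := by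
    have h1 := le_of_eps (X := mixedLnorm n q (fun x => ∑ i, multiMaxComm n m b i f x))
      (A := D * ∏ k, mixedNorm n (Q k) (f k)) (B := B) (ENNReal.mul_ne_top hD hP) (fun ε h0 h1 => by
        refine (H b hbloc (B + ε) (fun k => (le_iSup (fun k => bmoNorm n (b k)) k).trans le_self_add) (by simp [h0])
          (by simp [hBt, h1]) f mf).trans (le_of_eq (by ring)))
    calc _ ≤ _ := h1
      _ = D * B * ∏ k, mixedNorm n (Q k) (f k) := by ring
      _ ≤ _ := by gcongr
  refine ⟨fun i => (mln_mono hq0 fun x => ?_).trans key, key⟩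
  exact Finset.single_le_sum (f := fun i => multiMaxComm n m b i f x) (fun _ _ => zero_le) (Finset.mem_univ i)
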